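/- Assume the cost c satisfies (H1) with moreover c''(ρ) > 0 for all ρ ∈ [0,ρ_max], and the speed v satisfies (H2). Let the initial datum ρ̄ belong to BV((−1,1);[0,ρ_max]) with ‖ρ̄‖_{L^∞} < ρ_max, and assume (v_max/2)·( L·TV(ρ̄) + 3C ) < v(‖ρ̄‖_{L^∞}), where C := max{ c'(ρ)·ρ : ρ ∈ [0,‖ρ̄‖_{L^∞}] } and L := max{ c''(ρ)·ρ : ρ ∈ [0,‖ρ̄‖_{L^∞}] }. Then there exists a unique BV-regular entropy solution (ρ,ξ) of Hughes' model with initial datum ρ̄ defined globally in time. -/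

import Mathlib

open MeasureTheory Set Filter

noncomputable section

/-- The flux `f(ρ) = ρ·v(ρ)`. -/
def hughesFlux (v : ℝ → ℝ) (r : ℝ) : ℝ := r * v r

/-- The discontinuous flux `F(t,x,ρ,ξ) = sign(x − ξ(t))·f(ρ)`. -/
def hughesF (v : ℝ → ℝ) (ξ : ℝ → ℝ) (t x r : ℝ) : ℝ :=
  Real.sign (x - ξ t) * hughesFlux v r

/-- The Kruzhkov-type entropy flux `𝓕(t,x,ρ,k,ξ)`. -/
def hughesKruzhkov (v : ℝ → ℝ) (ξ : ℝ → ℝ) (t x r k : ℝ) : ℝ :=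
  Real.sign (r - k) * (hughesF v ξ t x r - hughesF v ξ t x k)

/-- Entropy solution of Hughes' model on `C = (−1,1)` with speed `v`, cost `c`,
maximal density `ρmax` and initial datum `ρ₀` (extended by `0` outside `C`). -/
structure IsEntropySol (ρmax : ℝ) (v c : ℝ → ℝ) (ρ₀ : ℝ → ℝ)
    (ρ : ℝ → ℝ → ℝ) (ξ : ℝ → ℝ) : Prop where
  meas : Measurable (Function.uncurry ρ)
  range : ∀ t x : ℝ, 0 ≤ t → ρ t x ∈ Icc 0 ρmax
  integrable : ∀ t : ℝ, 0 ≤ t → Integrable (ρ t)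
  timeCont : ∀ s : ℝ, 0 ≤ s →
    Tendsto (fun t => ∫ x : ℝ, |ρ t x - ρ s x|) (nhdsWithin s (Ici 0)) (nhds 0)
  init : ∀ᵐ x : ℝ, ρ 0 x = if x ∈ Ioo (-1 : ℝ) 1 then ρ₀ x else 0
  xi_mem : ∀ t : ℝ, ξ t ∈ Ioo (-1 : ℝ) 1
  xi_lip : ∃ L : NNReal, LipschitzOnWith L ξ (Ici 0)
  balance : ∀ᵐ t ∂(volume.restrict (Ioi (0 : ℝ))),
    ∫ y in Ioo (-1 : ℝ) (ξ t), c (ρ t y) = ∫ y in Ioo (ξ t) 1, c (ρ t y)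
  entropy : ∀ k ∈ Icc (0 : ℝ) ρmax, ∀ φ : ℝ × ℝ → ℝ,
    ContDiff ℝ (⊤ : ℕ∞) φ → HasCompactSupport φ →
    (∀ p : ℝ × ℝ, p.1 ≤ 0 → φ p = 0) → (∀ p : ℝ × ℝ, 0 ≤ φ p) →
    0 ≤ (∫ t in Ioi (0 : ℝ), ∫ x : ℝ,
          (|ρ t x - k| * (fderiv ℝ φ (t, x)) (1, 0)
            + hughesKruzhkov v ξ t x (ρ t x) k * (fderiv ℝ φ (t, x)) (0, 1)))
        + 2 * ∫ t in Ioi (0 : ℝ), hughesFlux v k * φ (t, ξ t)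

/-- BV-regular entropy solution: in addition `ρ ∈ L^∞([0,T]; BV((−1,1)))` for all `T > 0`. -/
def IsBVEntropySol (ρmax : ℝ) (v c : ℝ → ℝ) (ρ₀ : ℝ → ℝ)
    (ρ : ℝ → ℝ → ℝ) (ξ : ℝ → ℝ) : Prop :=
  IsEntropySol ρmax v c ρ₀ ρ ξ ∧
    ∀ T > (0 : ℝ), ∃ V : ENNReal, V < ⊤ ∧
      ∀ t ∈ Icc (0 : ℝ) T, eVariationOn (ρ t) (Ioo (-1 : ℝ) 1) ≤ V

/-- Assumption (H1) on the cost map, with explicit first and second derivatives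
`c'`, `c''` on `[0, ρmax]`. -/
structure CostH1 (ρmax : ℝ) (c c' c'' : ℝ → ℝ) : Prop where
  hasDeriv : ∀ x ∈ Icc (0 : ℝ) ρmax, HasDerivWithinAt c (c' x) (Icc 0 ρmax) x
  hasDeriv2 : ∀ x ∈ Icc (0 : ℝ) ρmax, HasDerivWithinAt c' (c'' x) (Icc 0 ρmax) x
  cont2 : ContinuousOn c'' (Icc 0 ρmax)
  mono : StrictMonoOn c (Icc 0 ρmax)
  one_le : ∀ x ∈ Icc (0 : ℝ) ρmax, 1 ≤ c x
  at_zero : c 0 = 1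
  second_nonneg : ∀ x ∈ Icc (0 : ℝ) ρmax, 0 ≤ c'' x

/-- Assumption (H2) on the speed map, with explicit derivative `v'` on `[0, ρmax]`. -/
structure SpeedH2 (ρmax vmax : ℝ) (v v' : ℝ → ℝ) : Prop where
  vmax_pos : 0 < vmax
  hasDeriv : ∀ x ∈ Icc (0 : ℝ) ρmax, HasDerivWithinAt v (v' x) (Icc 0 ρmax) x
  cont : ContinuousOn v' (Icc 0 ρmax)
  anti : StrictAntiOn v (Icc 0 ρmax)
  range : ∀ x ∈ Icc (0 : ℝ) ρmax, v x ∈ Icc 0 vmax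
  at_zero : v 0 = vmax
  at_max : v ρmax = 0
  hump : ∃ ρhat ∈ Ioo (0 : ℝ) ρmax, ∀ x ∈ Ioo (0 : ℝ) ρmax, x ≠ ρhat →
    0 < (v x + x * v' x) * (ρhat - x)

/-- The Kruzhkov entropy flux of a scalar flux `f`. -/
def kflux (f : ℝ → ℝ) (r k : ℝ) : ℝ := Real.sign (r - k) * (f r - f k)

lemma abs_sign_le_one (x : ℝ) : |Real.sign x| ≤ 1 := by
  rcases lt_trichotomy x 0 with h | h | h
  · simp [Real.sign_of_neg h]
  · simp [h]
  · simp [Real.sign_of_pos h]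

lemma measurable_real_sign : Measurable Real.sign := by
  unfold Real.sign
  exact Measurable.ite measurableSet_Iio measurable_const
    (Measurable.ite measurableSet_Ioi measurable_const measurable_const)

lemma kflux_self (f : ℝ → ℝ) (r : ℝ) : kflux f r r = 0 := by simp [kflux]

lemma kflux_of_le {f : ℝ → ℝ} {r k : ℝ} (h : k ≤ r) : kflux f r k = f r - f k := by
  rcases h.eq_or_lt with h | h
  · subst h; simp [kflux]
  · simp [kflux, Real.sign_of_pos (sub_pos.2 h)]

lemma kflux_of_ge {f : ℝ → ℝ} {r k : ℝ} (h : r ≤ k) : kflux f r k = f k - f r := by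
  rcases h.eq_or_lt with h | h
  · subst h; simp [kflux]
  · simp [kflux, Real.sign_of_neg (sub_neg.2 h)]

lemma kflux_comm (f : ℝ → ℝ) (r k : ℝ) : kflux f r k = kflux f k r := by
  rcases le_total r k with h | h
  · rw [kflux_of_ge h, kflux_of_le h]
  · rw [kflux_of_ge h, kflux_of_le h]

lemma abs_kflux_le {f : ℝ → ℝ} {Λ : ℝ} (hf : ∀ a b, |f a - f b| ≤ Λ * |a - b|) (r k : ℝ) :
    |kflux f r k| ≤ Λ * |r - k| := by
  unfold kflux
  rw [abs_mul]
  calc _ ≤ 1 * |f r - f k| := by gcongr; exact abs_sign_le_one _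
    _ ≤ _ := by rw [one_mul]; exact hf _ _

lemma abs_kflux_sub_le {f : ℝ → ℝ} {Λ : ℝ} (hf : ∀ a b, |f a - f b| ≤ Λ * |a - b|)
    (r k l : ℝ) : |kflux f r k - kflux f r l| ≤ Λ * |k - l| := by
  have key : ∀ a b : ℝ, a ≤ b → |f b - f a| ≤ Λ * (b - a) := fun a b h => by
    simpa [abs_of_nonneg (sub_nonneg.2 h)] using hf b a
  rcases le_total k l with hkl | hkl
  · rw [abs_of_nonpos (sub_nonpos.2 hkl)]
    have h0 := key _ _ hkl
    rcases le_total r k with h1 | h1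
    · rw [kflux_of_ge h1, kflux_of_ge (h1.trans hkl), abs_sub_comm]
      convert h0 using 1; all_goals ring_nf
    · rcases le_total r l with h2 | h2
      · rw [kflux_of_le h1, kflux_of_ge h2]
        have a1 := abs_le.1 (key _ _ h1)
        have a2 := abs_le.1 (key _ _ h2)
        rw [abs_le]; constructor <;> linarith
      · rw [kflux_of_le h1, kflux_of_le h2]
        convert h0 using 1; all_goals ring_nf
  · rw [abs_of_nonneg (sub_nonneg.2 hkl)]
    have h0 := key _ _ hkl
    rcases le_total r l with h1 | h1
    · rw [kflux_of_ge h1, kflux_of_ge (h1.trans hkl)]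
      convert h0 using 1; all_goals ring_nf
    · rcases le_total r k with h2 | h2
      · rw [kflux_of_le h1, kflux_of_ge h2]
        have a1 := abs_le.1 (key _ _ h1)
        have a2 := abs_le.1 (key _ _ h2)
        rw [abs_le]; constructor <;> linarith
      · rw [kflux_of_le h1, kflux_of_le h2, abs_sub_comm]
        convert h0 using 1; all_goals ring_nf

lemma measurable_kflux {X : Type*} [MeasurableSpace X] {f : ℝ → ℝ} (hf : Measurable f)
    {u w : X → ℝ} (hu : Measurable u) (hw : Measurable w) :
    Measurable (fun x => kflux f (u x) (w x)) :=
  (measurable_real_sign.comp (hu.sub hw)).mul ((hf.comp hu).sub (hf.comp hw))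

/-- Nonnegative smooth compactly supported functions on space-time vanishing for `t ≤ 0`. -/
structure IsTest (φ : ℝ × ℝ → ℝ) : Prop where
  smooth : ContDiff ℝ (⊤ : ℕ∞) φ
  cpt : HasCompactSupport φ
  zero : ∀ p : ℝ × ℝ, p.1 ≤ 0 → φ p = 0
  nonneg : ∀ p, 0 ≤ φ p

/-- Time derivative. -/
def dT (φ : ℝ × ℝ → ℝ) (p : ℝ × ℝ) : ℝ := fderiv ℝ φ p (1, 0)
/-- Space derivative. -/
def dX (φ : ℝ × ℝ → ℝ) (p : ℝ × ℝ) : ℝ := fderiv ℝ φ p (0, 1)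

section deriv_lemmas
variable {φ : ℝ × ℝ → ℝ}

lemma continuous_fderiv_apply (h : ContDiff ℝ (⊤ : ℕ∞) φ) (e : ℝ × ℝ) :
    Continuous (fun p => fderiv ℝ φ p e) :=
  (h.continuous_fderiv (by simp)).clm_apply continuous_const

lemma continuous_dT (h : ContDiff ℝ (⊤ : ℕ∞) φ) : Continuous (dT φ) :=
  continuous_fderiv_apply h _

lemma continuous_dX (h : ContDiff ℝ (⊤ : ℕ∞) φ) : Continuous (dX φ) :=
  continuous_fderiv_apply h _

lemma hasCompactSupport_dT (h : HasCompactSupport φ) : HasCompactSupport (dT φ) :=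
  h.fderiv_apply (𝕜 := ℝ) (1, 0)

lemma hasCompactSupport_dX (h : HasCompactSupport φ) : HasCompactSupport (dX φ) :=
  h.fderiv_apply (𝕜 := ℝ) (0, 1)

lemma hasDerivAt_dT (h : ContDiff ℝ (⊤ : ℕ∞) φ) (t x : ℝ) :
    HasDerivAt (fun s => φ (s, x)) (dT φ (t, x)) t := by
  have h1 : HasFDerivAt φ (fderiv ℝ φ (t, x)) (t, x) :=
    (h.differentiable (by simp) (t, x)).hasFDerivAt
  exact h1.comp_hasDerivAt t ((hasDerivAt_id t).prodMk (hasDerivAt_const t x))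

lemma hasDerivAt_dX (h : ContDiff ℝ (⊤ : ℕ∞) φ) (t x : ℝ) :
    HasDerivAt (fun y => φ (t, y)) (dX φ (t, x)) x := by
  have h1 : HasFDerivAt φ (fderiv ℝ φ (t, x)) (t, x) :=
    (h.differentiable (by simp) (t, x)).hasFDerivAt
  exact h1.comp_hasDerivAt x ((hasDerivAt_const x t).prodMk (hasDerivAt_id x))

lemma dT_eq_zero_of_zero (h : IsTest φ) {p : ℝ × ℝ} (hp : φ p = 0) : dT φ p = 0 := by
  have : IsLocalMin φ p := Eventually.of_forall fun q => by rw [hp]; exact h.nonneg q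
  simp [dT, this.fderiv_eq_zero]

lemma dX_eq_zero_of_zero (h : IsTest φ) {p : ℝ × ℝ} (hp : φ p = 0) : dX φ p = 0 := by
  have : IsLocalMin φ p := Eventually.of_forall fun q => by rw [hp]; exact h.nonneg q
  simp [dX, this.fderiv_eq_zero]

end deriv_lemmas

/-- Bounded measurable functions. -/
def BddMeas {X : Type*} [MeasurableSpace X] (g : X → ℝ) : Prop :=
  Measurable g ∧ ∃ B, ∀ x, |g x| ≤ B

lemma BddMeas.add {X : Type*} [MeasurableSpace X] {g h : X → ℝ} (hg : BddMeas g)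
    (hh : BddMeas h) : BddMeas (fun x => g x + h x) := by
  obtain ⟨hg, B, hB⟩ := hg
  obtain ⟨hh, B', hB'⟩ := hh
  exact ⟨hg.add hh, B + B', fun x => (abs_add_le _ _).trans (add_le_add (hB x) (hB' x))⟩

lemma BddMeas.neg {X : Type*} [MeasurableSpace X] {g : X → ℝ} (hg : BddMeas g) :
    BddMeas (fun x => -g x) := by
  obtain ⟨hg, B, hB⟩ := hg
  exact ⟨hg.neg, B, fun x => by rw [abs_neg]; exact hB x⟩

lemma BddMeas.const {X : Type*} [MeasurableSpace X] (k : ℝ) : BddMeas (fun _ : X => k) :=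
  ⟨measurable_const, |k|, fun _ => le_rfl⟩

lemma BddMeas.sub {X : Type*} [MeasurableSpace X] {g h : X → ℝ} (hg : BddMeas g)
    (hh : BddMeas h) : BddMeas (fun x => g x - h x) := by
  simpa [sub_eq_add_neg] using hg.add hh.neg

lemma BddMeas.abs {X : Type*} [MeasurableSpace X] {g : X → ℝ} (hg : BddMeas g) :
    BddMeas (fun x => |g x|) :=
  ⟨hg.1.abs, hg.2.imp fun B hB x => by rw [abs_abs]; exact hB x⟩

lemma BddMeas.kflux {X : Type*} [MeasurableSpace X] {f : ℝ → ℝ} {Λ : ℝ}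
    (hf : ∀ a b, |f a - f b| ≤ Λ * |a - b|) (hfm : Measurable f) {u w : X → ℝ} (hu : BddMeas u)
    (hw : BddMeas w) : BddMeas (fun x => kflux f (u x) (w x)) := by
  refine ⟨measurable_kflux hfm hu.1 hw.1, ?_⟩
  obtain ⟨B, hB⟩ := (hu.sub hw).2
  refine ⟨|Λ| * B, fun x => (abs_kflux_le hf _ _).trans ?_⟩
  exact mul_le_mul (le_abs_self _) (hB x) (abs_nonneg _) (abs_nonneg _)

lemma BddMeas.integrable_mul {X : Type*} [MeasurableSpace X] {μ : Measure X} {g ψ : X → ℝ}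
    (hg : BddMeas g) (hψ : Integrable ψ μ) : Integrable (fun x => g x * ψ x) μ := by
  obtain ⟨hg, B, hB⟩ := hg
  exact hψ.bdd_mul hg.aestronglyMeasurable (Eventually.of_forall hB)

lemma integrable_of_cc {X : Type*} [TopologicalSpace X] [MeasurableSpace X]
    [OpensMeasurableSpace X] {μ : Measure X} [IsFiniteMeasureOnCompacts μ]
    {ψ : X → ℝ} (h : Continuous ψ) (hc : HasCompactSupport ψ) : Integrable ψ μ :=
  h.integrable_of_hasCompactSupport hc

lemma IsTest.integrable_dT {φ : ℝ × ℝ → ℝ} (h : IsTest φ) : Integrable (dT φ) :=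
  integrable_of_cc (continuous_dT h.smooth) (hasCompactSupport_dT h.cpt)
lemma IsTest.integrable_dX {φ : ℝ × ℝ → ℝ} (h : IsTest φ) : Integrable (dX φ) :=
  integrable_of_cc (continuous_dX h.smooth) (hasCompactSupport_dX h.cpt)

/-- The differential inequality `∂ₜ D + ∂ₓ q ≤ 0` in the distributional sense on `Ω`. -/
def WeakIneq (Ω : Set (ℝ × ℝ)) (D q : ℝ × ℝ → ℝ) : Prop :=
  ∀ φ, IsTest φ → (∀ P, φ P ≠ 0 → P ∈ Ω) → 0 ≤ ∫ P, (D P * dT φ P + q P * dX φ P)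

lemma WeakIneq.mono {Ω Ω' : Set (ℝ × ℝ)} {D q : ℝ × ℝ → ℝ} (h : WeakIneq Ω D q)
    (hs : Ω' ⊆ Ω) : WeakIneq Ω' D q :=
  fun φ hφ hsup => h φ hφ fun P hP => hs (hsup P hP)

lemma weakIneq_integrable {D q : ℝ × ℝ → ℝ} (hD : BddMeas D) (hq : BddMeas q) {φ : ℝ × ℝ → ℝ}
    (hφ : IsTest φ) : Integrable (fun P => D P * dT φ P + q P * dX φ P) :=
  (hD.integrable_mul hφ.integrable_dT).add (hq.integrable_mul hφ.integrable_dX)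

lemma WeakIneq.add {Ω : Set (ℝ × ℝ)} {D q D' q' : ℝ × ℝ → ℝ} (h : WeakIneq Ω D q)
    (h' : WeakIneq Ω D' q') (hD : BddMeas D) (hq : BddMeas q) (hD' : BddMeas D')
    (hq' : BddMeas q') : WeakIneq Ω (fun P => D P + D' P) (fun P => q P + q' P) := by
  intro φ hφ hs
  have := add_nonneg (h φ hφ hs) (h' φ hφ hs)
  rw [← integral_add (weakIneq_integrable hD hq hφ) (weakIneq_integrable hD' hq' hφ)] at this
  refine this.trans_eq (integral_congr_ae (Eventually.of_forall fun P => ?_))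
  simp only; ring

lemma integral_dT_eq_zero {φ : ℝ × ℝ → ℝ} (hφ : ContDiff ℝ (⊤ : ℕ∞) φ)
    (hc : HasCompactSupport φ) : ∫ P, dT φ P = 0 := by
  have := integral_mul_fderiv_eq_neg_fderiv_mul_of_integrable (μ := (volume : Measure (ℝ × ℝ)))
    (f := fun _ => (1 : ℝ)) (g := φ) (v := (1, 0)) (by simp)
    (by simpa using integrable_of_cc (continuous_fderiv_apply hφ _) (hc.fderiv_apply (𝕜 := ℝ) _))
    (by simpa using integrable_of_cc hφ.continuous hc) (fun _ _ => differentiableAt_const _)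
    (fun _ _ => hφ.differentiable (by simp) _)
  simpa [dT] using this

lemma integral_dX_eq_zero {φ : ℝ × ℝ → ℝ} (hφ : ContDiff ℝ (⊤ : ℕ∞) φ)
    (hc : HasCompactSupport φ) : ∫ P, dX φ P = 0 := by
  have := integral_mul_fderiv_eq_neg_fderiv_mul_of_integrable (μ := (volume : Measure (ℝ × ℝ)))
    (f := fun _ => (1 : ℝ)) (g := φ) (v := (0, 1)) (by simp)
    (by simpa using integrable_of_cc (continuous_fderiv_apply hφ _) (hc.fderiv_apply (𝕜 := ℝ) _))
    (by simpa using integrable_of_cc hφ.continuous hc) (fun _ _ => differentiableAt_const _)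
    (fun _ _ => hφ.differentiable (by simp) _)
  simpa [dX] using this

lemma weakIneq_const (Ω : Set (ℝ × ℝ)) (a b : ℝ) :
    WeakIneq Ω (fun _ => a) (fun _ => b) := by
  intro φ hφ _
  rw [integral_add (hφ.integrable_dT.const_mul a) (hφ.integrable_dX.const_mul b),
    integral_const_mul, integral_const_mul, integral_dT_eq_zero hφ.smooth hφ.cpt,
    integral_dX_eq_zero hφ.smooth hφ.cpt]
  simp

lemma WeakIneq.const_mul {Ω : Set (ℝ × ℝ)} {D q : ℝ × ℝ → ℝ} (h : WeakIneq Ω D q) {a : ℝ}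
    (ha : 0 ≤ a) : WeakIneq Ω (fun P => a * D P) (fun P => a * q P) := by
  intro φ hφ hs
  have := mul_nonneg ha (h φ hφ hs)
  rw [← integral_const_mul] at this
  refine this.trans_eq (integral_congr_ae (Eventually.of_forall fun P => ?_))
  simp only; ring

lemma WeakIneq.congr {Ω : Set (ℝ × ℝ)} {D q D' q' : ℝ × ℝ → ℝ} (h : WeakIneq Ω D q)
    (h1 : ∀ P ∈ Ω, 0 < P.1 → D P = D' P) (h2 : ∀ P ∈ Ω, 0 < P.1 → q P = q' P) :
    WeakIneq Ω D' q' := by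
  intro φ hφ hs
  have := h φ hφ hs
  convert this using 2
  ext P
  by_cases hP : φ P = 0
  · simp [dT_eq_zero_of_zero hφ hP, dX_eq_zero_of_zero hφ hP]
  · have h0 : 0 < P.1 := by
      by_contra h0
      exact hP (hφ.zero P (not_lt.1 h0))
    rw [h1 P (hs P hP) h0, h2 P (hs P hP) h0]

/-- Kruzhkov's entropy inequalities for `∂ₜ u + ∂ₓ f(u) = 0` on `Ω`, with constants in
`[0, ρm]`. -/
def KruzhkovOn (f : ℝ → ℝ) (ρm : ℝ) (Ω : Set (ℝ × ℝ)) (u : ℝ × ℝ → ℝ) : Prop :=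
  ∀ k ∈ Icc 0 ρm, WeakIneq Ω (fun P => |u P - k|) (fun P => kflux f (u P) k)

lemma integrable_shear {a b : ℝ × ℝ → ℝ} (ha : Continuous a) (hb : Continuous b)
    (hac : HasCompactSupport a) (hbc : HasCompactSupport b) :
    Integrable (fun z : (ℝ × ℝ) × (ℝ × ℝ) => a z.1 * b (z.1 - z.2)) := by
  refine integrable_of_cc (by fun_prop) ?_
  refine HasCompactSupport.of_support_subset_isCompact
    (K := tsupport a ×ˢ ((fun z : (ℝ × ℝ) × (ℝ × ℝ) => z.1 - z.2) '' (tsupport a ×ˢ tsupport b)))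
    (hac.isCompact.prod ((hac.isCompact.prod hbc.isCompact).image (by fun_prop))) ?_
  intro z hz
  have h1 : a z.1 ≠ 0 := left_ne_zero_of_mul hz
  have h2 : b (z.1 - z.2) ≠ 0 := right_ne_zero_of_mul hz
  exact ⟨subset_tsupport _ h1, (z.1, z.1 - z.2), ⟨subset_tsupport _ h1, subset_tsupport _ h2⟩,
    by simp⟩

lemma dT_mul_translate {ψ Θ : ℝ × ℝ → ℝ} (hψ : ContDiff ℝ (⊤ : ℕ∞) ψ)
    (hΘ : ContDiff ℝ (⊤ : ℕ∞) Θ) (P Q e : ℝ × ℝ) :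
    fderiv ℝ (fun P => ψ P * Θ (P - Q)) P e
      = fderiv ℝ ψ P e * Θ (P - Q) + ψ P * fderiv ℝ Θ (P - Q) e := by
  have h1 : HasFDerivAt ψ (fderiv ℝ ψ P) P := (hψ.differentiable (by simp) P).hasFDerivAt
  have h2 : HasFDerivAt (fun P => Θ (P - Q))
      ((fderiv ℝ Θ (P - Q)).comp (ContinuousLinearMap.id ℝ (ℝ × ℝ))) P :=
    ((hΘ.differentiable (by simp) (P - Q)).hasFDerivAt).comp P ((hasFDerivAt_id P).sub_const Q)
  rw [show fderiv ℝ (fun P => ψ P * Θ (P - Q)) P = _ from (h1.mul h2).fderiv]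
  simp; ring

lemma dT_reflect_translate {Θ : ℝ × ℝ → ℝ} (hΘ : ContDiff ℝ (⊤ : ℕ∞) Θ) (a : ℝ)
    (P Q e : ℝ × ℝ) :
    fderiv ℝ (fun Q => a * Θ (P - Q)) Q e = -(a * fderiv ℝ Θ (P - Q) e) := by
  have h2 : HasFDerivAt (fun Q => Θ (P - Q))
      ((fderiv ℝ Θ (P - Q)).comp (-ContinuousLinearMap.id ℝ (ℝ × ℝ))) Q :=
    ((hΘ.differentiable (by simp) (P - Q)).hasFDerivAt).comp Q ((hasFDerivAt_id Q).const_sub P)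
  rw [(h2.const_mul a).fderiv]
  simp

/-- Comparison of two Kruzhkov solutions by doubling of variables. -/
theorem KruzhkovOn.doubling {f : ℝ → ℝ} {ρm Λ : ℝ} (hΛ : 0 ≤ Λ)
    (hf : ∀ a b, |f a - f b| ≤ Λ * |a - b|)
    (hfm : Measurable f) {u w : ℝ × ℝ → ℝ} (hu : Measurable u) (hw : Measurable w)
    (hur : ∀ P, u P ∈ Icc 0 ρm) (hwr : ∀ P, w P ∈ Icc 0 ρm) {Ω : Set (ℝ × ℝ)} {t1 : ℝ}
    (ht1 : 0 < t1) (hΩ : ∀ P ∈ Ω, t1 ≤ P.1) (hKu : KruzhkovOn f ρm Ω u)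
    (hKw : KruzhkovOn f ρm univ w)
    (htr : ∀ R ε : ℝ, 0 < ε → ∃ δ > 0, ∀ h : ℝ × ℝ, ‖h‖ < δ →
      ∫ P in Metric.closedBall 0 R, |w (P - h) - w P| ≤ ε) :
    WeakIneq Ω (fun P => |u P - w P|) (fun P => kflux f (u P) (w P)) := by
  intro ψ hψ hsup
  have hbu : BddMeas u := ⟨hu, ρm, fun P => by rw [abs_of_nonneg (hur P).1]; exact (hur P).2⟩
  have hbw : BddMeas w := ⟨hw, ρm, fun P => by rw [abs_of_nonneg (hwr P).1]; exact (hwr P).2⟩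
  set m : ℝ × ℝ → ℝ := fun P => |dT ψ P| + Λ * |dX ψ P| with hm
  have hmc : Continuous m :=
    (continuous_dT hψ.smooth).abs.add (continuous_const.mul (continuous_dX hψ.smooth).abs)
  have hmcc : HasCompactSupport m := by
    refine HasCompactSupport.of_support_subset_isCompact hψ.cpt.isCompact fun P hP => ?_
    by_contra h
    have h0 : ψ P = 0 := image_eq_zero_of_notMem_tsupport h
    exact hP (by simp [hm, dT_eq_zero_of_zero hψ h0, dX_eq_zero_of_zero hψ h0])
  have hm0 : ∀ P, 0 ≤ m P := fun P => by positivity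
  obtain ⟨B, hB⟩ := hmc.bounded_above_of_compact_support hmcc
  have hB0 : 0 ≤ B := (norm_nonneg _).trans (hB 0)
  obtain ⟨R, hR⟩ := hmcc.isCompact.isBounded.subset_closedBall 0
  refine le_of_forall_pos_lt_add fun ε hε => ?_
  obtain ⟨δ, hδ, hδw⟩ := htr R (ε / (B + 1)) (by positivity)
  set d := min δ t1 with hd
  have hd0 : 0 < d := lt_min hδ ht1
  let bump : ContDiffBump (0 : ℝ × ℝ) := ⟨d / 2, d, by linarith, by linarith⟩
  set Θ : ℝ × ℝ → ℝ := bump.normed volume with hΘdef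
  have hΘs : ContDiff ℝ (⊤ : ℕ∞) Θ := bump.contDiff_normed
  have hΘc : HasCompactSupport Θ := bump.hasCompactSupport_normed
  have hΘ0 : ∀ h, 0 ≤ Θ h := fun h => bump.nonneg_normed _
  have hΘ1 : ∫ h, Θ h = 1 := bump.integral_normed
  have hΘsupp : ∀ h, Θ h ≠ 0 → ‖h‖ < d := fun h hh => by
    have : h ∈ Function.support (bump.normed volume) := hh
    rw [bump.support_normed_eq] at this
    simpa using this
  set D : (ℝ × ℝ) × (ℝ × ℝ) → ℝ := fun z => |u z.1 - w z.2| with hD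
  set q : (ℝ × ℝ) × (ℝ × ℝ) → ℝ := fun z => kflux f (u z.1) (w z.2) with hq
  have hbu' : BddMeas (fun z : (ℝ × ℝ) × (ℝ × ℝ) => u z.1) :=
    ⟨hu.comp measurable_fst, hbu.2.imp fun B h z => h _⟩
  have hbw' : BddMeas (fun z : (ℝ × ℝ) × (ℝ × ℝ) => w z.2) :=
    ⟨hw.comp measurable_snd, hbw.2.imp fun B h z => h _⟩
  have hDb : BddMeas D := (hbu'.sub hbw').abs
  have hqb : BddMeas q := hbu'.kflux hf hfm hbw'
  have i1 : Integrable (fun z => D z * (dT ψ z.1 * Θ (z.1 - z.2))) :=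
    hDb.integrable_mul (integrable_shear (continuous_dT hψ.smooth) hΘs.continuous
      (hasCompactSupport_dT hψ.cpt) hΘc)
  have i2 : Integrable (fun z => D z * (ψ z.1 * dT Θ (z.1 - z.2))) :=
    hDb.integrable_mul (integrable_shear hψ.smooth.continuous (continuous_dT hΘs)
      hψ.cpt (hasCompactSupport_dT hΘc))
  have i3 : Integrable (fun z => q z * (dX ψ z.1 * Θ (z.1 - z.2))) :=
    hqb.integrable_mul (integrable_shear (continuous_dX hψ.smooth) hΘs.continuous
      (hasCompactSupport_dX hψ.cpt) hΘc)
  have i4 : Integrable (fun z => q z * (ψ z.1 * dX Θ (z.1 - z.2))) :=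
    hqb.integrable_mul (integrable_shear hψ.smooth.continuous (continuous_dX hΘs)
      hψ.cpt (hasCompactSupport_dX hΘc))
  have iA : Integrable (fun z => D z * (dT ψ z.1 * Θ (z.1 - z.2)) +
      D z * (ψ z.1 * dT Θ (z.1 - z.2)) + q z * (dX ψ z.1 * Θ (z.1 - z.2)) +
      q z * (ψ z.1 * dX Θ (z.1 - z.2))) := ((i1.add i2).add i3).add i4
  have iB : Integrable (fun z => D z * (-(ψ z.1 * dT Θ (z.1 - z.2))) +
      q z * (-(ψ z.1 * dX Θ (z.1 - z.2)))) := by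
    refine (i2.neg.add i4.neg).congr (Eventually.of_forall fun z => ?_)
    simp only [Pi.add_apply, Pi.neg_apply]; ring
  have hA : 0 ≤ ∫ z, (D z * (dT ψ z.1 * Θ (z.1 - z.2)) +
      D z * (ψ z.1 * dT Θ (z.1 - z.2)) + q z * (dX ψ z.1 * Θ (z.1 - z.2)) +
      q z * (ψ z.1 * dX Θ (z.1 - z.2))) := by
    rw [Measure.volume_eq_prod (ℝ × ℝ) (ℝ × ℝ), integral_prod_symm _ iA]
    refine integral_nonneg fun Q => ?_
    have hts : IsTest (fun P => ψ P * Θ (P - Q)) :=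
      ⟨hψ.smooth.mul (hΘs.comp (contDiff_id.sub contDiff_const)), hψ.cpt.mul_right,
        fun P hP => by simp [hψ.zero P hP], fun P => mul_nonneg (hψ.nonneg P) (hΘ0 _)⟩
    have := hKu (w Q) (hwr Q) _ hts fun P hP => hsup P (left_ne_zero_of_mul hP)
    refine this.trans_eq (integral_congr_ae (Eventually.of_forall fun P => ?_))
    simp only [dT, dX, dT_mul_translate hψ.smooth hΘs, hD, hq]
    ring
  have hBi : 0 ≤ ∫ z, (D z * (-(ψ z.1 * dT Θ (z.1 - z.2))) +
      q z * (-(ψ z.1 * dX Θ (z.1 - z.2)))) := by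
    rw [Measure.volume_eq_prod (ℝ × ℝ) (ℝ × ℝ), integral_prod _ iB]
    refine integral_nonneg fun P => ?_
    have hts : IsTest (fun Q => ψ P * Θ (P - Q)) := by
      refine ⟨contDiff_const.mul (hΘs.comp (contDiff_const.sub contDiff_id)), ?_, ?_,
        fun Q => mul_nonneg (hψ.nonneg P) (hΘ0 _)⟩
      · have : HasCompactSupport (fun Q => Θ (P - Q)) :=
          hΘc.comp_homeomorph (Homeomorph.subLeft P)
        exact this.mul_left
      · intro Q hQ
        by_contra hne
        have h1 := hΩ P (hsup P (left_ne_zero_of_mul hne))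
        have h2 := hΘsupp _ (right_ne_zero_of_mul hne)
        have h3 : |P.1 - Q.1| ≤ ‖P - Q‖ := by
          simpa using norm_fst_le (P - Q)
        have h4 := le_abs_self (P.1 - Q.1)
        have h5 : d ≤ t1 := min_le_right _ _
        linarith
    have := hKw (u P) (hur P) _ hts fun P hP => mem_univ _
    refine this.trans_eq (integral_congr_ae (Eventually.of_forall fun Q => ?_))
    simp only [dT, dX, dT_reflect_translate hΘs, hD, hq]
    rw [abs_sub_comm, kflux_comm]
  have hC : 0 ≤ ∫ z, (D z * (dT ψ z.1 * Θ (z.1 - z.2)) + q z * (dX ψ z.1 * Θ (z.1 - z.2))) := by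
    have := add_nonneg hA hBi
    rw [← integral_add iA iB] at this
    refine this.trans_eq (integral_congr_ae (Eventually.of_forall fun z => ?_))
    simp only; ring
  rw [Measure.volume_eq_prod (ℝ × ℝ) (ℝ × ℝ), integral_prod _ (show Integrable (fun z =>
    D z * (dT ψ z.1 * Θ (z.1 - z.2)) + q z * (dX ψ z.1 * Θ (z.1 - z.2))) _ from i1.add i3)] at hC
  set c : ℝ × ℝ → ℝ := fun P => |u P - w P| * dT ψ P + kflux f (u P) (w P) * dX ψ P with hc
  set c' : (ℝ × ℝ) × (ℝ × ℝ) → ℝ := fun z =>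
    |u z.1 - w (z.1 - z.2)| * (dT ψ z.1 * Θ z.2)
      + kflux f (u z.1) (w (z.1 - z.2)) * (dX ψ z.1 * Θ z.2) with hc'
  have hbw'' : BddMeas (fun z : (ℝ × ℝ) × (ℝ × ℝ) => w (z.1 - z.2)) :=
    ⟨hw.comp (measurable_fst.sub measurable_snd), hbw.2.imp fun B h z => h _⟩
  have iΘ : Integrable Θ := integrable_of_cc hΘs.continuous hΘc
  have ic' : Integrable c' :=
    ((hbu'.sub hbw'').abs.integrable_mul (hψ.integrable_dT.mul_prod iΘ)).add
      ((hbu'.kflux hf hfm hbw'').integrable_mul (hψ.integrable_dX.mul_prod iΘ))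
  have hC2 : 0 ≤ ∫ z, c' z := by
    rw [Measure.volume_eq_prod (ℝ × ℝ) (ℝ × ℝ), integral_prod _ ic']
    refine hC.trans_eq (integral_congr_ae (Eventually.of_forall fun P => ?_))
    simp only
    rw [← integral_sub_left_eq_self _ _ P]
    refine integral_congr_ae (Eventually.of_forall fun h => ?_)
    simp [hD, hq, hc']
  have ic : Integrable c := weakIneq_integrable (hbu.sub hbw).abs (hbu.kflux hf hfm hbw) hψ
  have icΘ : Integrable (fun z : (ℝ × ℝ) × (ℝ × ℝ) => c z.1 * Θ z.2) := ic.mul_prod iΘ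
  have hI : ∫ P, c P = ∫ z : (ℝ × ℝ) × (ℝ × ℝ), c z.1 * Θ z.2 := by
    rw [Measure.volume_eq_prod (ℝ × ℝ) (ℝ × ℝ), integral_prod_mul, hΘ1, mul_one]
  have imΘ : Integrable (fun z : (ℝ × ℝ) × (ℝ × ℝ) =>
      |w (z.1 - z.2) - w z.1| * (m z.1 * Θ z.2)) := by
    refine (hbw''.sub ⟨hw.comp measurable_fst, hbw.2.imp fun B h z => h _⟩).abs.integrable_mul
      ((integrable_of_cc hmc hmcc).mul_prod iΘ)
  have hdiff : (∫ z, c' z) - ∫ z : (ℝ × ℝ) × (ℝ × ℝ), c z.1 * Θ z.2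
      ≤ ∫ z : (ℝ × ℝ) × (ℝ × ℝ), |w (z.1 - z.2) - w z.1| * (m z.1 * Θ z.2) := by
    rw [← integral_sub ic' icΘ]
    refine integral_mono (ic'.sub icΘ) imΘ fun z => ?_
    simp only [hc', hc, hm]
    have e1 : |(|u z.1 - w (z.1 - z.2)| - |u z.1 - w z.1|)| ≤ |w (z.1 - z.2) - w z.1| := by
      refine (abs_abs_sub_abs_le _ _).trans_eq ?_
      rw [abs_sub_comm]; ring_nf
    have e2 := abs_kflux_sub_le hf (u z.1) (w (z.1 - z.2)) (w z.1)
    have h0 := hΘ0 z.2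
    calc _ = ((|u z.1 - w (z.1 - z.2)| - |u z.1 - w z.1|) * dT ψ z.1
          + (kflux f (u z.1) (w (z.1 - z.2)) - kflux f (u z.1) (w z.1)) * dX ψ z.1) * Θ z.2 := by
          ring
      _ ≤ (|w (z.1 - z.2) - w z.1| * |dT ψ z.1|
          + Λ * |w (z.1 - z.2) - w z.1| * |dX ψ z.1|) * Θ z.2 := by
          refine mul_le_mul_of_nonneg_right (add_le_add ?_ ?_) h0
          · refine (le_abs_self _).trans ?_
            rw [abs_mul]; gcongr
          · refine (le_abs_self _).trans ?_
            rw [abs_mul]; gcongr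
      _ = _ := by ring
  have hlast : ∫ z : (ℝ × ℝ) × (ℝ × ℝ), |w (z.1 - z.2) - w z.1| * (m z.1 * Θ z.2)
      ≤ B * (ε / (B + 1)) := by
    rw [Measure.volume_eq_prod (ℝ × ℝ) (ℝ × ℝ), integral_prod_symm _ imΘ]
    have hle : ∀ h, ∫ P, |w (P - h) - w P| * (m P * Θ h) ≤ (B * (ε / (B + 1))) * Θ h := by
      intro h
      by_cases hh : Θ h = 0
      · simp [hh]
      · have hhd := (hΘsupp h hh).trans_le (min_le_left _ _)
        have h1 := hδw h hhd
        calc ∫ P, |w (P - h) - w P| * (m P * Θ h)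
            = (∫ P, |w (P - h) - w P| * m P) * Θ h := by
              rw [← integral_mul_const]; congr 1; ext P; ring
          _ ≤ _ := by
              refine mul_le_mul_of_nonneg_right ?_ (hΘ0 h)
              calc ∫ P, |w (P - h) - w P| * m P
                  = ∫ P in Metric.closedBall 0 R, |w (P - h) - w P| * m P := by
                    refine (setIntegral_eq_integral_of_forall_compl_eq_zero fun P hP => ?_).symm
                    have : m P = 0 := image_eq_zero_of_notMem_tsupport fun hh => hP (hR hh)
                    simp [this]
                _ ≤ ∫ P in Metric.closedBall 0 R, B * |w (P - h) - w P| := by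
                    have hbd : BddMeas (fun P => |w (P - h) - w P|) :=
                      (BddMeas.sub ⟨hw.comp (measurable_id.sub_const h),
                        hbw.2.imp fun B hh z => hh _⟩ hbw).abs
                    have hfin : IsFiniteMeasure
                        ((volume : Measure (ℝ × ℝ)).restrict (Metric.closedBall 0 R)) :=
                      ⟨by simpa using (isCompact_closedBall (0 : ℝ × ℝ) R).measure_lt_top⟩
                    refine integral_mono (hbd.integrable_mul
                      (integrable_of_cc hmc hmcc).integrableOn) ?_ fun P => ?_
                    · have := (hbd.integrable_mul (μ := (volume : Measure (ℝ × ℝ)).restrict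
                        (Metric.closedBall 0 R)) (integrable_const (1 : ℝ))).const_mul B
                      simpa using this
                    · simp only
                      rw [mul_comm]
                      refine mul_le_mul_of_nonneg_right ?_ (abs_nonneg _)
                      exact (le_abs_self _).trans (hB P)
                _ ≤ _ := by
                    rw [integral_const_mul]
                    exact mul_le_mul_of_nonneg_left h1 hB0
    calc _ ≤ ∫ h, (B * (ε / (B + 1))) * Θ h :=
          integral_mono imΘ.integral_prod_right (iΘ.const_mul _) hle
      _ = _ := by rw [integral_const_mul, hΘ1, mul_one]
  have hlt : B * (ε / (B + 1)) < ε := by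
    rw [mul_div_assoc', div_lt_iff₀ (by positivity)]
    nlinarith
  rw [hI]
  linarith

/-- The mollified Heaviside function at `s` of width `ε`. -/
def stepAt (s ε : ℝ) (τ : ℝ) : ℝ := Real.smoothTransition ((τ - s) / ε)

lemma stepAt_contDiff (s ε : ℝ) : ContDiff ℝ (⊤ : ℕ∞) (stepAt s ε) :=
  Real.smoothTransition.contDiff.comp ((contDiff_id.sub contDiff_const).div_const _)

lemma stepAt_monotone (s : ℝ) {ε : ℝ} (hε : 0 < ε) : Monotone (stepAt s ε) := fun a b h =>
  Real.smoothTransition.monotone (by gcongr)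

lemma stepAt_zero {s ε τ : ℝ} (hε : 0 < ε) (h : τ ≤ s) : stepAt s ε τ = 0 :=
  Real.smoothTransition.zero_of_nonpos (div_nonpos_of_nonpos_of_nonneg (by linarith) hε.le)

lemma stepAt_one {s ε τ : ℝ} (hε : 0 < ε) (h : s + ε ≤ τ) : stepAt s ε τ = 1 :=
  Real.smoothTransition.one_of_one_le (by rw [le_div_iff₀ hε]; linarith)

lemma stepAt_nonneg (s ε τ : ℝ) : 0 ≤ stepAt s ε τ := Real.smoothTransition.nonneg _
lemma stepAt_le_one (s ε τ : ℝ) : stepAt s ε τ ≤ 1 := Real.smoothTransition.le_one _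

lemma stepAt_deriv_nonneg (s : ℝ) {ε : ℝ} (hε : 0 < ε) (τ : ℝ) : 0 ≤ deriv (stepAt s ε) τ :=
  (stepAt_monotone s hε).deriv_nonneg

lemma stepAt_deriv_eq_zero {s ε τ : ℝ} (hε : 0 < ε) (h : τ ∉ Icc s (s + ε)) :
    deriv (stepAt s ε) τ = 0 := by
  rcases lt_or_ge τ s with h1 | h1
  · have : stepAt s ε =ᶠ[nhds τ] fun _ => 0 := by
      filter_upwards [gt_mem_nhds h1] with y hy using stepAt_zero hε hy.le
    rw [this.deriv_eq]; simp
  · have h2 : s + ε < τ := by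
      by_contra h2; exact h ⟨h1, not_lt.1 h2⟩
    have : stepAt s ε =ᶠ[nhds τ] fun _ => 1 := by
      filter_upwards [lt_mem_nhds h2] with y hy using stepAt_one hε hy.le
    rw [this.deriv_eq]; simp

lemma stepAt_deriv_continuous (s ε : ℝ) : Continuous (deriv (stepAt s ε)) :=
  (stepAt_contDiff s ε).continuous_deriv (by simp)

lemma stepAt_deriv_integral {s ε : ℝ} (hε : 0 < ε) :
    ∫ τ in Icc s (s + ε), deriv (stepAt s ε) τ = 1 := by
  rw [integral_Icc_eq_integral_Ioc, ← intervalIntegral.integral_of_le (by linarith),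
    intervalIntegral.integral_deriv_eq_sub
      (fun x _ => (stepAt_contDiff s ε).differentiable (by simp) x)
      ((stepAt_deriv_continuous s ε).intervalIntegrable _ _),
    stepAt_one hε le_rfl, stepAt_zero hε le_rfl]
  simp

lemma stepAt_deriv_mul_integrable {s ε : ℝ} (hε : 0 < ε) {G : ℝ → ℝ}
    (hG : ContinuousOn G (Icc s (s + ε))) : Integrable (fun τ => deriv (stepAt s ε) τ * G τ) := by
  have h1 : IntegrableOn (fun τ => deriv (stepAt s ε) τ * G τ) (Icc s (s + ε)) :=
    ((stepAt_deriv_continuous s ε).continuousOn.mul hG).integrableOn_Icc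
  rw [integrableOn_iff_integrable_of_support_subset] at h1
  · exact h1
  · intro τ hτ
    by_contra h
    exact hτ (by simp [stepAt_deriv_eq_zero hε h])

lemma stepAt_deriv_mul_integral {s ε : ℝ} (hε : 0 < ε) (G : ℝ → ℝ) :
    ∫ τ, deriv (stepAt s ε) τ * G τ = ∫ τ in Icc s (s + ε), deriv (stepAt s ε) τ * G τ :=
  (setIntegral_eq_integral_of_forall_compl_eq_zero fun τ hτ => by
    simp [stepAt_deriv_eq_zero hε hτ]).symm

lemma abs_stepAt_deriv_mul_integral_sub {s ε : ℝ} (hε : 0 < ε) {G : ℝ → ℝ}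
    (hG : ContinuousOn G (Icc s (s + ε))) {η : ℝ} (hη : ∀ τ ∈ Icc s (s + ε), |G τ - G s| ≤ η) :
    |(∫ τ, deriv (stepAt s ε) τ * G τ) - G s| ≤ η := by
  have hi := (stepAt_deriv_mul_integrable hε hG).integrableOn (s := Icc s (s + ε))
  have hc : ∀ k : ℝ, IntegrableOn (fun τ => deriv (stepAt s ε) τ * k) (Icc s (s + ε)) := fun k =>
    (((stepAt_deriv_continuous s ε).mul continuous_const).continuousOn).integrableOn_Icc
  have e : ∀ k : ℝ, ∫ τ in Icc s (s + ε), deriv (stepAt s ε) τ * k = k := fun k => by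
    rw [integral_mul_const, stepAt_deriv_integral hε, one_mul]
  rw [stepAt_deriv_mul_integral hε]
  rw [abs_le]
  constructor
  · have := setIntegral_mono_on (hc (G s - η)) hi measurableSet_Icc fun τ hτ =>
      mul_le_mul_of_nonneg_left (by linarith [(abs_le.1 (hη τ hτ)).1])
        (stepAt_deriv_nonneg s hε τ)
    rw [e] at this
    linarith
  · have := setIntegral_mono_on hi (hc (G s + η)) measurableSet_Icc fun τ hτ =>
      mul_le_mul_of_nonneg_left (by linarith [(abs_le.1 (hη τ hτ)).2])
        (stepAt_deriv_nonneg s hε τ)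
    rw [e] at this
    linarith

lemma antitone_of_weak {G : ℝ → ℝ} {s0 : ℝ} (hG : ContinuousOn G (Ici s0))
    (h : ∀ a : ℝ → ℝ, ContDiff ℝ (⊤ : ℕ∞) a → HasCompactSupport a → (∀ τ, 0 ≤ a τ) →
      (∀ τ, a τ ≠ 0 → s0 < τ) → 0 ≤ ∫ τ, deriv a τ * G τ) {s t : ℝ} (hs : s0 ≤ s)
    (hst : s ≤ t) : G t ≤ G s := by
  rcases hst.eq_or_lt with rfl | hst
  · exact le_rfl
  refine le_of_forall_pos_le_add fun η hη => ?_
  have near : ∀ r, s0 ≤ r → ∃ δ > 0, ∀ τ, r ≤ τ → τ ≤ r + δ → |G τ - G r| ≤ η / 2 := by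
    intro r hr
    obtain ⟨δ, hδ, h1⟩ := Metric.continuousWithinAt_iff.1 (hG r hr) (η / 2) (by positivity)
    refine ⟨δ / 2, by positivity, fun τ h2 h3 => ?_⟩
    have := h1 (x := τ) (hr.trans h2) (by
      rw [Real.dist_eq, abs_of_nonneg (by linarith)]; linarith)
    rw [Real.dist_eq] at this
    exact this.le
  obtain ⟨δ1, hδ1, hn1⟩ := near s hs
  obtain ⟨δ2, hδ2, hn2⟩ := near t (hs.trans hst.le)
  set ε := min δ1 δ2 with hεd
  have hε : 0 < ε := lt_min hδ1 hδ2
  have c1 : ContinuousOn G (Icc s (s + ε)) := hG.mono fun x hx => hs.trans hx.1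
  have c2 : ContinuousOn G (Icc t (t + ε)) := hG.mono fun x hx => (hs.trans hst.le).trans hx.1
  have b1 := abs_stepAt_deriv_mul_integral_sub hε c1 (η := η / 2) fun τ hτ =>
    hn1 τ hτ.1 (hτ.2.trans (by gcongr; exact min_le_left _ _))
  have b2 := abs_stepAt_deriv_mul_integral_sub hε c2 (η := η / 2) fun τ hτ =>
    hn2 τ hτ.1 (hτ.2.trans (by gcongr; exact min_le_right _ _))
  have := h (fun τ => stepAt s ε τ - stepAt t ε τ)
    ((stepAt_contDiff s ε).sub (stepAt_contDiff t ε)) ?_ ?_ ?_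
  · have e : ∀ τ, deriv (fun τ => stepAt s ε τ - stepAt t ε τ) τ * G τ
        = deriv (stepAt s ε) τ * G τ - deriv (stepAt t ε) τ * G τ := fun τ => by
      rw [deriv_fun_sub ((stepAt_contDiff s ε).differentiable (by simp) τ)
        ((stepAt_contDiff t ε).differentiable (by simp) τ)]
      ring
    simp_rw [e] at this
    rw [integral_sub (stepAt_deriv_mul_integrable hε c1) (stepAt_deriv_mul_integrable hε c2)]
      at this
    have h1 := abs_le.1 b1
    have h2 := abs_le.1 b2
    linarith
  · refine HasCompactSupport.of_support_subset_isCompact (isCompact_Icc (a := s) (b := t + ε))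
      fun τ hτ => ?_
    by_contra hn
    apply hτ
    rcases lt_or_ge τ s with h1 | h1
    · simp [stepAt_zero hε h1.le, stepAt_zero hε (h1.le.trans hst.le)]
    · have h2 : t + ε < τ := by
        by_contra h2; exact hn ⟨h1, not_lt.1 h2⟩
      simp [stepAt_one hε h2.le, stepAt_one hε (show s + ε ≤ τ by linarith)]
  · intro τ
    refine sub_nonneg.2 (Real.smoothTransition.monotone ?_)
    gcongr
  · intro τ hτ
    by_contra hn
    apply hτ
    have h1 : τ ≤ s := (not_lt.1 hn).trans hs
    simp [stepAt_zero hε h1, stepAt_zero hε (h1.trans hst.le)]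

/-- `D` is continuous in time with values in `L¹`, for nonnegative times. -/
structure TimeL1 (D : ℝ × ℝ → ℝ) : Prop where
  int : ∀ t, 0 ≤ t → Integrable (fun x => D (t, x))
  cont : ∀ s, 0 ≤ s → Tendsto (fun t => ∫ x, |D (t, x) - D (s, x)|) (nhdsWithin s (Ici 0)) (nhds 0)

lemma continuousOn_of_tendsto_zero {N e : ℝ → ℝ → ℝ} {G : ℝ → ℝ} {S : Set ℝ}
    (h : ∀ s ∈ S, ∀ t ∈ S, |G t - G s| ≤ N s t)
    (hN : ∀ s ∈ S, Tendsto (N s) (nhdsWithin s S) (nhds 0)) : ContinuousOn G S := by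
  intro s hs
  rw [ContinuousWithinAt, tendsto_iff_dist_tendsto_zero]
  refine squeeze_zero' (Eventually.of_forall fun _ => dist_nonneg) ?_ (hN s hs)
  filter_upwards [self_mem_nhdsWithin] with t ht
  rw [Real.dist_eq]; exact h s hs t ht

lemma TimeL1.continuousOn_norm {D : ℝ × ℝ → ℝ} (h : TimeL1 D) :
    ContinuousOn (fun t => ∫ x, |D (t, x)|) (Ici 0) := by
  refine continuousOn_of_tendsto_zero (e := fun _ _ => 0)
    (N := fun s t => ∫ x, |D (t, x) - D (s, x)|) (fun s hs t ht => ?_) h.cont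
  rw [← integral_sub (h.int t ht).abs (h.int s hs).abs]
  refine (abs_integral_le_integral_abs).trans (integral_mono
    ((h.int t ht).abs.sub (h.int s hs).abs).abs ((h.int t ht).sub (h.int s hs)).abs fun x => ?_)
  exact abs_abs_sub_abs_le _ _

lemma TimeL1.mul_integrable {D : ℝ × ℝ → ℝ} (h : TimeL1 D) {χ : ℝ → ℝ} (hχ : Continuous χ)
    (h0 : ∀ z, |χ z| ≤ 1) {t : ℝ} (ht : 0 ≤ t) (c : ℝ) :
    Integrable (fun x => D (t, x) * χ (x - c)) :=
  (h.int t ht).mul_bdd (c := 1) (hχ.comp (continuous_id.sub continuous_const)).aestronglyMeasurable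
    (Eventually.of_forall fun x => h0 _)

lemma TimeL1.continuousOn_mul {D : ℝ × ℝ → ℝ} (h : TimeL1 D) {χ : ℝ → ℝ} (hχ : Continuous χ)
    (h0 : ∀ z, |χ z| ≤ 1) (α κ : ℝ) :
    ContinuousOn (fun t => ∫ x, D (t, x) * χ (x - (α + κ * t))) (Ici 0) := by
  refine continuousOn_of_tendsto_zero (e := fun _ _ => 0)
    (N := fun s t => (∫ x, |D (t, x) - D (s, x)|) +
      ∫ x, |D (s, x)| * |χ (x - (α + κ * t)) - χ (x - (α + κ * s))|) (fun s hs t ht => ?_)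
      (fun s hs => ?_)
  all_goals
    have iD : ∀ t, Integrable (fun x => |D (s, x)| * |χ (x - (α + κ * t)) - χ (x - (α + κ * s))|) :=
      fun t => (h.int s hs).abs.mul_bdd (c := 2) (by fun_prop) (Eventually.of_forall fun x => by
        rw [Real.norm_eq_abs, abs_abs]
        have h1 := abs_le.1 (h0 (x - (α + κ * t)))
        have h2 := abs_le.1 (h0 (x - (α + κ * s)))
        rw [abs_le]; constructor <;> linarith)
  · have i1 := h.mul_integrable hχ h0 ht (α + κ * t)
    have i2 := h.mul_integrable hχ h0 hs (α + κ * s)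
    have i3 := ((h.int t ht).sub (h.int s hs)).abs
    simp only [Pi.sub_apply] at i3
    rw [← integral_sub i1 i2, ← integral_add i3 (iD t)]
    refine (abs_integral_le_integral_abs).trans (integral_mono (i1.sub i2).abs
      (i3.add (iD t)) fun x => ?_)
    simp only [Pi.sub_apply, Pi.add_apply]
    have h1 := h0 (x - (α + κ * t))
    calc |D (t, x) * χ (x - (α + κ * t)) - D (s, x) * χ (x - (α + κ * s))|
        = |(D (t, x) - D (s, x)) * χ (x - (α + κ * t))
          + D (s, x) * (χ (x - (α + κ * t)) - χ (x - (α + κ * s)))| := by ring_nf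
      _ ≤ _ := by
        refine (abs_add_le _ _).trans ?_
        rw [abs_mul, abs_mul]
        gcongr
        exact mul_le_of_le_one_right (abs_nonneg _) h1
  · rw [show nhds (0 : ℝ) = nhds (0 + 0) by simp]
    refine (h.cont s hs).add ?_
    have : Tendsto (fun t => ∫ x, |D (s, x)| * |χ (x - (α + κ * t)) - χ (x - (α + κ * s))|)
        (nhds s) (nhds (∫ x : ℝ, 0)) := by
      refine tendsto_integral_filter_of_dominated_convergence (fun x => |D (s, x)| * 2)
        (Eventually.of_forall fun t => (iD t).aestronglyMeasurable)
        (Eventually.of_forall fun t => Eventually.of_forall fun x => ?_)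
        ((h.int s hs).abs.mul_const 2) (Eventually.of_forall fun x => ?_)
      · rw [Real.norm_eq_abs, abs_mul, abs_abs, abs_abs]
        gcongr
        have h1 := abs_le.1 (h0 (x - (α + κ * t)))
        have h2 := abs_le.1 (h0 (x - (α + κ * s)))
        rw [abs_le]; constructor <;> linarith
      · have hc : Continuous (fun t => |D (s, x)| * |χ (x - (α + κ * t)) - χ (x - (α + κ * s))|) := by
          fun_prop
        have := hc.tendsto s
        simpa using this
    simp only [integral_zero] at this
    exact this.mono_left nhdsWithin_le_nhds

lemma TimeL1.integrable_mul_time {D : ℝ × ℝ → ℝ} (h : TimeL1 D) (hm : Measurable D) {a : ℝ → ℝ}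
    (ha : Continuous a) (hac : HasCompactSupport a) (ha0 : ∀ τ, a τ ≠ 0 → 0 < τ) :
    Integrable (fun P : ℝ × ℝ => a P.1 * D P) := by
  have hm' : Measurable (fun P : ℝ × ℝ => a P.1 * D P) := (ha.measurable.comp measurable_fst).mul hm
  rw [Measure.volume_eq_prod, integrable_prod_iff hm'.aestronglyMeasurable]
  constructor
  · refine Eventually.of_forall fun τ => ?_
    by_cases hτ : a τ = 0
    · simp [hτ]
    · exact (h.int τ (ha0 τ hτ).le).const_mul (a τ)
  · obtain ⟨R, hR⟩ := hac.isCompact.isBounded.subset_closedBall 0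
    obtain ⟨B, hB⟩ := (isCompact_Icc (a := (0 : ℝ)) (b := R)).exists_bound_of_continuousOn
      (h.continuousOn_norm.mono fun x hx => hx.1)
    refine Integrable.mono' ((integrable_of_cc ha hac).abs.const_mul B)
      (hm'.norm.stronglyMeasurable.integral_prod_right.aestronglyMeasurable)
      (Eventually.of_forall fun τ => ?_)
    simp only [norm_mul, integral_const_mul, Real.norm_eq_abs, abs_abs]
    rw [mul_comm]
    by_cases hτ : a τ = 0
    · simp [hτ]
    · have h1 : τ ∈ Metric.closedBall 0 R := hR (subset_tsupport _ hτ)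
      rw [mem_closedBall_zero_iff, Real.norm_eq_abs] at h1
      exact mul_le_mul_of_nonneg_right (hB τ ⟨(ha0 τ hτ).le, (le_abs_self _).trans h1⟩)
        (abs_nonneg _)

lemma deriv_eq_zero_of_zero {a : ℝ → ℝ} (ha : ∀ τ, 0 ≤ a τ) {τ : ℝ} (h : a τ = 0) :
    deriv a τ = 0 := by
  have : IsLocalMin a τ := Eventually.of_forall fun q => by rw [h]; exact ha q
  exact this.deriv_eq_zero

/-- A weak differential inequality controls the mass inside a moving smooth cutoff. -/
theorem WeakIneq.integral_cutoff_le {D q : ℝ × ℝ → ℝ} {Λ : ℝ} (hD : BddMeas D) (hq : BddMeas q)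
    (hqD : ∀ P, |q P| ≤ Λ * |D P|) (hT : TimeL1 D) {χ : ℝ → ℝ} (hχ : ContDiff ℝ (⊤ : ℕ∞) χ)
    (hχ0 : ∀ z, 0 ≤ χ z) (hχ1 : ∀ z, χ z ≤ 1) {s0 α κ : ℝ} (hs0 : 0 ≤ s0)
    (hW : WeakIneq {P | s0 < P.1 ∧ χ (P.2 - (α + κ * P.1)) ≠ 0} D q)
    (hsgn : ∀ᵐ P : ℝ × ℝ, s0 < P.1 → deriv χ (P.2 - (α + κ * P.1)) * (q P - κ * D P) ≤ 0)
    {s t : ℝ} (hs : s0 ≤ s) (hst : s ≤ t) :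
    ∫ x, D (t, x) * χ (x - (α + κ * t)) ≤ ∫ x, D (s, x) * χ (x - (α + κ * s)) := by
  have hχa : ∀ z, |χ z| ≤ 1 := fun z => by rw [abs_of_nonneg (hχ0 z)]; exact hχ1 z
  refine antitone_of_weak (G := fun t => ∫ x, D (t, x) * χ (x - (α + κ * t)))
    ((hT.continuousOn_mul hχ.continuous hχa α κ).mono (Ici_subset_Ici.2 hs0)) ?_ hs hst
  intro a ha hac ha0 has
  set b : ContDiffBump (0 : ℝ) := ⟨1, 2, one_pos, one_lt_two⟩ with hb
  have hbs : ContDiff ℝ (⊤ : ℕ∞) b := b.contDiff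
  obtain ⟨B, hB⟩ := (hbs.continuous_deriv (by simp)).bounded_above_of_compact_support
    b.hasCompactSupport.deriv
  have hB0 : 0 ≤ B := (norm_nonneg _).trans (hB 0)
  have hapos : ∀ τ, a τ ≠ 0 → 0 < τ := fun τ h => hs0.trans_lt (has τ h)
  have hda : ∀ τ, deriv a τ ≠ 0 → 0 < τ := fun τ h => hapos τ fun h' =>
    h (deriv_eq_zero_of_zero ha0 h')
  have dac : Continuous (deriv a) := ha.continuous_deriv (by simp)
  have I1 := hT.integrable_mul_time hD.1 dac hac.deriv hda
  have I2 := hT.integrable_mul_time hD.1 ha.continuous hac hapos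
  set φ : ℕ → ℝ × ℝ → ℝ := fun n P =>
    a P.1 * χ (P.2 - (α + κ * P.1)) * b (P.2 / (n + 1)) with hφ
  have φs : ∀ n, ContDiff ℝ (⊤ : ℕ∞) (φ n) := fun n =>
    ((ha.comp contDiff_fst).mul (hχ.comp (contDiff_snd.sub (contDiff_const.add
      (contDiff_const.mul contDiff_fst))))).mul (hbs.comp (contDiff_snd.div_const _))
  have np : ∀ n : ℕ, (0 : ℝ) < n + 1 := fun n => by positivity
  have φc : ∀ n, HasCompactSupport (φ n) := fun n => by
    refine HasCompactSupport.of_support_subset_isCompact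
      (hac.isCompact.prod (isCompact_closedBall (0 : ℝ) (2 * (n + 1)))) fun P hP => ?_
    have h1 : a P.1 ≠ 0 := fun h => hP (by simp [hφ, h])
    have h2 : b (P.2 / (n + 1)) ≠ 0 := fun h => hP (by simp [hφ, h])
    refine ⟨subset_tsupport _ h1, ?_⟩
    have h3 : P.2 / (n + 1) ∈ Function.support b := h2
    rw [b.support_eq, mem_ball_zero_iff, Real.norm_eq_abs, abs_div, abs_of_pos (np n),
      div_lt_iff₀ (np n)] at h3
    rw [mem_closedBall_zero_iff]
    exact h3.le
  have φt : ∀ n, IsTest (φ n) := fun n => ⟨φs n, φc n, fun P hP => by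
    have : a P.1 = 0 := by
      by_contra h
      exact absurd (hapos _ h) (not_lt.2 hP)
    simp [hφ, this], fun P => mul_nonneg (mul_nonneg (ha0 _) (hχ0 _)) b.nonneg⟩
  have eT : ∀ n P, dT (φ n) P = (deriv a P.1 * χ (P.2 - (α + κ * P.1)) +
      a P.1 * (deriv χ (P.2 - (α + κ * P.1)) * -κ)) * b (P.2 / (n + 1)) := fun n P => by
    refine (hasDerivAt_dT (φs n) P.1 P.2).unique ?_
    have h1 : HasDerivAt a (deriv a P.1) P.1 := (ha.differentiable (by simp) _).hasDerivAt
    have h2 : HasDerivAt χ (deriv χ (P.2 - (α + κ * P.1))) (P.2 - (α + κ * P.1)) :=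
      (hχ.differentiable (by simp) _).hasDerivAt
    have h3 : HasDerivAt (fun s => P.2 - (α + κ * s)) (-κ) P.1 := by
      simpa using (((hasDerivAt_id P.1).const_mul κ).const_add α).const_sub P.2
    exact (h1.mul (h2.comp P.1 h3)).mul_const (b (P.2 / (n + 1)))
  have eX : ∀ n P, dX (φ n) P = a P.1 * (deriv χ (P.2 - (α + κ * P.1))) * b (P.2 / (n + 1)) +
      a P.1 * χ (P.2 - (α + κ * P.1)) * (deriv b (P.2 / (n + 1)) * (1 / (n + 1))) := fun n P => by
    refine (hasDerivAt_dX (φs n) P.1 P.2).unique ?_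
    have h2 : HasDerivAt χ (deriv χ (P.2 - (α + κ * P.1))) (P.2 - (α + κ * P.1)) :=
      (hχ.differentiable (by simp) _).hasDerivAt
    have h3 : HasDerivAt (fun y => y - (α + κ * P.1)) 1 P.2 := (hasDerivAt_id P.2).sub_const _
    have h4 : HasDerivAt b (deriv b (P.2 / (n + 1))) (P.2 / (n + 1)) :=
      (hbs.differentiable (by simp) _).hasDerivAt
    have h5 : HasDerivAt (fun y : ℝ => y / (n + 1)) (1 / (n + 1)) P.2 :=
      (hasDerivAt_id P.2).div_const _
    refine (((h2.comp P.2 h3).const_mul (a P.1)).mul (h4.comp P.2 h5)).congr_deriv ?_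
    simp
  set J : ℕ → ℝ × ℝ → ℝ := fun n P =>
    deriv a P.1 * D P * (χ (P.2 - (α + κ * P.1)) * b (P.2 / (n + 1))) +
      a P.1 * q P * (χ (P.2 - (α + κ * P.1)) * (deriv b (P.2 / (n + 1)) * (1 / (n + 1)))) with hJ
  have Jm : ∀ n, Measurable (J n) := fun n => by
    have h1 : Measurable fun P : ℝ × ℝ => χ (P.2 - (α + κ * P.1)) :=
      hχ.continuous.measurable.comp (by fun_prop)
    have h2 : Measurable fun P : ℝ × ℝ => b (P.2 / (n + 1)) :=
      hbs.continuous.measurable.comp (by fun_prop)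
    have h3 : Measurable fun P : ℝ × ℝ => deriv b (P.2 / (n + 1)) :=
      (measurable_deriv b).comp (by fun_prop)
    exact (((dac.measurable.comp measurable_fst).mul hD.1).mul (h1.mul h2)).add
      (((ha.continuous.measurable.comp measurable_fst).mul hq.1).mul
        (h1.mul (h3.mul measurable_const)))
  have b1 : ∀ z, |b z| ≤ 1 := fun z => by rw [abs_of_nonneg b.nonneg]; exact b.le_one
  have bJ : ∀ n P, ‖J n P‖ ≤ |deriv a P.1 * D P| + |Λ| * B * |a P.1 * D P| := fun n P => by
    refine (norm_add_le _ _).trans (add_le_add ?_ ?_)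
    · rw [Real.norm_eq_abs, abs_mul]
      refine mul_le_of_le_one_right (abs_nonneg _) ?_
      rw [abs_mul]
      exact mul_le_one₀ (hχa _) (abs_nonneg _) (b1 _)
    · rw [Real.norm_eq_abs, abs_mul, abs_mul, abs_mul (χ _), abs_mul (deriv _ _), abs_mul (a _)]
      have h1 : |q P| ≤ |Λ| * |D P| := (hqD P).trans (by gcongr; exact le_abs_self _)
      have h2 : |1 / ((n : ℝ) + 1)| ≤ 1 := by
        rw [abs_of_pos (by positivity), div_le_one (np n)]
        linarith [n.cast_nonneg (α := ℝ)]
      have h3 : |χ (P.2 - (α + κ * P.1))| * (|deriv b (P.2 / (n + 1))| * |1 / ((n : ℝ) + 1)|)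
          ≤ 1 * (B * 1) := by
        gcongr
        · exact hχa _
        · exact hB _
      calc _ ≤ |a P.1| * (|Λ| * |D P|) * (1 * (B * 1)) := by gcongr
        _ = _ := by ring
  have bi : Integrable (fun P : ℝ × ℝ => |deriv a P.1 * D P| + |Λ| * B * |a P.1 * D P|) :=
    I1.abs.add (I2.abs.const_mul _)
  have iJ : ∀ n, Integrable (J n) := fun n =>
    bi.mono' (Jm n).aestronglyMeasurable (Eventually.of_forall (bJ n))
  have JJ : ∀ n, 0 ≤ ∫ P, J n P := fun n => by
    refine (hW (φ n) (φt n) fun P hP => ⟨has _ fun h => hP (by simp [hφ, h]),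
      fun h => hP (by simp [hφ, h])⟩).trans ?_
    refine integral_mono_ae (weakIneq_integrable hD hq (φt n)) (iJ n) ?_
    filter_upwards [hsgn] with P hP
    simp only [hJ]
    rw [eT, eX]
    have : a P.1 * b (P.2 / (n + 1)) *
        (deriv χ (P.2 - (α + κ * P.1)) * (q P - κ * D P)) ≤ 0 := by
      by_cases h : a P.1 = 0
      · simp [h]
      · exact mul_nonpos_of_nonneg_of_nonpos (mul_nonneg (ha0 _) b.nonneg) (hP (has _ h))
    linarith
  have lim : Tendsto (fun n => ∫ P, J n P) atTop
      (nhds (∫ P : ℝ × ℝ, deriv a P.1 * D P * χ (P.2 - (α + κ * P.1)))) := by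
    refine tendsto_integral_of_dominated_convergence _ (fun n => (iJ n).aestronglyMeasurable) bi
      (fun n => Eventually.of_forall (bJ n)) (Eventually.of_forall fun P => ?_)
    have h0 : Tendsto (fun n : ℕ => (1 : ℝ) / (n + 1)) atTop (nhds 0) :=
      tendsto_one_div_add_atTop_nhds_zero_nat
    have h1 : Tendsto (fun n : ℕ => P.2 / (n + 1)) atTop (nhds 0) := by
      have := h0.const_mul P.2
      simpa [div_eq_mul_inv] using this
    have h2 : Tendsto (fun n : ℕ => b (P.2 / (n + 1))) atTop (nhds 1) := by
      have := (hbs.continuous.tendsto 0).comp h1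
      rwa [b.one_of_mem_closedBall (by simp [hb])] at this
    have h3 : Tendsto (fun n : ℕ => deriv b (P.2 / (n + 1))) atTop (nhds (deriv b 0)) :=
      ((hbs.continuous_deriv (by simp)).tendsto 0).comp h1
    have := (((h2.const_mul (χ (P.2 - (α + κ * P.1)))).const_mul (deriv a P.1 * D P)).add
      (((h3.mul h0).const_mul (χ (P.2 - (α + κ * P.1)))).const_mul (a P.1 * q P)))
    simpa [hJ] using this
  have fin := ge_of_tendsto' lim JJ
  have iF : Integrable (fun P : ℝ × ℝ => deriv a P.1 * D P * χ (P.2 - (α + κ * P.1))) :=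
    I1.mul_bdd (c := 1) (hχ.continuous.comp (by fun_prop)).aestronglyMeasurable
      (Eventually.of_forall fun P => hχa _)
  rw [Measure.volume_eq_prod] at fin iF
  rw [integral_prod _ iF] at fin
  refine fin.trans_eq (integral_congr_ae (Eventually.of_forall fun τ => ?_))
  simp only
  rw [← integral_const_mul]
  refine integral_congr_ae (Eventually.of_forall fun x => ?_)
  simp only; ring

lemma eVariationOn_le_of_dominated {u A : ℝ → ℝ} {S : Set ℝ} {a b : ℝ}
    (hA : ∀ x ∈ S, A x ∈ Icc a b)
    (h : ∀ x ∈ S, ∀ y ∈ S, x ≤ y → |u y - u x| ≤ A y - A x) :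
    eVariationOn u S ≤ ENNReal.ofReal (b - a) := by
  refine iSup_le fun ⟨n, s, hs, hsS⟩ => ?_
  calc ∑ i ∈ Finset.range n, edist (u (s (i + 1))) (u (s i))
      ≤ ∑ i ∈ Finset.range n, ENNReal.ofReal (A (s (i + 1)) - A (s i)) := by
        refine Finset.sum_le_sum fun i _ => ?_
        rw [edist_dist, Real.dist_eq]
        exact ENNReal.ofReal_le_ofReal (h _ (hsS i) _ (hsS _) (hs (Nat.le_succ i)))
    _ = ENNReal.ofReal (∑ i ∈ Finset.range n, (A (s (i + 1)) - A (s i))) := by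
        rw [ENNReal.ofReal_sum_of_nonneg]
        exact fun i _ => (abs_nonneg _).trans (h _ (hsS i) _ (hsS _) (hs (Nat.le_succ i)))
    _ ≤ ENNReal.ofReal (b - a) := by
        rw [Finset.sum_range_sub (fun i => A (s i))]
        exact ENNReal.ofReal_le_ofReal (sub_le_sub (hA _ (hsS n)).2 (hA _ (hsS 0)).1)

lemma eVariationOn_Icc_le_of_dominated {u A : ℝ → ℝ} {x y : ℝ} (hxy : x ≤ y)
    (h : ∀ z ∈ Icc x y, ∀ z' ∈ Icc x y, z ≤ z' → |u z' - u z| ≤ A z' - A z) :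
    eVariationOn u (Icc x y) ≤ ENNReal.ofReal (A y - A x) := by
  refine eVariationOn_le_of_dominated (A := A) (fun z hz => ⟨?_, ?_⟩) h
  · linarith [(abs_nonneg _).trans (h x (left_mem_Icc.2 hxy) z hz hz.1)]
  · linarith [(abs_nonneg _).trans (h z hz y (right_mem_Icc.2 hxy) hz.2)]

/-- The variation of `u` up to `x`. -/
def varFn (u : ℝ → ℝ) (x : ℝ) : ℝ := (eVariationOn u (Iic x)).toReal

section varFn
variable {u : ℝ → ℝ} {W : ℝ}

lemma varFn_nonneg (u : ℝ → ℝ) (x : ℝ) : 0 ≤ varFn u x := ENNReal.toReal_nonneg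

lemma varFn_le (hu : eVariationOn u univ ≤ ENNReal.ofReal W) (hW : 0 ≤ W) (x : ℝ) :
    varFn u x ≤ W := by
  have := (eVariationOn.mono u (subset_univ (Iic x))).trans hu
  exact ENNReal.toReal_le_of_le_ofReal hW this

lemma eVariationOn_ne_top (hu : eVariationOn u univ ≤ ENNReal.ofReal W) (s : Set ℝ) :
    eVariationOn u s ≠ ⊤ :=
  ne_top_of_le_ne_top ENNReal.ofReal_ne_top ((eVariationOn.mono u (subset_univ s)).trans hu)

lemma varFn_sub (hu : eVariationOn u univ ≤ ENNReal.ofReal W) {x y : ℝ} (hxy : x ≤ y) :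
    varFn u y - varFn u x = (eVariationOn u (Icc x y)).toReal := by
  have := eVariationOn.union u (isGreatest_Iic (a := x)) (isLeast_Icc hxy)
  rw [Iic_union_Icc_eq_Iic hxy] at this
  rw [varFn, varFn, this, ENNReal.toReal_add (eVariationOn_ne_top hu _) (eVariationOn_ne_top hu _)]
  ring

lemma abs_sub_le_varFn (hu : eVariationOn u univ ≤ ENNReal.ofReal W) {x y : ℝ} (hxy : x ≤ y) :
    |u y - u x| ≤ varFn u y - varFn u x := by
  rw [varFn_sub hu hxy]
  have := eVariationOn.edist_le u (right_mem_Icc.2 hxy) (left_mem_Icc.2 hxy)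
  rw [edist_dist, Real.dist_eq] at this
  exact (ENNReal.ofReal_le_iff_le_toReal (eVariationOn_ne_top hu _)).1 this

lemma varFn_mono (hu : eVariationOn u univ ≤ ENNReal.ofReal W) : Monotone (varFn u) :=
  fun x y h => by linarith [(abs_nonneg _).trans (abs_sub_le_varFn hu h)]

lemma eVariationOn_split {p q : ℝ → ℝ} (hu : eVariationOn u univ ≤ ENNReal.ofReal W)
    (hW : 0 ≤ W) (hpq : ∀ a b, |p a - p b| + |q a - q b| ≤ |a - b|) {h : ℝ} (hh : 0 ≤ h) :
    eVariationOn (fun x => p (u (x - h)) + q (u (x + h))) univ ≤ ENNReal.ofReal W := by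
  have hp : eVariationOn (fun x => p (u x)) univ ≤ ENNReal.ofReal W := by
    have := eVariationOn_le_of_dominated (u := fun x => p (u x)) (A := varFn u) (S := univ)
      (a := 0) (b := W) (fun x _ => ⟨varFn_nonneg u x, varFn_le hu hW x⟩)
      (fun x _ y _ hxy => le_trans (by linarith [hpq (u y) (u x), abs_nonneg (q (u y) - q (u x))])
        (abs_sub_le_varFn hu hxy))
    simpa using this
  set P := varFn (fun x => p (u x)) with hP
  have key : ∀ x y, x ≤ y → |q (u y) - q (u x)| ≤ (varFn u y - P y) - (varFn u x - P x) := by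
    intro x y hxy
    obtain ⟨s, hs, hs'⟩ : ∃ s : ℝ, |s| ≤ 1 ∧ s * (q (u y) - q (u x)) = |q (u y) - q (u x)| := by
      rcases le_total 0 (q (u y) - q (u x)) with h0 | h0
      · exact ⟨1, by simp, by rw [abs_of_nonneg h0, one_mul]⟩
      · exact ⟨-1, by simp, by rw [abs_of_nonpos h0]; ring⟩
    have h1 := eVariationOn_Icc_le_of_dominated (u := fun x => p (u x))
      (A := fun z => varFn u z - s * q (u z)) hxy (fun z _ z' _ hz => by
        have h2 := abs_sub_le_varFn hu hz
        have h3 := hpq (u z') (u z)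
        have h4 : s * (q (u z') - q (u z)) ≤ |q (u z') - q (u z)| := by
          refine (le_abs_self _).trans ?_
          rw [abs_mul]
          exact mul_le_of_le_one_left (abs_nonneg _) hs
        linarith)
    have h5 : 0 ≤ varFn u y - s * q (u y) - (varFn u x - s * q (u x)) := by
      have h2 := abs_sub_le_varFn hu hxy
      have h3 := hpq (u y) (u x)
      linarith [abs_nonneg (p (u y) - p (u x))]
    have h6 := ENNReal.toReal_le_of_le_ofReal h5 h1
    rw [← varFn_sub hp hxy] at h6
    linarith
  have hPm := varFn_mono hp
  have hQm : Monotone fun x => varFn u x - P x := fun x y hxy => by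
    linarith [(abs_nonneg _).trans (key x y hxy)]
  have hQ0 : ∀ x, 0 ≤ varFn u x - P x := fun x => by
    have h1 := eVariationOn_le_of_dominated (u := fun x => p (u x)) (A := varFn u) (S := Iic x)
      (a := 0) (b := varFn u x) (fun z hz => ⟨varFn_nonneg u z, varFn_mono hu hz⟩)
      (fun x _ y _ hxy => le_trans (by linarith [hpq (u y) (u x), abs_nonneg (q (u y) - q (u x))])
        (abs_sub_le_varFn hu hxy))
    have := ENNReal.toReal_le_of_le_ofReal (by simpa using varFn_nonneg u x) h1
    rw [sub_zero] at this
    exact sub_nonneg.2 this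
  have := eVariationOn_le_of_dominated (u := fun x => p (u (x - h)) + q (u (x + h)))
    (A := fun x => P (x - h) + (varFn u (x + h) - P (x + h))) (S := univ) (a := 0) (b := W)
    (fun x _ => ⟨add_nonneg (varFn_nonneg _ _) (hQ0 _), by
      linarith [hPm (show x - h ≤ x + h by linarith), varFn_le hu hW (x + h)]⟩)
    (fun x _ y _ hxy => by
      have h1 := abs_sub_le_varFn hp (show x - h ≤ y - h by linarith)
      have h2 := key (x + h) (y + h) (by linarith)
      calc _ = |(p (u (y - h)) - p (u (x - h))) + (q (u (y + h)) - q (u (x + h)))| := by ring_nf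
        _ ≤ _ := abs_add_le _ _
        _ ≤ _ := by linarith)
  simpa using this

lemma measurable_of_eVariationOn (hu : eVariationOn u univ ≤ ENNReal.ofReal W) : Measurable u := by
  have h1 : Monotone fun x => varFn u x - u x := fun x y hxy => by
    have := abs_sub_le_varFn hu hxy
    simp only
    linarith [le_abs_self (u y - u x)]
  have e : u = fun x => varFn u x - (varFn u x - u x) := by ext x; ring
  rw [e]
  exact (varFn_mono hu).measurable.sub h1.measurable

/-- Two-point comparison integrated over the line: if the increments of `ψ` over the cells of
size `δ` are controlled by the variation on the cell, the integral is at most `δ W`. -/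
lemma lintegral_le_of_cells {ψ : ℝ → ENNReal} (hψ : Measurable ψ) {δ : ℝ} (hδ : 0 < δ) {B : ENNReal}
    (h : ∀ x, ∑' i : ℤ, ψ (x + i * δ) ≤ B) : ∫⁻ x, ψ x ≤ ENNReal.ofReal δ * B := by
  have e : ∫⁻ x, ψ x = ∑' i : ℤ, ∫⁻ x in Ioc (0 : ℝ) δ, ψ (x + i * δ) := by
    rw [← setLIntegral_univ, ← iUnion_Ioc_zsmul hδ,
      lintegral_iUnion (fun _ => measurableSet_Ioc) (pairwise_disjoint_Ioc_zsmul δ)]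
    refine tsum_congr fun i => ?_
    have := (measurePreserving_add_right volume ((i : ℝ) * δ)).setLIntegral_comp_emb
      (measurableEmbedding_addRight _) ψ (Ioc 0 δ)
    refine Eq.trans ?_ this.symm
    congr 2
    simp only [image_add_const_Ioc, zero_add, zsmul_eq_mul]
    push_cast
    ring_nf
  rw [e, ← lintegral_tsum (fun i => by fun_prop)]
  calc _ ≤ ∫⁻ x in Ioc (0 : ℝ) δ, B := lintegral_mono fun x => h x
    _ = _ := by simp [mul_comm]

lemma tsum_int_le_of_dominated {ψ : ℤ → ENNReal} {A : ℤ → ℝ} {W : ℝ} (hA : ∀ i, A i ∈ Icc 0 W)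
    (hm : Monotone A) (h : ∀ i, ψ i ≤ ENNReal.ofReal (A (i + 1) - A i)) :
    ∑' i, ψ i ≤ ENNReal.ofReal W := by
  rw [ENNReal.tsum_eq_iSup_sum]
  refine iSup_le fun s => ?_
  obtain ⟨N, hN⟩ : ∃ N : ℕ, s ⊆ Finset.Ico (-N : ℤ) N := by
    obtain ⟨a, ha⟩ := s.finite_toSet.bddAbove
    obtain ⟨b, hb⟩ := s.finite_toSet.bddBelow
    refine ⟨a.toNat + (-b).toNat + 1, fun i hi => ?_⟩
    have := ha hi; have := hb hi
    rw [Finset.mem_Ico]; omega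
  calc ∑ i ∈ s, ψ i ≤ ∑ i ∈ Finset.Ico (-N : ℤ) N, ψ i := Finset.sum_le_sum_of_subset hN
    _ ≤ ∑ i ∈ Finset.Ico (-N : ℤ) N, ENNReal.ofReal (A (i + 1) - A i) :=
      Finset.sum_le_sum fun i _ => h i
    _ = ENNReal.ofReal (∑ i ∈ Finset.Ico (-N : ℤ) N, (A (i + 1) - A i)) := by
      rw [ENNReal.ofReal_sum_of_nonneg]
      exact fun i _ => sub_nonneg.2 (hm (by omega))
    _ ≤ _ := by
      have : ∀ N : ℕ, ∑ i ∈ Finset.Ico (-N : ℤ) N, (A (i + 1) - A i) = A N - A (-N) := by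
        intro N
        induction N with
        | zero => simp
        | succ N ih =>
          have : Finset.Ico (-(N + 1 : ℕ) : ℤ) (N + 1 : ℕ)
              = insert (-(N + 1 : ℕ) : ℤ) (insert (N : ℤ) (Finset.Ico (-N : ℤ) N)) := by
            ext i; simp only [Finset.mem_Ico, Finset.mem_insert]; omega
          rw [this, Finset.sum_insert (by simp), Finset.sum_insert (by simp), ih]
          push_cast
          rw [show -((N : ℤ) + 1) + 1 = -N by ring]
          ring
      rw [this]
      exact ENNReal.ofReal_le_ofReal (by linarith [(hA N).2, (hA (-N)).1])

lemma lintegral_translate_le (hu : eVariationOn u univ ≤ ENNReal.ofReal W) (hW : 0 ≤ W) {z : ℝ}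
    (hz : 0 < z) : ∫⁻ x, ENNReal.ofReal |u (x + z) - u x| ≤ ENNReal.ofReal (z * W) := by
  have hm := measurable_of_eVariationOn hu
  rw [ENNReal.ofReal_mul hz.le]
  refine lintegral_le_of_cells (by fun_prop) hz fun x => ?_
  refine tsum_int_le_of_dominated (A := fun i : ℤ => varFn u (x + i * z))
    (fun i => ⟨varFn_nonneg _ _, varFn_le hu hW _⟩)
    (fun i j hij => varFn_mono hu (by gcongr)) fun i => ?_
  refine ENNReal.ofReal_le_ofReal ?_
  have := abs_sub_le_varFn hu (show x + i * z ≤ x + i * z + z by linarith)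
  push_cast
  rwa [show x + ((i : ℝ) + 1) * z = x + i * z + z by ring]

lemma lintegral_sample_le (hu : eVariationOn u univ ≤ ENNReal.ofReal W) (hW : 0 ≤ W) {δ : ℝ}
    (hδ : 0 < δ) :
    ∫⁻ x, ENNReal.ofReal |u x - u (δ * ⌊x / δ⌋)| ≤ ENNReal.ofReal (δ * W) := by
  have hm := measurable_of_eVariationOn hu
  rw [ENNReal.ofReal_mul hδ.le]
  refine lintegral_le_of_cells (by fun_prop) hδ fun x => ?_
  have hfl : ∀ i : ℤ, ⌊(x + i * δ) / δ⌋ = ⌊x / δ⌋ + i := fun i => by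
    rw [add_div, mul_div_cancel_right₀ _ hδ.ne', Int.floor_add_intCast]
  have e1 : δ * ⌊x / δ⌋ ≤ x := by
    have := Int.floor_le (x / δ); rw [le_div_iff₀ hδ] at this; linarith
  have e2 : x ≤ δ * ⌊x / δ⌋ + δ := by
    have := (Int.lt_floor_add_one (x / δ)).le; rw [div_le_iff₀ hδ] at this; linarith
  refine tsum_int_le_of_dominated (A := fun i : ℤ => varFn u (δ * (⌊x / δ⌋ + i)))
    (fun i => ⟨varFn_nonneg _ _, varFn_le hu hW _⟩)
    (fun i j hij => varFn_mono hu (by gcongr)) fun i => ?_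
  refine ENNReal.ofReal_le_ofReal ?_
  rw [hfl]
  push_cast
  have h1 := abs_sub_le_varFn hu (show δ * (⌊x / δ⌋ + i) ≤ x + i * δ by linarith)
  have h2 := varFn_mono hu (show x + i * δ ≤ δ * (⌊x / δ⌋ + (i + 1)) by linarith)
  linarith

end varFn

lemma integrable_and_integral_abs_le {g : ℝ → ℝ} (hg : Measurable g) {B : ℝ} (hB : 0 ≤ B)
    (h : ∫⁻ x, ENNReal.ofReal |g x| ≤ ENNReal.ofReal B) : Integrable g ∧ ∫ x, |g x| ≤ B := by
  have hi : Integrable g := ⟨hg.aestronglyMeasurable, by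
    rw [hasFiniteIntegral_iff_norm]
    exact h.trans_lt ENNReal.ofReal_lt_top⟩
  refine ⟨hi, ?_⟩
  rw [← ofReal_integral_eq_lintegral_ofReal hi.abs (Eventually.of_forall fun x => abs_nonneg _)] at h
  exact (ENNReal.ofReal_le_ofReal_iff hB).1 h

lemma integral_translate_le {u : ℝ → ℝ} {W : ℝ} (hu : eVariationOn u univ ≤ ENNReal.ofReal W)
    (hW : 0 ≤ W) (z : ℝ) :
    Integrable (fun x => u (x + z) - u x) ∧ ∫ x, |u (x + z) - u x| ≤ |z| * W := by
  have hm := measurable_of_eVariationOn hu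
  refine integrable_and_integral_abs_le (by fun_prop) (by positivity) ?_
  rcases lt_trichotomy z 0 with hz | hz | hz
  · rw [abs_of_neg hz]
    refine le_trans (le_of_eq ?_) (lintegral_translate_le hu hW (neg_pos.2 hz))
    rw [← lintegral_add_right_eq_self (fun x => ENNReal.ofReal |u (x + -z) - u x|) z]
    refine lintegral_congr fun x => ?_
    rw [add_neg_cancel_right, abs_sub_comm]
  · simp [hz]
  · rw [abs_of_pos hz]; exact lintegral_translate_le hu hW hz

lemma integral_sample_le {u : ℝ → ℝ} {W : ℝ} (hu : eVariationOn u univ ≤ ENNReal.ofReal W)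
    (hW : 0 ≤ W) {δ : ℝ} (hδ : 0 < δ) :
    Integrable (fun x => u x - u (δ * ⌊x / δ⌋)) ∧ ∫ x, |u x - u (δ * ⌊x / δ⌋)| ≤ δ * W := by
  have hm := measurable_of_eVariationOn hu
  exact integrable_and_integral_abs_le (by fun_prop) (by positivity) (lintegral_sample_le hu hW hδ)

/-- Functions with values in `[0, M]`, variation at most `W`, vanishing outside `[-R, R]`. -/
structure BVBox (M W R : ℝ) (g : ℝ → ℝ) : Prop where
  range : ∀ x, g x ∈ Icc 0 M
  var : eVariationOn g univ ≤ ENNReal.ofReal W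
  supp : ∀ x, R < |x| → g x = 0

namespace BVBox
variable {M W R : ℝ} {g : ℝ → ℝ}

lemma meas (h : BVBox M W R g) : Measurable g := measurable_of_eVariationOn h.var

lemma integrable (h : BVBox M W R g) : Integrable g := by
  have h1 : IntegrableOn g (Icc (-R) R) :=
    Measure.integrableOn_of_bounded (M := M) (by simp) h.meas.aestronglyMeasurable
      (Eventually.of_forall fun x => by
        rw [Real.norm_eq_abs, abs_of_nonneg (h.range x).1]; exact (h.range x).2)
  refine (integrableOn_iff_integrable_of_support_subset fun x hx => ?_).1 h1
  by_contra h2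
  exact hx (h.supp x (by
    by_contra h3
    exact h2 (abs_le.1 (not_lt.1 h3))))

lemma mono (h : BVBox M W R g) {R' : ℝ} (hR : R ≤ R') : BVBox M W R' g :=
  ⟨h.range, h.var, fun x hx => h.supp x (hR.trans_lt hx)⟩

/-- Pointwise limits of uniformly `BV` functions are limits in `L¹`. -/
lemma tendsto_integral {ι : Type*} {F : Filter ι} {g : ι → ℝ → ℝ} {w : ℝ → ℝ} (hW : 0 ≤ W)
    (hR : 0 ≤ R) (hg : ∀ᶠ i in F, BVBox M W R (g i)) (hw : BVBox M W R w)
    (h : ∀ x, Tendsto (fun i => g i x) F (nhds (w x))) :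
    Tendsto (fun i => ∫ x, |g i x - w x|) F (nhds 0) := by
  rw [Metric.tendsto_nhds]
  intro ε hε
  obtain ⟨δ, hδ, hδ1, hδε⟩ : ∃ δ > 0, δ ≤ 1 ∧ 2 * (δ * W) < ε / 2 := by
    refine ⟨min 1 (ε / (8 * (W + 1))), by positivity, min_le_left _ _, ?_⟩
    have h1 : min 1 (ε / (8 * (W + 1))) * W ≤ ε / (8 * (W + 1)) * (W + 1) := by
      gcongr
      · exact min_le_right _ _
      · linarith
    have h2 : ε / (8 * (W + 1)) * (W + 1) = ε / 8 := by field_simp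
    linarith
  set η := ε / (4 * (R + 1)) with hη
  have hη0 : 0 < η := by positivity
  set N : ℤ := ⌈(R + 1) / δ⌉ + 1 with hN
  have key : ∀ᶠ i in F, ∀ j ∈ Finset.Icc (-N) N, |g i (δ * j) - w (δ * j)| ≤ η := by
    rw [Finset.eventually_all]
    intro j _
    filter_upwards [(Metric.tendsto_nhds.1 (h (δ * j))) η hη0] with i hi
    exact hi.le
  filter_upwards [hg, key] with i hi hk
  have s1 := integral_sample_le hi.var hW hδ
  have s2 := integral_sample_le hw.var hW hδ
  have i3 : Integrable ((Icc (-(R + 1)) (R + 1)).indicator fun _ : ℝ => η) :=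
    (integrable_indicator_iff measurableSet_Icc).2 (by simp)
  have pt : ∀ x, |g i x - w x| ≤ |g i x - g i (δ * ⌊x / δ⌋)| + |w x - w (δ * ⌊x / δ⌋)| +
      (Icc (-(R + 1)) (R + 1)).indicator (fun _ : ℝ => η) x := by
    intro x
    by_cases hx : x ∈ Icc (-(R + 1)) (R + 1)
    · rw [indicator_of_mem hx]
      have hb1 : ⌊x / δ⌋ ≤ N := by
        have : ⌊x / δ⌋ ≤ ⌈(R + 1) / δ⌉ := by
          refine (Int.floor_le_ceil _).trans (Int.ceil_le_ceil ?_)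
          gcongr; exact hx.2
        omega
      have hb2 : -N ≤ ⌊x / δ⌋ := by
        rw [Int.le_floor]
        push_cast [hN]
        have h1 := Int.le_ceil ((R + 1) / δ)
        have h2 : -((R + 1) / δ) ≤ x / δ := by rw [← neg_div]; gcongr; exact hx.1
        linarith
      have h3 := hk _ (Finset.mem_Icc.2 ⟨hb2, hb1⟩)
      calc |g i x - w x| = |(g i x - g i (δ * ⌊x / δ⌋)) - (w x - w (δ * ⌊x / δ⌋))
            + (g i (δ * ⌊x / δ⌋) - w (δ * ⌊x / δ⌋))| := by ring_nf
        _ ≤ _ := (abs_add_le _ _).trans (add_le_add (abs_sub _ _) h3)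
    · have hx' : R < |x| := by
        by_contra h1
        have := abs_le.1 (not_lt.1 h1)
        exact hx ⟨by linarith, by linarith⟩
      rw [hi.supp x hx', hw.supp x hx', indicator_of_notMem hx, sub_zero, abs_zero]
      positivity
  have hle : ∫ x, |g i x - w x| ≤ δ * W + δ * W + η * (2 * (R + 1)) := by
    refine (integral_mono (hi.integrable.sub hw.integrable).abs ((s1.1.abs.add s2.1.abs).add i3)
      pt).trans ?_
    rw [integral_add' (s1.1.abs.add s2.1.abs) i3]
    have h1 : ∫ x, ((fun x => |g i x - g i (δ * ⌊x / δ⌋)|) + fun x => |w x - w (δ * ⌊x / δ⌋)|) x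
        ≤ δ * W + δ * W := by
      rw [integral_add' s1.1.abs s2.1.abs]
      exact add_le_add s1.2 s2.2
    have h2 : ∫ x, (Icc (-(R + 1)) (R + 1)).indicator (fun _ : ℝ => η) x = η * (2 * (R + 1)) := by
      rw [integral_indicator measurableSet_Icc, setIntegral_const]
      simp only [Real.volume_real_Icc, smul_eq_mul]
      rw [max_eq_left (by linarith)]; ring
    exact add_le_add h1 h2.le
  have h5 : η * (2 * (R + 1)) = ε / 2 := by rw [hη]; field_simp; ring
  rw [Real.dist_eq, sub_zero, abs_of_nonneg (integral_nonneg fun x => abs_nonneg _)]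
  linarith

lemma boundedVariationOn (h : BVBox M W R g) : BoundedVariationOn g univ :=
  (h.var.trans_lt ENNReal.ofReal_lt_top).ne

lemma rightLim_tendsto (h : BVBox M W R g) (x : ℝ) :
    Tendsto g (nhdsWithin x (Ioi x)) (nhds (Function.rightLim g x)) :=
  h.boundedVariationOn.tendsto_rightLim x

lemma rightLim (h : BVBox M W R g) : BVBox M W R (Function.rightLim g) where
  range x := isClosed_Icc.mem_of_tendsto (h.rightLim_tendsto x)
    (Eventually.of_forall fun y => h.range y)
  var := (eVariationOn.eVariationOn_rightLim_le isOpen_univ).trans h.var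
  supp x hx := by
    refine tendsto_nhds_unique (h.rightLim_tendsto x) (tendsto_const_nhds.congr' ?_)
    have : ∀ᶠ y in nhds x, R < |y| := (continuous_abs.tendsto x).eventually (lt_mem_nhds hx)
    filter_upwards [nhdsWithin_le_nhds this] with y hy using (h.supp y hy).symm

lemma rightLim_ae (h : BVBox M W R g) : ∀ᵐ x, Function.rightLim g x = g x := by
  have h1 : Monotone fun x => varFn g x - g x := fun x y hxy => by
    have := abs_sub_le_varFn h.var hxy
    simp only
    linarith [le_abs_self (g y - g x)]
  have c1 := (varFn_mono h.var).countable_not_continuousAt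
  have c2 := h1.countable_not_continuousAt
  filter_upwards [c1.ae_notMem volume, c2.ae_notMem volume] with x h3 h4
  simp only [not_not] at h3 h4
  have : ContinuousAt g x := by
    have e : g = fun x => varFn g x - (varFn g x - g x) := by ext y; ring
    rw [e]
    exact h3.sub h4
  exact tendsto_nhds_unique (h.rightLim_tendsto x) (this.tendsto.mono_left nhdsWithin_le_nhds)

lemma tendsto_average (h : BVBox M W R g) (x : ℝ) :
    Tendsto (fun k : ℕ => (k + 1) * ((∫ y in (0 : ℝ)..(x + 1 / (k + 1)), g y)
      - ∫ y in (0 : ℝ)..x, g y)) atTop (nhds (Function.rightLim g x)) := by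
  have hd : HasDerivWithinAt (fun u => ∫ y in (0 : ℝ)..u, g y) (Function.rightLim g x) (Ici x) x :=
    intervalIntegral.integral_hasDerivWithinAt_of_tendsto_ae_right (t := Ioi x)
      h.integrable.intervalIntegrable
      (h.meas.stronglyMeasurable.stronglyMeasurableAtFilter)
      ((h.rightLim_tendsto x).mono_left inf_le_left)
  rw [hasDerivWithinAt_iff_tendsto_slope, Ici_sdiff_left] at hd
  have h0 : Tendsto (fun k : ℕ => x + 1 / ((k : ℝ) + 1)) atTop (nhdsWithin x (Ioi x)) := by
    refine tendsto_nhdsWithin_iff.2 ⟨?_, Eventually.of_forall fun k => ?_⟩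
    · simpa using tendsto_one_div_add_atTop_nhds_zero_nat.const_add x
    · simp only [mem_Ioi, lt_add_iff_pos_right]; positivity
  refine (hd.comp h0).congr fun k => ?_
  simp only [Function.comp, slope_def_field]
  have : (k : ℝ) + 1 ≠ 0 := by positivity
  field_simp
  ring_nf

end BVBox

lemma integral_abs_sub_triangle {f g h : ℝ → ℝ} (hf : Integrable f) (hg : Integrable g)
    (hh : Integrable h) : ∫ x, |f x - h x| ≤ (∫ x, |f x - g x|) + ∫ x, |g x - h x| := by
  refine le_trans ?_ (integral_add (hf.sub hg).abs (hg.sub hh).abs).le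
  exact integral_mono (hf.sub hh).abs ((hf.sub hg).abs.add (hg.sub hh).abs)
    fun x => abs_sub_le _ _ _

lemma BVBox.of_tendsto {M W R : ℝ} {ι : Type*} {F : Filter ι} [F.NeBot] {g : ι → ℝ → ℝ} {w : ℝ → ℝ}
    (hg : ∀ i, BVBox M W R (g i)) (h : ∀ x, Tendsto (fun i => g i x) F (nhds (w x))) :
    BVBox M W R w where
  range x := isClosed_Icc.mem_of_tendsto (h x) (Eventually.of_forall fun i => (hg i).range x)
  var := by
    by_contra hc
    have := (eVariationOn.lowerSemicontinuous_aux (fun x _ => h x) (not_le.1 hc)).exists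
    obtain ⟨i, hi⟩ := this
    exact absurd (hg i).var (not_le.2 hi)
  supp x hx := tendsto_nhds_unique (h x)
    (tendsto_const_nhds.congr fun i => ((hg i).supp x hx).symm)

lemma measurable_rightLim_of_lipschitz {M W A B K : ℝ} {w : ℝ → ℝ → ℝ} (hM : 0 ≤ M)
    (hb : ∀ t, BVBox M W (A + B * max t 0) (w t))
    (hK : ∀ s t, ∫ x, |w t x - w s x| ≤ K * |t - s|) :
    Measurable (fun P : ℝ × ℝ => Function.rightLim (w P.1) P.2) := by
  set F : ℝ × ℝ → ℝ := fun P => ∫ y in (0 : ℝ)..P.2, w P.1 y with hF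
  have hii : ∀ t a b, IntervalIntegrable (w t) volume a b := fun t a b =>
    (hb t).integrable.intervalIntegrable
  have hFd : ∀ P Q : ℝ × ℝ, |F P - F Q| ≤ K * |P.1 - Q.1| + M * |P.2 - Q.2| := by
    intro P Q
    have e1 : F P - F Q = (∫ y in (0 : ℝ)..P.2, (w P.1 y - w Q.1 y)) + ∫ y in Q.2..P.2, w Q.1 y := by
      rw [intervalIntegral.integral_sub (hii _ _ _) (hii _ _ _),
        ← intervalIntegral.integral_interval_sub_left (hii Q.1 0 P.2) (hii Q.1 0 Q.2)]
      ring
    have hi : Integrable fun y => |w P.1 y - w Q.1 y| := ((hb P.1).integrable.sub (hb Q.1).integrable).abs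
    have h1 : |∫ y in (0 : ℝ)..P.2, (w P.1 y - w Q.1 y)| ≤ K * |P.1 - Q.1| := by
      refine le_trans ?_ (hK Q.1 P.1)
      have := intervalIntegral.norm_integral_le_integral_norm_uIoc (a := (0 : ℝ)) (b := P.2)
        (f := fun y => w P.1 y - w Q.1 y) (μ := volume)
      refine this.trans ?_
      simp only [Real.norm_eq_abs]
      exact setIntegral_le_integral (f := fun y => |w P.1 y - w Q.1 y|) hi (Eventually.of_forall fun x => abs_nonneg _)
    have h2 : |∫ y in Q.2..P.2, w Q.1 y| ≤ M * |P.2 - Q.2| :=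
      intervalIntegral.norm_integral_le_of_norm_le_const fun x _ => by
        rw [Real.norm_eq_abs, abs_of_nonneg ((hb Q.1).range x).1]; exact ((hb Q.1).range x).2
    rw [e1]
    exact (abs_add_le _ _).trans (add_le_add h1 h2)
  have hFc : Continuous F := by
    rw [continuous_iff_continuousAt]
    intro Q
    refine tendsto_iff_dist_tendsto_zero.2 ?_
    refine squeeze_zero (fun _ => dist_nonneg) (fun P => hFd P Q) ?_
    have : Continuous fun P : ℝ × ℝ => K * |P.1 - Q.1| + M * |P.2 - Q.2| := by fun_prop
    have h := this.tendsto Q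
    simpa using h
  refine measurable_of_tendsto_metrizable
    (f := fun (k : ℕ) (P : ℝ × ℝ) => (k + 1) * (F (P.1, P.2 + 1 / (k + 1)) - F P)) (fun k => ?_) ?_
  · have : Continuous fun P : ℝ × ℝ => ((k : ℝ) + 1) * (F (P.1, P.2 + 1 / (k + 1)) - F P) := by
      fun_prop
    exact this.measurable
  · rw [tendsto_pi_nhds]
    intro P
    exact (hb P.1).tendsto_average P.2

/-- Compactness in `C([0,∞); L¹)` of approximations with uniform variation bounds in space and
uniform approximate Lipschitz bounds in time. -/
theorem exists_limit_of_approx {M W A B K : ℝ} (hM : 0 ≤ M) (hW : 0 ≤ W) (hA : 0 ≤ A) (hB : 0 ≤ B)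
    (hK0 : 0 ≤ K)
    {U : ℕ → ℝ → ℝ → ℝ} (hb : ∀ n t, BVBox M W (A + B * max t 0) (U n t)) {e : ℕ → ℝ}
    (he : Tendsto e atTop (nhds 0))
    (hK : ∀ n s t, ∫ x, |U n t x - U n s x| ≤ K * |t - s| + e n) :
    ∃ F : Filter ℕ, F.NeBot ∧ F ≤ atTop ∧ ∃ u : ℝ → ℝ → ℝ, Measurable (Function.uncurry u) ∧
      (∀ t, BVBox M W (A + B * max t 0) (u t)) ∧
      (∀ s t, ∫ x, |u t x - u s x| ≤ K * |t - s|) ∧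
      (∀ t, Tendsto (fun n => ∫ x, |U n t x - u t x|) F (nhds 0)) ∧
      ∀ T ε, 0 < ε → ∀ᶠ n in F, ∀ t ∈ Icc 0 T, ∫ x, |U n t x - u t x| ≤ ε := by
  have hle : (hyperfilter ℕ : Filter ℕ) ≤ atTop := Nat.hyperfilter_le_atTop
  have hex : ∀ t x, ∃ w, Tendsto (fun n => U n t x) (hyperfilter ℕ : Filter ℕ) (nhds w) := by
    intro t x
    obtain ⟨w, -, hw⟩ := (isCompact_Icc (a := (0 : ℝ)) (b := M)).ultrafilter_le_nhds
      ((hyperfilter ℕ).map fun n => U n t x) (by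
        rw [le_principal_iff, Ultrafilter.coe_map, mem_map]
        exact Eventually.of_forall fun n => (hb n t).range x)
    exact ⟨w, hw⟩
  choose w hw using hex
  have hwb : ∀ t, BVBox M W (A + B * max t 0) (w t) := fun t =>
    BVBox.of_tendsto (fun n => hb n t) (hw t)
  have hR : ∀ t, 0 ≤ A + B * max t 0 := fun t => by positivity
  have hconv : ∀ t, Tendsto (fun n => ∫ x, |U n t x - w t x|) (hyperfilter ℕ : Filter ℕ) (nhds 0) :=
    fun t => BVBox.tendsto_integral hW (hR t) (Eventually.of_forall fun n => hb n t) (hwb t) (hw t)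
  have hwL : ∀ s t, ∫ x, |w t x - w s x| ≤ K * |t - s| := by
    intro s t
    have h1 : Tendsto (fun n => (∫ x, |U n t x - w t x|) + (K * |t - s| + e n)
        + ∫ x, |U n s x - w s x|) (hyperfilter ℕ : Filter ℕ) (nhds (0 + (K * |t - s| + 0) + 0)) :=
      ((hconv t).add (tendsto_const_nhds.add (he.mono_left hle))).add (hconv s)
    rw [zero_add, add_zero, add_zero] at h1
    refine ge_of_tendsto' h1 fun n => ?_
    have t1 := integral_abs_sub_triangle (hwb t).integrable (hb n t).integrable (hwb s).integrable
    have t2 := integral_abs_sub_triangle (hb n t).integrable (hb n s).integrable (hwb s).integrable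
    have e1 : ∫ x, |w t x - U n t x| = ∫ x, |U n t x - w t x| := by simp_rw [abs_sub_comm]
    linarith [hK n s t]
  have hae : ∀ t, ∀ᵐ x, Function.rightLim (w t) x = w t x := fun t => (hwb t).rightLim_ae
  have hconv' : ∀ t, Tendsto (fun n => ∫ x, |U n t x - Function.rightLim (w t) x|)
      (hyperfilter ℕ : Filter ℕ) (nhds 0) := by
    intro t
    refine (hconv t).congr fun n => integral_congr_ae ?_
    filter_upwards [hae t] with x hx
    rw [hx]
  have huL : ∀ s t, ∫ x, |Function.rightLim (w t) x - Function.rightLim (w s) x| ≤ K * |t - s| := by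
    intro s t
    refine le_trans (le_of_eq (integral_congr_ae ?_)) (hwL s t)
    filter_upwards [hae t, hae s] with x h1 h2
    rw [h1, h2]
  refine ⟨hyperfilter ℕ, inferInstance, hle, fun t => Function.rightLim (w t),
    measurable_rightLim_of_lipschitz hM hwb hwL, fun t => (hwb t).rightLim, huL, hconv', ?_⟩
  intro T ε hε
  obtain ⟨δ, hδ, hδ1⟩ : ∃ δ > 0, K * δ < ε / 4 :=
    ⟨ε / (8 * (K + 1)), by positivity, by
      rw [← mul_div_assoc, div_lt_div_iff₀ (by positivity) (by norm_num)]; nlinarith⟩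
  set N := ⌈T / δ⌉₊
  have k1 : ∀ᶠ n in (hyperfilter ℕ : Filter ℕ), ∀ j ∈ Finset.range (N + 1),
      ∫ x, |U n (δ * j) x - Function.rightLim (w (δ * j)) x| < ε / 4 := by
    rw [Finset.eventually_all]
    exact fun j _ => (hconv' (δ * j)).eventually (gt_mem_nhds (by linarith))
  have k2 : ∀ᶠ n in (hyperfilter ℕ : Filter ℕ), e n < ε / 4 :=
    (he.mono_left hle).eventually (gt_mem_nhds (by linarith))
  filter_upwards [k1, k2] with n h1 h2 t ht
  have hj : ⌊t / δ⌋₊ ∈ Finset.range (N + 1) := by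
    rw [Finset.mem_range, Nat.lt_succ_iff]
    exact (Nat.floor_le_floor (by gcongr; exact ht.2)).trans (Nat.floor_le_ceil _)
  have h3 := h1 _ hj
  have ht0 : 0 ≤ t / δ := div_nonneg ht.1 hδ.le
  have f1 := Nat.floor_le ht0
  have f2 := Nat.lt_floor_add_one (t / δ)
  rw [le_div_iff₀ hδ] at f1
  rw [div_lt_iff₀ hδ] at f2
  set s := δ * (⌊t / δ⌋₊ : ℝ) with hs
  have hst : |t - s| ≤ δ := by rw [abs_le]; constructor <;> linarith
  have hst' : K * |t - s| ≤ K * δ := by gcongr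
  have t1 := integral_abs_sub_triangle (hb n t).integrable (hb n s).integrable
    (hwb t).rightLim.integrable
  have t2 := integral_abs_sub_triangle (hb n s).integrable (hwb s).rightLim.integrable
    (hwb t).rightLim.integrable
  have h4 := huL t s
  rw [abs_sub_comm s t] at h4
  linarith [hK n s t]

lemma integral_shift (a φ : ℝ × ℝ → ℝ) (z : ℝ × ℝ) :
    ∫ P, a (P + z) * φ P = ∫ P, a P * φ (P - z) := by
  rw [← integral_add_right_eq_self (fun P => a P * φ (P - z)) z]
  simp

/-- Discrete counterpart of the time derivative in the Lax–Friedrichs scheme. -/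
def discT (φ : ℝ × ℝ → ℝ) (μ h : ℝ) (P : ℝ × ℝ) : ℝ :=
  ((φ (P + (0, h)) + φ (P - (0, h))) / 2 - φ (P - (μ * h, 0))) / (μ * h)

/-- Centred difference in space. -/
def discX (φ : ℝ × ℝ → ℝ) (h : ℝ) (P : ℝ × ℝ) : ℝ :=
  (φ (P + (0, h)) - φ (P - (0, h))) / (2 * h)

lemma integrable_shift {a φ : ℝ × ℝ → ℝ} (ha : BddMeas a) (hφ : Continuous φ)
    (hc : HasCompactSupport φ) (z : ℝ × ℝ) : Integrable (fun P => a P * φ (P - z)) :=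
  ha.integrable_mul ((integrable_of_cc hφ hc).comp_sub_right z)

lemma discrete_weak_ineq {a g : ℝ × ℝ → ℝ} {μ h : ℝ} (ha : BddMeas a) (hg : BddMeas g)
    (hμ : 0 < μ) (hh : 0 < h)
    (hpt : ∀ P : ℝ × ℝ, 0 ≤ P.1 → a (P + (μ * h, 0)) ≤
      (a (P + -(0, h)) + μ * g (P + -(0, h))) / 2 + (a (P + (0, h)) - μ * g (P + (0, h))) / 2)
    {φ : ℝ × ℝ → ℝ} (hφ : IsTest φ) :
    0 ≤ ∫ P, (a P * discT φ μ h P + g P * discX φ h P) := by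
  have hφc : Continuous φ := hφ.smooth.continuous
  have hI : ∀ {b : ℝ × ℝ → ℝ}, BddMeas b → ∀ z, Integrable (fun P => b (P + z) * φ P) := by
    intro b hb z
    have hb' : BddMeas fun P => b (P + z) := ⟨hb.1.comp (measurable_id.add_const z),
      hb.2.imp fun B hB P => hB _⟩
    exact hb'.integrable_mul (integrable_of_cc hφc hφ.cpt)
  have h0 : 0 ≤ ∫ P, ((((a (P + -(0, h)) * φ P + μ * (g (P + -(0, h)) * φ P)) +
      (a (P + (0, h)) * φ P - μ * (g (P + (0, h)) * φ P))) / 2) - a (P + (μ * h, 0)) * φ P) := by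
    refine integral_nonneg fun P => ?_
    simp only [Pi.zero_apply]
    rcases le_or_gt P.1 0 with h1 | h1
    · simp [hφ.zero P h1]
    · have := mul_le_mul_of_nonneg_right (hpt P h1.le) (hφ.nonneg P)
      linarith
  have i1 := hI ha (-(0, h))
  have i2 := (hI hg (-(0, h))).const_mul μ
  have i3 := hI ha (0, h)
  have i4 := (hI hg (0, h)).const_mul μ
  have i5 := hI ha (μ * h, 0)
  have e : ∫ P, ((((a (P + -(0, h)) * φ P + μ * (g (P + -(0, h)) * φ P)) +
      (a (P + (0, h)) * φ P - μ * (g (P + (0, h)) * φ P))) / 2) - a (P + (μ * h, 0)) * φ P)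
      = (((∫ P, a P * φ (P - -(0, h))) + μ * ∫ P, g P * φ (P - -(0, h))) +
        ((∫ P, a P * φ (P - (0, h))) - μ * ∫ P, g P * φ (P - (0, h)))) / 2
        - ∫ P, a P * φ (P - (μ * h, 0)) := by
    have j12 : Integrable fun P => a (P + -(0, h)) * φ P + μ * (g (P + -(0, h)) * φ P) := i1.add i2
    have j34 : Integrable fun P => a (P + (0, h)) * φ P - μ * (g (P + (0, h)) * φ P) := i3.sub i4
    have j : Integrable fun P => ((a (P + -(0, h)) * φ P + μ * (g (P + -(0, h)) * φ P)) +
      (a (P + (0, h)) * φ P - μ * (g (P + (0, h)) * φ P))) / 2 := (j12.add j34).div_const 2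
    rw [integral_sub j i5, integral_div, integral_add j12 j34, integral_add i1 i2,
      integral_sub i3 i4, integral_const_mul, integral_const_mul]
    simp only [integral_shift]
  rw [e] at h0
  have s := fun z => integrable_shift ha hφc hφ.cpt z
  have s' := fun z => integrable_shift hg hφc hφ.cpt z
  have e2 : ∫ P, (a P * discT φ μ h P + g P * discX φ h P) =
      ((((∫ P, a P * φ (P - -(0, h))) + μ * ∫ P, g P * φ (P - -(0, h))) +
        ((∫ P, a P * φ (P - (0, h))) - μ * ∫ P, g P * φ (P - (0, h)))) / 2
        - ∫ P, a P * φ (P - (μ * h, 0))) / (μ * h) := by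
    have j12 : Integrable fun P => a P * φ (P - -(0, h)) + μ * (g P * φ (P - -(0, h))) :=
      (s _).add ((s' _).const_mul μ)
    have j34 : Integrable fun P => a P * φ (P - (0, h)) - μ * (g P * φ (P - (0, h))) :=
      (s _).sub ((s' _).const_mul μ)
    have j : Integrable fun P => ((a P * φ (P - -(0, h)) + μ * (g P * φ (P - -(0, h)))) +
      (a P * φ (P - (0, h)) - μ * (g P * φ (P - (0, h))))) / 2 := (j12.add j34).div_const 2
    rw [← integral_const_mul μ, ← integral_const_mul μ, ← integral_add (s _) ((s' _).const_mul μ),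
      ← integral_sub (s _) ((s' _).const_mul μ), ← integral_add j12 j34, ← integral_div,
      ← integral_sub j (s _), ← integral_div]
    refine integral_congr_ae (Eventually.of_forall fun P => ?_)
    simp only [discT, discX, sub_neg_eq_add]
    field_simp
    ring
  rw [e2]
  positivity

lemma tendsto_discX {φ : ℝ × ℝ → ℝ} (hφ : ContDiff ℝ (⊤ : ℕ∞) φ) {h : ℕ → ℝ} (hpos : ∀ n, 0 < h n)
    (hlim : Tendsto h atTop (nhds 0)) (P : ℝ × ℝ) :
    Tendsto (fun n => (φ (P + (0, h n)) - φ P) / h n) atTop (nhds (dX φ P)) ∧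
    Tendsto (fun n => (φ P - φ (P - (0, h n))) / h n) atTop (nhds (dX φ P)) ∧
    Tendsto (fun n => (φ P - φ (P - (h n, 0))) / h n) atTop (nhds (dT φ P)) := by
  have hd := hasDerivAt_dX hφ P.1 P.2
  have ht := hasDerivAt_dT hφ P.1 P.2
  have hp : Tendsto h atTop (nhdsWithin 0 {0}ᶜ) :=
    tendsto_nhdsWithin_iff.2 ⟨hlim, Eventually.of_forall fun n => (hpos n).ne'⟩
  have hn : Tendsto (fun n => -h n) atTop (nhdsWithin 0 {0}ᶜ) :=
    tendsto_nhdsWithin_iff.2 ⟨by simpa using hlim.neg, Eventually.of_forall fun n => by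
      simpa using (hpos n).ne'⟩
  refine ⟨?_, ?_, ?_⟩
  · refine (hd.tendsto_slope_zero.comp hp).congr fun n => ?_
    simp only [Function.comp, smul_eq_mul]
    rw [show P + (0, h n) = (P.1, P.2 + h n) by ext <;> simp]
    rw [div_eq_inv_mul]
  · refine (hd.tendsto_slope_zero.comp hn).congr fun n => ?_
    simp only [Function.comp, smul_eq_mul]
    rw [show P - (0, h n) = (P.1, P.2 + -h n) by ext <;> simp [sub_eq_add_neg]]
    rw [div_eq_inv_mul, inv_neg]; ring
  · refine (ht.tendsto_slope_zero.comp hn).congr fun n => ?_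
    simp only [Function.comp, smul_eq_mul]
    rw [show P - (h n, 0) = (P.1 + -h n, P.2) by ext <;> simp [sub_eq_add_neg]]
    rw [div_eq_inv_mul, inv_neg]; ring

lemma abs_integral_mul_le {A d : ℝ × ℝ → ℝ} {C T ε : ℝ} (hC : 0 ≤ C) (hT : 0 ≤ T)
    (hA : ∀ P, |A P| ≤ C) (hA0 : ∀ P : ℝ × ℝ, P.1 ∉ Icc 0 T → A P = 0)
    (hd : ∀ t ∈ Icc 0 T, Integrable (fun x => d (t, x)) ∧ ∫ x, |d (t, x)| ≤ ε) :
    |∫ P, d P * A P| ≤ C * ε * T := by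
  have hε : 0 ≤ ε := (integral_nonneg fun _ => abs_nonneg _).trans (hd 0 ⟨le_rfl, hT⟩).2
  by_cases hi : Integrable (fun P => d P * A P)
  · have hi' := hi.abs
    refine (norm_integral_le_integral_norm fun P => d P * A P).trans ?_
    simp only [Real.norm_eq_abs]
    have e : ∫ P : ℝ × ℝ, |d P * A P| = ∫ t, ∫ x, |d (t, x) * A (t, x)| := integral_prod _ hi'
    rw [e]
    have i2 : Integrable ((Icc 0 T).indicator fun _ : ℝ => C * ε) :=
      (integrable_indicator_iff measurableSet_Icc).2 (integrableOn_const measure_Icc_lt_top.ne)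
    have e2 : ∫ t, (Icc 0 T).indicator (fun _ : ℝ => C * ε) t = C * ε * T := by
      rw [integral_indicator measurableSet_Icc, setIntegral_const]
      simp only [Real.volume_real_Icc, smul_eq_mul]
      rw [max_eq_left (by linarith)]; ring
    rw [← e2]
    refine integral_mono_of_nonneg (Eventually.of_forall fun t =>
      integral_nonneg fun _ => abs_nonneg _) i2 (Eventually.of_forall fun t => ?_)
    simp only
    by_cases ht : t ∈ Icc 0 T
    · rw [indicator_of_mem ht]
      calc ∫ x, |d (t, x) * A (t, x)| ≤ ∫ x, C * |d (t, x)| := by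
            refine integral_mono_of_nonneg (Eventually.of_forall fun _ => abs_nonneg _)
              ((hd t ht).1.abs.const_mul C) (Eventually.of_forall fun x => ?_)
            simp only [abs_mul]
            rw [mul_comm]
            gcongr
            exact hA _
        _ ≤ C * ε := by rw [integral_const_mul]; gcongr; exact (hd t ht).2
    · rw [indicator_of_notMem ht]
      simp [hA0 (t, _) ht]
  · rw [integral_undef hi, abs_zero]; positivity

lemma disc_bounds {φ : ℝ × ℝ → ℝ} (hφ : IsTest φ) {μ : ℝ} (hμ : 0 < μ) :
    ∃ C R : ℝ, 0 ≤ C ∧ 0 ≤ R ∧ ∀ h, 0 < h → h ≤ 1 →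
      (∀ P, |discT φ μ h P| ≤ C ∧ |discX φ h P| ≤ C) ∧
      (∀ P : ℝ × ℝ, R < ‖P‖ → discT φ μ h P = 0 ∧ discX φ h P = 0) ∧
      (∀ P : ℝ × ℝ, P.1 ∉ Icc 0 R → discT φ μ h P = 0 ∧ discX φ h P = 0) := by
  obtain ⟨K, hK⟩ := (hφ.smooth.of_le (by norm_cast) :
    ContDiff ℝ 1 φ).lipschitzWith_of_hasCompactSupport hφ.cpt (by norm_num)
  have hL : ∀ P Q, |φ P - φ Q| ≤ K * ‖P - Q‖ := fun P Q => by
    have := hK.dist_le_mul P Q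
    rwa [Real.dist_eq, dist_eq_norm] at this
  obtain ⟨R, hR⟩ := hφ.cpt.isCompact.isBounded.subset_closedBall (0 : ℝ × ℝ)
  have hR0 : ∀ P : ℝ × ℝ, max R 0 < ‖P‖ → φ P = 0 := fun P hP => by
    by_contra h
    have := hR (subset_tsupport φ h)
    rw [mem_closedBall_zero_iff] at this
    exact absurd (this.trans (le_max_left _ _)) (not_le.2 hP)
  have hn1 : ∀ h : ℝ, ‖((0 : ℝ), h)‖ = |h| := fun h => by simp [Prod.norm_def]
  have hn2 : ∀ h : ℝ, ‖(h, (0 : ℝ))‖ = |h| := fun h => by simp [Prod.norm_def]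
  refine ⟨K / μ + K, max R 0 + 1 + μ, by positivity, by positivity, fun h hh hh1 => ⟨fun P => ?_,
    fun P hP => ?_, fun P hP => ?_⟩⟩
  · have a1 := hL (P + (0, h)) P
    have a2 := hL P (P - (0, h))
    have a3 := hL P (P - (μ * h, 0))
    rw [add_sub_cancel_left, hn1, abs_of_pos hh] at a1
    rw [sub_sub_cancel, hn1, abs_of_pos hh] at a2
    rw [sub_sub_cancel, hn2, abs_of_pos (show 0 < μ * h by positivity)] at a3
    rw [abs_le] at a1 a2 a3
    constructor
    · unfold discT
      rw [abs_div, abs_of_pos (show 0 < μ * h by positivity), div_le_iff₀ (by positivity)]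
      have : (K / μ + K) * (μ * h) = K * h + K * (μ * h) := by field_simp
      rw [this, abs_le]
      constructor <;> linarith [a1.1, a1.2, a2.1, a2.2, a3.1, a3.2]
    · unfold discX
      rw [abs_div, abs_of_pos (show 0 < 2 * h by positivity), div_le_iff₀ (by positivity)]
      have : 0 ≤ (K / μ) * (2 * h) := by positivity
      rw [abs_le]
      constructor <;> nlinarith [a1.1, a1.2, a2.1, a2.2]
  · have t1 : φ (P + (0, h)) = 0 := hR0 _ (by
      have := norm_sub_le (P + (0, h)) (0, h)
      rw [add_sub_cancel_right, hn1, abs_of_pos hh] at this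
      linarith)
    have t2 : φ (P - (0, h)) = 0 := hR0 _ (by
      have := norm_add_le (P - (0, h)) (0, h)
      rw [sub_add_cancel, hn1, abs_of_pos hh] at this
      linarith)
    have t3 : φ (P - (μ * h, 0)) = 0 := hR0 _ (by
      have := norm_add_le (P - (μ * h, 0)) (μ * h, 0)
      rw [sub_add_cancel, hn2, abs_of_pos (show 0 < μ * h by positivity)] at this
      nlinarith)
    simp [discT, discX, t1, t2, t3]
  · have hz : ∀ Q : ℝ × ℝ, (Q.1 ≤ 0 ∨ max R 0 < Q.1) → φ Q = 0 := by
      rintro Q (hQ | hQ)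
      · exact hφ.zero Q hQ
      · exact hR0 Q (hQ.trans_le ((le_abs_self _).trans (norm_fst_le Q)))
    have hP' : P.1 < 0 ∨ max R 0 + 1 + μ < P.1 := by
      by_contra hc
      push Not at hc
      exact hP ⟨hc.1, hc.2⟩
    have hμh : 0 < μ * h := by positivity
    have hμh' : μ * h ≤ μ := by nlinarith
    have t1 : φ (P + (0, h)) = 0 := hz _ (by
      simp only [Prod.fst_add, add_zero]
      exact hP'.imp (fun h => h.le) (fun h => by linarith))
    have t2 : φ (P - (0, h)) = 0 := hz _ (by
      simp only [Prod.fst_sub, sub_zero]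
      exact hP'.imp (fun h => h.le) (fun h => by linarith))
    have t3 : φ (P - (μ * h, 0)) = 0 := hz _ (by
      simp only [Prod.fst_sub]
      exact hP'.imp (fun h => by linarith) (fun h => by linarith))
    simp [discT, discX, t1, t2, t3]

/-- Limits of consistent monotone discretisations satisfy the weak inequality. -/
theorem weakIneq_of_discrete {F : Filter ℕ} [F.NeBot] (hF : F ≤ atTop) {h : ℕ → ℝ} {μ : ℝ}
    (hμ : 0 < μ) (hpos : ∀ n, 0 < h n) (hle : ∀ n, h n ≤ 1) (hlim : Tendsto h atTop (nhds 0))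
    {an gn : ℕ → ℝ × ℝ → ℝ} {a g : ℝ × ℝ → ℝ} (han : ∀ n, BddMeas (an n))
    (hgn : ∀ n, BddMeas (gn n)) (ha : BddMeas a) (hg : BddMeas g)
    (hpt : ∀ n (P : ℝ × ℝ), 0 ≤ P.1 → an n (P + (μ * h n, 0)) ≤
      (an n (P + -(0, h n)) + μ * gn n (P + -(0, h n))) / 2
        + (an n (P + (0, h n)) - μ * gn n (P + (0, h n))) / 2)
    (hca : ∀ T ε, 0 < ε → ∀ᶠ n in F, ∀ t ∈ Icc 0 T, Integrable (fun x => an n (t, x) - a (t, x)) ∧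
      ∫ x, |an n (t, x) - a (t, x)| ≤ ε)
    (hcg : ∀ T ε, 0 < ε → ∀ᶠ n in F, ∀ t ∈ Icc 0 T, Integrable (fun x => gn n (t, x) - g (t, x)) ∧
      ∫ x, |gn n (t, x) - g (t, x)| ≤ ε) : WeakIneq univ a g := by
  intro φ hφ _
  obtain ⟨C, R, hC, hR, hCR⟩ := disc_bounds hφ hμ
  have hφc : Continuous φ := hφ.smooth.continuous
  obtain ⟨Ba, hBa⟩ := ha.2
  obtain ⟨Bg, hBg⟩ := hg.2
  have cT : ∀ n, Continuous (discT φ μ (h n)) := fun n => by unfold discT; fun_prop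
  have cX : ∀ n, Continuous (discX φ (h n)) := fun n => by unfold discX; fun_prop
  have hcs : ∀ n, HasCompactSupport (discT φ μ (h n)) ∧ HasCompactSupport (discX φ (h n)) :=
    fun n => ⟨HasCompactSupport.intro (isCompact_closedBall (0 : ℝ × ℝ) R) fun P hP =>
        ((hCR _ (hpos n) (hle n)).2.1 P (by
          rwa [mem_closedBall_zero_iff, not_le] at hP)).1,
      HasCompactSupport.intro (isCompact_closedBall (0 : ℝ × ℝ) R) fun P hP =>
        ((hCR _ (hpos n) (hle n)).2.1 P (by
          rwa [mem_closedBall_zero_iff, not_le] at hP)).2⟩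
  have iT : ∀ n, Integrable (discT φ μ (h n)) := fun n => integrable_of_cc (cT n) (hcs n).1
  have iX : ∀ n, Integrable (discX φ (h n)) := fun n => integrable_of_cc (cX n) (hcs n).2
  have J : Tendsto (fun n => ∫ P, (a P * discT φ μ (h n) P + g P * discX φ (h n) P)) atTop
      (nhds (∫ P, (a P * dT φ P + g P * dX φ P))) := by
    refine tendsto_integral_of_dominated_convergence
      ((Metric.closedBall (0 : ℝ × ℝ) R).indicator fun _ => (Ba + Bg) * C) (fun n => ?_) ?_
      (fun n => Eventually.of_forall fun P => ?_) (Eventually.of_forall fun P => ?_)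
    · exact ((ha.integrable_mul (iT n)).add (hg.integrable_mul (iX n))).aestronglyMeasurable
    · rw [integrable_indicator_iff measurableSet_closedBall]
      exact integrableOn_const (isCompact_closedBall _ _).measure_lt_top.ne
    · have := hCR _ (hpos n) (hle n)
      by_cases hP : P ∈ Metric.closedBall (0 : ℝ × ℝ) R
      · rw [indicator_of_mem hP, Real.norm_eq_abs]
        refine (abs_add_le _ _).trans ?_
        rw [abs_mul, abs_mul, add_mul]
        have b1 := hBa P
        have b2 := hBg P
        have b3 := this.1 P
        gcongr
        · exact (abs_nonneg _).trans b1
        · exact b3.1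
        · exact (abs_nonneg _).trans b2
        · exact b3.2
      · rw [indicator_of_notMem hP]
        rw [mem_closedBall_zero_iff, not_le] at hP
        simp [this.2.1 P hP]
    · have hl := tendsto_discX hφ.smooth hpos hlim P
      have hl' := tendsto_discX hφ.smooth (fun n => mul_pos hμ (hpos n))
        (by simpa using hlim.const_mul μ) P
      refine (Tendsto.const_mul _ ?_).add (Tendsto.const_mul _ ?_)
      · have := ((hl.1.sub hl.2.1).div_const (2 * μ)).add hl'.2.2
        rw [sub_self, zero_div, zero_add] at this
        refine this.congr fun n => ?_
        have := (hpos n).ne'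
        unfold discT
        field_simp
        ring
      · have := (hl.1.add hl.2.1).div_const 2
        rw [add_self_div_two] at this
        refine this.congr fun n => ?_
        have := (hpos n).ne'
        unfold discX
        field_simp
        ring
  refine le_of_forall_pos_le_add fun ε hε => ?_
  have hlow : ∀ᶠ n in F, -ε ≤ ∫ P, (a P * discT φ μ (h n) P + g P * discX φ (h n) P) := by
    obtain ⟨δ, hδ, hδε⟩ : ∃ δ > 0, 2 * (C * δ * R) ≤ ε := by
      refine ⟨ε / (2 * (C * R + 1)), by positivity, ?_⟩
      have : 2 * (C * (ε / (2 * (C * R + 1))) * R) = ε * (C * R / (C * R + 1)) := by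
        field_simp
      rw [this]
      have h2 : C * R / (C * R + 1) ≤ 1 := by
        rw [div_le_one (by positivity)]; linarith
      nlinarith
    filter_upwards [hca R δ hδ, hcg R δ hδ] with n h1 h2
    have hn := hCR _ (hpos n) (hle n)
    have e1 := abs_integral_mul_le (A := discT φ μ (h n)) (d := fun P => an n P - a P) hC hR
      (fun P => (hn.1 P).1) (fun P hP => (hn.2.2 P hP).1) h1
    have e2 := abs_integral_mul_le (A := discX φ (h n)) (d := fun P => gn n P - g P) hC hR
      (fun P => (hn.1 P).2) (fun P hP => (hn.2.2 P hP).2) h2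
    have e3 := discrete_weak_ineq (han n) (hgn n) hμ (hpos n) (hpt n) hφ
    have j1 := ((han n).sub ha).integrable_mul (iT n)
    have j2 := ((hgn n).sub hg).integrable_mul (iX n)
    have j3 := (ha.integrable_mul (iT n)).add (hg.integrable_mul (iX n))
    have e4 : ∫ P, (an n P * discT φ μ (h n) P + gn n P * discX φ (h n) P) =
        (∫ P, (an n P - a P) * discT φ μ (h n) P) + (∫ P, (gn n P - g P) * discX φ (h n) P)
        + ∫ P, (a P * discT φ μ (h n) P + g P * discX φ (h n) P) := by
      rw [← integral_add j1 j2]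
      refine Eq.trans ?_ (integral_add (j1.add j2) j3)
      refine integral_congr_ae (Eventually.of_forall fun P => ?_)
      simp only [Pi.add_apply]
      ring
    rw [abs_le] at e1 e2
    linarith [e1.2, e2.2]
  have := ge_of_tendsto (J.mono_left hF) hlow
  linarith

def lfP (f : ℝ → ℝ) (μ r : ℝ) : ℝ := (r + μ * f r) / 2
def lfQ (f : ℝ → ℝ) (μ r : ℝ) : ℝ := (r - μ * f r) / 2

/-- One step of the Lax–Friedrichs scheme. -/
def lfStep (f : ℝ → ℝ) (μ h : ℝ) (u : ℝ → ℝ) (x : ℝ) : ℝ :=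
  lfP f μ (u (x - h)) + lfQ f μ (u (x + h))

section
variable {f : ℝ → ℝ} {Λ μ : ℝ} (hf : ∀ a b, |f a - f b| ≤ Λ * |a - b|) (hμ : 0 < μ)
  (hμΛ : μ * Λ ≤ 1)
include hf hμ hμΛ

lemma lf_abs (a b : ℝ) : |lfP f μ a - lfP f μ b| = (|a - b| + μ * kflux f a b) / 2 ∧
    |lfQ f μ a - lfQ f μ b| = (|a - b| - μ * kflux f a b) / 2 := by
  have h1 : |μ * (f a - f b)| ≤ |a - b| := by
    rw [abs_mul, abs_of_pos hμ]
    calc μ * |f a - f b| ≤ μ * (Λ * |a - b|) := by gcongr; exact hf a b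
      _ = (μ * Λ) * |a - b| := by ring
      _ ≤ 1 * |a - b| := by gcongr
      _ = _ := one_mul _
  rw [abs_le] at h1
  unfold lfP lfQ
  rcases le_total b a with h | h
  · rw [kflux_of_le h]
    rw [abs_of_nonneg (sub_nonneg.2 h)] at h1 ⊢
    constructor
    · rw [abs_of_nonneg (by linarith)]; ring
    · rw [abs_of_nonneg (by linarith)]; ring
  · rw [kflux_of_ge h]
    rw [abs_of_nonpos (sub_nonpos.2 h)] at h1 ⊢
    constructor
    · rw [abs_of_nonpos (by linarith)]; ring
    · rw [abs_of_nonpos (by linarith)]; ring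

lemma lf_abs_add_le (a b : ℝ) : |lfP f μ a - lfP f μ b| + |lfQ f μ a - lfQ f μ b| ≤ |a - b| := by
  obtain ⟨h1, h2⟩ := lf_abs hf hμ hμΛ a b
  rw [h1, h2]
  linarith

lemma lfP_mono {a b : ℝ} (hab : a ≤ b) : lfP f μ a ≤ lfP f μ b ∧ lfQ f μ a ≤ lfQ f μ b := by
  have h := lf_abs_add_le hf hμ hμΛ b a
  rw [abs_of_nonneg (sub_nonneg.2 hab)] at h
  have e : ∀ r, lfP f μ r + lfQ f μ r = r := fun r => by unfold lfP lfQ; ring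
  have ea := e a
  have eb := e b
  constructor
  · linarith [neg_abs_le (lfP f μ b - lfP f μ a), le_abs_self (lfQ f μ b - lfQ f μ a)]
  · linarith [neg_abs_le (lfQ f μ b - lfQ f μ a), le_abs_self (lfP f μ b - lfP f μ a)]

lemma BVBox.lfStep {M W R : ℝ} {u : ℝ → ℝ} (hu : BVBox M W R u) (hW : 0 ≤ W) {h : ℝ} (hh : 0 ≤ h) :
    BVBox M W (R + h) (lfStep f μ h u) where
  range x := by
    have e : ∀ r, lfP f μ r + lfQ f μ r = r := fun r => by unfold lfP lfQ; ring
    have a1 := lfP_mono hf hμ hμΛ (hu.range (x - h)).1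
    have a2 := lfP_mono hf hμ hμΛ (hu.range (x - h)).2
    have a3 := lfP_mono hf hμ hμΛ (hu.range (x + h)).1
    have a4 := lfP_mono hf hμ hμΛ (hu.range (x + h)).2
    have := e 0
    have := e M
    constructor <;> unfold _root_.lfStep <;> linarith [a1.1, a2.1, a3.2, a4.2]
  var := eVariationOn_split hu.var hW (lf_abs_add_le hf hμ hμΛ) hh
  supp x hx := by
    have e : lfP f μ 0 + lfQ f μ 0 = 0 := by unfold lfP lfQ; ring
    have h1 : R < |x - h| := by
      have := abs_add_le (x - h) h
      rw [sub_add_cancel, abs_of_nonneg hh] at this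
      linarith
    have h2 : R < |x + h| := by
      have := abs_sub (x + h) h
      rw [add_sub_cancel_right, abs_of_nonneg hh] at this
      linarith
    unfold _root_.lfStep
    rw [hu.supp _ h1, hu.supp _ h2, e]

lemma lfStep_integral_le {M W R : ℝ} {u : ℝ → ℝ} (hu : BVBox M W R u) (hW : 0 ≤ W) {h : ℝ}
    (hh : 0 ≤ h) : ∫ x, |lfStep f μ h u x - u x| ≤ 2 * h * W := by
  obtain ⟨i1, b1⟩ := integral_translate_le hu.var hW (-h)
  obtain ⟨i2, b2⟩ := integral_translate_le hu.var hW h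
  rw [abs_neg, abs_of_nonneg hh] at b1
  rw [abs_of_nonneg hh] at b2
  have key : ∫ x, |lfStep f μ h u x - u x| ≤ ∫ x, (|u (x + -h) - u x| + |u (x + h) - u x|) := by
    refine integral_mono_of_nonneg (Eventually.of_forall fun _ => abs_nonneg _) (i1.abs.add i2.abs)
      (Eventually.of_forall fun x => ?_)
    have e : ∀ r, lfP f μ r + lfQ f μ r = r := fun r => by unfold lfP lfQ; ring
    have c1 := lf_abs_add_le hf hμ hμΛ (u (x + -h)) (u x)
    have c2 := lf_abs_add_le hf hμ hμΛ (u (x + h)) (u x)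
    have e2 : lfStep f μ h u x - u x = (lfP f μ (u (x + -h)) - lfP f μ (u x))
        + (lfQ f μ (u (x + h)) - lfQ f μ (u x)) := by
      rw [lfStep, sub_eq_add_neg x h]
      linarith [e (u x)]
    simp only
    rw [e2]
    refine (abs_add_le _ _).trans ?_
    linarith [abs_nonneg (lfQ f μ (u (x + -h)) - lfQ f μ (u x)),
      abs_nonneg (lfP f μ (u (x + h)) - lfP f μ (u x))]
  rw [integral_add i1.abs i2.abs] at key
  linarith

lemma lfStep_entropy (u : ℝ → ℝ) (h k x : ℝ) : |lfStep f μ h u x - k| ≤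
    (|u (x - h) - k| + μ * kflux f (u (x - h)) k) / 2
      + (|u (x + h) - k| - μ * kflux f (u (x + h)) k) / 2 := by
  rw [← (lf_abs hf hμ hμΛ _ _).1, ← (lf_abs hf hμ hμΛ _ _).2]
  have e : k = lfP f μ k + lfQ f μ k := by unfold lfP lfQ; ring
  have : lfStep f μ h u x - k = (lfP f μ (u (x - h)) - lfP f μ k)
      + (lfQ f μ (u (x + h)) - lfQ f μ k) := by
    rw [lfStep]
    linarith
  rw [this]
  exact abs_add_le _ _

/-- Lax–Friedrichs approximation after `j` steps. -/
lemma BVBox.lfIter {M W R : ℝ} {u : ℝ → ℝ} (hu : BVBox M W R u) (hW : 0 ≤ W) {h : ℝ} (hh : 0 ≤ h)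
    (j : ℕ) : BVBox M W (R + j * h) ((_root_.lfStep f μ h)^[j] u) := by
  induction j with
  | zero => simpa using hu
  | succ j ih =>
    rw [Function.iterate_succ_apply']
    have := BVBox.lfStep hf hμ hμΛ ih hW hh
    have e : R + ((j + 1 : ℕ) : ℝ) * h = R + j * h + h := by push_cast; ring
    rw [e]
    exact this

lemma lfIter_integral_le {M W R : ℝ} {u : ℝ → ℝ} (hu : BVBox M W R u) (hW : 0 ≤ W) {h : ℝ}
    (hh : 0 ≤ h) (i j : ℕ) (hij : i ≤ j) :
    ∫ x, |(lfStep f μ h)^[j] u x - (lfStep f μ h)^[i] u x| ≤ (j - i) * (2 * h * W) := by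
  induction j, hij using Nat.le_induction with
  | base => simp
  | succ j hj ih =>
    have b := fun j => BVBox.lfIter hf hμ hμΛ hu hW hh j
    have t := integral_abs_sub_triangle (b (j + 1)).integrable (b j).integrable (b i).integrable
    have s := lfStep_integral_le hf hμ hμΛ (b j) hW hh
    rw [← Function.iterate_succ_apply' (lfStep f μ h)] at s
    push_cast
    linarith

end

/-- A Kruzhkov solution with uniform bounds. -/
structure EvolSol (f : ℝ → ℝ) (M W A B K : ℝ) (u : ℝ × ℝ → ℝ) : Prop where
  meas : Measurable u
  box : ∀ t, BVBox M W (A + B * max t 0) (fun x => u (t, x))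
  lip : ∀ s t, ∫ x, |u (t, x) - u (s, x)| ≤ K * |t - s|
  kruzhkov : ∀ k, WeakIneq univ (fun P => |u P - k|) (fun P => kflux f (u P) k)

theorem exists_evolSol {f : ℝ → ℝ} {Λ : ℝ} (hΛ : 0 ≤ Λ) (hf : ∀ a b, |f a - f b| ≤ Λ * |a - b|)
    {M W A : ℝ} (hM : 0 ≤ M) (hW : 0 ≤ W) (hA : 0 ≤ A) {u₀ : ℝ → ℝ} (hu₀ : BVBox M W A u₀) :
    ∃ B K : ℝ, 0 ≤ B ∧ 0 ≤ K ∧ ∃ u, EvolSol f M W A B K u ∧ ∀ᵐ x, u (0, x) = u₀ x := by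
  obtain ⟨μ, hμ, hμΛ⟩ : ∃ μ > 0, μ * Λ ≤ 1 := ⟨1 / (Λ + 1), by positivity, by
    rw [one_div_mul_eq_div, div_le_one (by positivity)]; linarith⟩
  have hfm : Measurable f := by
    have : LipschitzWith Λ.toNNReal f := LipschitzWith.of_dist_le_mul fun a b => by
      rw [Real.dist_eq, Real.dist_eq, Real.coe_toNNReal _ hΛ]; exact hf a b
    exact this.continuous.measurable
  set h : ℕ → ℝ := fun n => 1 / ((n : ℝ) + 1) with hh
  have hpos : ∀ n, 0 < h n := fun n => by positivity
  have hle : ∀ n, h n ≤ 1 := fun n => by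
    simp only [hh]
    rw [div_le_one (by positivity)]
    linarith [(Nat.cast_nonneg n : (0 : ℝ) ≤ n)]
  have hlim : Tendsto h atTop (nhds 0) := tendsto_one_div_add_atTop_nhds_zero_nat
  set U : ℕ → ℝ → ℝ → ℝ := fun n t => (lfStep f μ (h n))^[⌊t / (μ * h n)⌋₊] u₀ with hU
  have hit := fun n j => BVBox.lfIter hf hμ hμΛ hu₀ hW (hpos n).le j
  have hb : ∀ n t, BVBox M W (A + 1 / μ * max t 0) (U n t) := by
    intro n t
    refine (hit n _).mono ?_
    have hp := hpos n
    refine add_le_add le_rfl ?_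
    rcases le_total t 0 with ht | ht
    · rw [Nat.floor_of_nonpos (div_nonpos_of_nonpos_of_nonneg ht (by positivity))]
      simp
      positivity
    · rw [max_eq_left ht]
      calc (⌊t / (μ * h n)⌋₊ : ℝ) * h n ≤ t / (μ * h n) * h n := by
            gcongr; exact Nat.floor_le (by positivity)
        _ = _ := by field_simp
  have hK' : ∀ n s t, s ≤ t → ∫ x, |U n t x - U n s x| ≤ 2 * W / μ * |t - s| + 2 * W * h n := by
    intro n s t hst
    have hp := hpos n
    have hdt : 0 < μ * h n := by positivity
    have hfl : ⌊s / (μ * h n)⌋₊ ≤ ⌊t / (μ * h n)⌋₊ := Nat.floor_le_floor (by gcongr)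
    have := lfIter_integral_le hf hμ hμΛ hu₀ hW hp.le _ _ hfl
    refine this.trans ?_
    have key : (⌊t / (μ * h n)⌋₊ : ℝ) - ⌊s / (μ * h n)⌋₊ ≤ (t - s) / (μ * h n) + 1 := by
      rcases le_total t 0 with ht | ht
      · rw [Nat.floor_of_nonpos (div_nonpos_of_nonpos_of_nonneg ht hdt.le)]
        have : 0 ≤ (t - s) / (μ * h n) := div_nonneg (by linarith) hdt.le
        have := (Nat.cast_nonneg ⌊s / (μ * h n)⌋₊ : (0 : ℝ) ≤ _)
        push_cast
        linarith
      · have a1 := Nat.floor_le (show 0 ≤ t / (μ * h n) by positivity)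
        have a2 := Nat.lt_floor_add_one (s / (μ * h n))
        rw [sub_div]
        linarith
    rw [abs_of_nonneg (sub_nonneg.2 hst)]
    calc _ ≤ ((t - s) / (μ * h n) + 1) * (2 * h n * W) := by gcongr
      _ = _ := by field_simp
  have hK : ∀ n s t, ∫ x, |U n t x - U n s x| ≤ 2 * W / μ * |t - s| + 2 * W * h n := by
    intro n s t
    rcases le_total s t with hst | hst
    · exact hK' n s t hst
    · rw [abs_sub_comm t s]
      simp_rw [abs_sub_comm (U n t _)]
      exact hK' n t s hst
  obtain ⟨F, hF1, hF, u, hum, hub, huL, hconv, hunif⟩ :=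
    exists_limit_of_approx hM hW hA (one_div_pos.2 hμ).le (by positivity : 0 ≤ 2 * W / μ) hb
      (by simpa using hlim.const_mul (2 * W)) hK
  have hUm : ∀ n, Measurable (fun P : ℝ × ℝ => U n P.1 P.2) := by
    intro n
    have h1 : Measurable (fun P : ℕ × ℝ => (lfStep f μ (h n))^[P.1] u₀ P.2) :=
      measurable_from_prod_countable_right fun j => (hit n j).meas
    have h2 : Measurable (fun P : ℝ × ℝ => (⌊P.1 / (μ * h n)⌋₊, P.2)) := by fun_prop
    exact h1.comp h2
  have hUB : ∀ n, BddMeas (fun P : ℝ × ℝ => U n P.1 P.2) := fun n => ⟨hUm n, M, fun P => by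
    rw [abs_of_nonneg ((hb n _).range _).1]; exact ((hb n _).range _).2⟩
  have huB : BddMeas (fun P : ℝ × ℝ => u P.1 P.2) := ⟨hum, M, fun P => by
    rw [abs_of_nonneg ((hub _).range _).1]; exact ((hub _).range _).2⟩
  refine ⟨1 / μ, 2 * W / μ, by positivity, by positivity, fun P => u P.1 P.2,
    ⟨hum, hub, huL, fun k => ?_⟩, ?_⟩
  · have hkc : ∀ n, BddMeas (fun P : ℝ × ℝ => |U n P.1 P.2 - k|) := fun n =>
      ((hUB n).sub (BddMeas.const k)).abs
    have hkg : ∀ n, BddMeas (fun P : ℝ × ℝ => kflux f (U n P.1 P.2) k) := fun n =>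
      (hUB n).kflux hf hfm (BddMeas.const k)
    refine weakIneq_of_discrete hF hμ hpos hle hlim hkc hkg (huB.sub (BddMeas.const k)).abs
      (huB.kflux hf hfm (BddMeas.const k)) ?_ ?_ ?_
    · intro n P hP
      have hp := hpos n
      have hdt : 0 < μ * h n := by positivity
      have e : U n (P.1 + μ * h n) = lfStep f μ (h n) (U n P.1) := by
        simp only [hU]
        rw [← Function.iterate_succ_apply' (lfStep f μ (h n)), add_div, div_self hdt.ne',
          Nat.floor_add_one (by positivity)]
      simp only [Prod.fst_add, Prod.snd_add, Prod.fst_neg, Prod.snd_neg, neg_zero, add_zero]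
      rw [e]
      have := lfStep_entropy hf hμ hμΛ (U n P.1) (h n) k P.2
      rwa [sub_eq_add_neg P.2] at this
    · intro T ε hε
      filter_upwards [hunif T ε hε] with n hn t ht
      have hi := ((hb n t).integrable.sub (hub t).integrable).abs
      have hpt : ∀ x, |(|U n t x - k| - |u t x - k|)| ≤ |U n t x - u t x| := fun x => by
        have := abs_abs_sub_abs_le_abs_sub (U n t x - k) (u t x - k)
        rwa [sub_sub_sub_cancel_right] at this
      have hm1 := (hb n t).meas
      have hm2 := (hub t).meas
      refine ⟨hi.mono' (by fun_prop) (Eventually.of_forall hpt), le_trans ?_ (hn t ht)⟩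
      exact integral_mono_of_nonneg (Eventually.of_forall fun _ => abs_nonneg _) hi
        (Eventually.of_forall hpt)
    · intro T ε hε
      filter_upwards [hunif T (ε / (Λ + 1)) (by positivity)] with n hn t ht
      have hi := (((hb n t).integrable.sub (hub t).integrable).abs).const_mul (Λ + 1)
      have hpt : ∀ x, |kflux f (U n t x) k - kflux f (u t x) k| ≤ (Λ + 1) * |U n t x - u t x| := by
        intro x
        rw [kflux_comm, kflux_comm f (u t x)]
        refine (abs_kflux_sub_le hf _ _ _).trans ?_
        gcongr; linarith
      have hm1 := measurable_kflux hfm (hb n t).meas (measurable_const (a := k))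
      have hm2 := measurable_kflux hfm (hub t).meas (measurable_const (a := k))
      refine ⟨hi.mono' (hm1.sub hm2).aestronglyMeasurable (Eventually.of_forall hpt), ?_⟩
      refine (integral_mono_of_nonneg (Eventually.of_forall fun _ => abs_nonneg _) hi
        (Eventually.of_forall hpt)).trans ?_
      rw [integral_const_mul]
      have := hn t ht
      rw [le_div_iff₀ (by positivity), mul_comm] at this
      exact this
  · have h0 : ∀ n, U n 0 = u₀ := fun n => by simp [hU]
    have h1 := hconv 0
    simp only [h0] at h1
    have h2 : ∫ x, |u₀ x - u 0 x| = 0 := tendsto_nhds_unique tendsto_const_nhds h1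
    have hi : Integrable fun x => |u₀ x - u 0 x| := (hu₀.integrable.sub (hub 0).integrable).abs
    rw [integral_eq_zero_iff_of_nonneg (fun _ => abs_nonneg _) hi] at h2
    filter_upwards [h2] with x hx
    simp only [Pi.zero_apply, abs_eq_zero] at hx
    linarith

lemma TimeL1.of_le {D E : ℝ × ℝ → ℝ} (h : TimeL1 D) {C : ℝ}
    (hm : Measurable E) (h0 : ∀ t, 0 ≤ t → ∀ x, |E (t, x)| ≤ C * |D (t, x)|)
    (hd : ∀ s t, 0 ≤ s → 0 ≤ t → ∀ x, |E (t, x) - E (s, x)| ≤ C * |D (t, x) - D (s, x)|) :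
    TimeL1 E where
  int t ht := ((h.int t ht).abs.const_mul C).mono'
    (hm.comp measurable_prodMk_left).aestronglyMeasurable (Eventually.of_forall (h0 t ht))
  cont s hs := by
    have h1 := (h.cont s hs).const_mul C
    rw [mul_zero] at h1
    refine squeeze_zero' (Eventually.of_forall fun t => integral_nonneg fun _ => abs_nonneg _) ?_ h1
    filter_upwards [self_mem_nhdsWithin] with t ht
    rw [← integral_const_mul]
    exact integral_mono_of_nonneg (Eventually.of_forall fun _ => abs_nonneg _)
      (((h.int t ht).sub (h.int s hs)).abs.const_mul C) (Eventually.of_forall (hd s t hs ht))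

lemma TimeL1.abs_sub {D E : ℝ × ℝ → ℝ} (hD : TimeL1 D) (hE : TimeL1 E) :
    TimeL1 (fun P => |D P - E P|) where
  int t ht := ((hD.int t ht).sub (hE.int t ht)).abs
  cont s hs := by
    have h1 := (hD.cont s hs).add (hE.cont s hs)
    rw [add_zero] at h1
    refine squeeze_zero' (Eventually.of_forall fun t => integral_nonneg fun _ => abs_nonneg _) ?_ h1
    filter_upwards [self_mem_nhdsWithin] with t ht
    have i1 := ((hD.int t ht).sub (hD.int s hs)).abs
    have i2 := ((hE.int t ht).sub (hE.int s hs)).abs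
    refine le_trans ?_ (integral_add i1 i2).le
    refine integral_mono_of_nonneg (Eventually.of_forall fun _ => abs_nonneg _) (i1.add i2)
      (Eventually.of_forall fun x => ?_)
    simp only [Pi.add_apply, Pi.sub_apply]
    refine (abs_abs_sub_abs_le_abs_sub _ _).trans ?_
    rw [show D (t, x) - E (t, x) - (D (s, x) - E (s, x)) =
      (D (t, x) - D (s, x)) - (E (t, x) - E (s, x)) by ring]
    exact _root_.abs_sub _ _

lemma TimeL1.neg {D : ℝ × ℝ → ℝ} (hD : TimeL1 D) : TimeL1 (fun P => -D P) where
  int t ht := (hD.int t ht).neg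
  cont s hs := (hD.cont s hs).congr fun t => by
    simp only [neg_sub_neg]
    simp_rw [abs_sub_comm]

/-- Spatial reflection. -/
def reflX (P : ℝ × ℝ) : ℝ × ℝ := (P.1, -P.2)

lemma measurePreserving_reflX : MeasurePreserving reflX (volume : Measure (ℝ × ℝ)) volume :=
  (MeasurePreserving.id (volume : Measure ℝ)).prod (Measure.measurePreserving_neg volume)

lemma reflX_reflX (P : ℝ × ℝ) : reflX (reflX P) = P := by simp [reflX]

lemma measurable_reflX : Measurable reflX := measurePreserving_reflX.measurable

lemma integral_reflX (g : ℝ × ℝ → ℝ) : ∫ P, g (reflX P) = ∫ P, g P := by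
  refine measurePreserving_reflX.integral_comp ?_ g
  exact (MeasurableEquiv.mk ⟨reflX, reflX, reflX_reflX, reflX_reflX⟩ measurable_reflX
    measurable_reflX).measurableEmbedding

lemma IsTest.reflX {φ : ℝ × ℝ → ℝ} (h : IsTest φ) : IsTest (fun P => φ (reflX P)) where
  smooth := h.smooth.comp (contDiff_fst.prodMk contDiff_snd.neg)
  cpt := by
    have hh : Topology.IsClosedEmbedding _root_.reflX :=
      (Homeomorph.mk ⟨_root_.reflX, _root_.reflX, reflX_reflX, reflX_reflX⟩
        (continuous_fst.prodMk continuous_snd.neg)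
        (continuous_fst.prodMk continuous_snd.neg)).isClosedEmbedding
    exact h.cpt.comp_isClosedEmbedding hh
  zero p hp := h.zero _ hp
  nonneg p := h.nonneg _

lemma dT_reflX {φ : ℝ × ℝ → ℝ} (h : IsTest φ) (P : ℝ × ℝ) :
    dT (fun P => φ (reflX P)) P = dT φ (reflX P) := by
  have h1 := hasDerivAt_dT h.reflX.smooth P.1 P.2
  have h2 := hasDerivAt_dT h.smooth P.1 (-P.2)
  exact h1.unique h2

lemma dX_reflX {φ : ℝ × ℝ → ℝ} (h : IsTest φ) (P : ℝ × ℝ) :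
    dX (fun P => φ (reflX P)) P = -dX φ (reflX P) := by
  have h1 := hasDerivAt_dX h.reflX.smooth P.1 P.2
  have h2 := (hasDerivAt_dX h.smooth P.1 (-P.2)).scomp P.2 (hasDerivAt_neg P.2)
  have := h1.unique h2
  simp only [smul_eq_mul, neg_one_mul] at this
  exact this

lemma WeakIneq.reflX {Ω : Set (ℝ × ℝ)} {D q : ℝ × ℝ → ℝ} (h : WeakIneq Ω D q) :
    WeakIneq {P | reflX P ∈ Ω} (fun P => D (reflX P)) (fun P => -q (reflX P)) := by
  intro φ hφ hs
  have := h _ hφ.reflX (fun P hP => by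
    have := hs _ hP
    simpa [reflX_reflX] using this)
  rw [← integral_reflX] at this
  refine this.trans_eq (integral_congr_ae (Eventually.of_forall fun P => ?_))
  simp only [dT_reflX hφ, dX_reflX hφ, reflX_reflX]
  ring

lemma TimeL1.reflX {D : ℝ × ℝ → ℝ} (h : TimeL1 D) : TimeL1 (fun P => D (reflX P)) where
  int t ht := (h.int t ht).comp_neg
  cont s hs := (h.cont s hs).congr fun t =>
    (integral_neg_eq_self (fun x => |D (t, x) - D (s, x)|) volume).symm

lemma BddMeas.reflX {D : ℝ × ℝ → ℝ} (h : BddMeas D) : BddMeas (fun P => D (reflX P)) :=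
  ⟨h.1.comp measurable_reflX, h.2.imp fun _ hB _ => hB _⟩

lemma tendsto_integral_step {D : ℝ → ℝ} (hD : Integrable D) (c : ℝ) :
    Tendsto (fun n : ℕ => ∫ x, D x * stepAt 0 (1 / ((n : ℝ) + 1)) (x - c)) atTop
      (nhds (∫ x in Ioi c, D x)) := by
  rw [← integral_indicator measurableSet_Ioi]
  refine tendsto_integral_of_dominated_convergence (fun x => |D x|) (fun n => ?_) hD.abs
    (fun n => Eventually.of_forall fun x => ?_) (Eventually.of_forall fun x => ?_)
  · exact hD.aestronglyMeasurable.mul ((stepAt_contDiff 0 _).continuous.comp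
      (continuous_id.sub continuous_const)).aestronglyMeasurable
  · rw [norm_mul, Real.norm_eq_abs, Real.norm_eq_abs, abs_of_nonneg (stepAt_nonneg _ _ _)]
    exact mul_le_of_le_one_right (abs_nonneg _) (stepAt_le_one _ _ _)
  · by_cases hx : x ∈ Ioi c
    · rw [indicator_of_mem hx]
      refine tendsto_const_nhds.congr' ?_
      have hx' : 0 < x - c := sub_pos.2 hx
      filter_upwards [(tendsto_one_div_add_atTop_nhds_zero_nat (𝕜 := ℝ)).eventually
        (gt_mem_nhds hx')] with n hn
      rw [stepAt_one (by positivity) (by linarith), mul_one]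
    · rw [indicator_of_notMem hx]
      refine tendsto_const_nhds.congr fun n => ?_
      rw [stepAt_zero (by positivity) (by simp only [mem_Ioi, not_lt] at hx; linarith), mul_zero]

/-- Mass to the right of a line which the flow does not cross. -/
theorem WeakIneq.integral_Ioi_le {D q : ℝ × ℝ → ℝ} {Λ : ℝ} (hD : BddMeas D) (hq : BddMeas q)
    (hqD : ∀ P, |q P| ≤ Λ * |D P|) (hT : TimeL1 D) {s0 α κ δ : ℝ} (hs0 : 0 ≤ s0) (hδ : 0 < δ)
    (hW : WeakIneq {P | s0 < P.1 ∧ α + κ * P.1 < P.2} D q)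
    (hsgn : ∀ᵐ P : ℝ × ℝ, s0 < P.1 → α + κ * P.1 < P.2 → P.2 < α + κ * P.1 + δ → q P ≤ κ * D P)
    {s t : ℝ} (hs : s0 ≤ s) (hst : s ≤ t) :
    ∫ x in Ioi (α + κ * t), D (t, x) ≤ ∫ x in Ioi (α + κ * s), D (s, x) := by
  have h1 := tendsto_integral_step (hT.int t (hs0.trans (hs.trans hst))) (α + κ * t)
  have h2 := tendsto_integral_step (hT.int s (hs0.trans hs)) (α + κ * s)
  refine le_of_tendsto_of_tendsto h1 h2 ?_
  filter_upwards [(tendsto_one_div_add_atTop_nhds_zero_nat (𝕜 := ℝ)).eventually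
    (gt_mem_nhds hδ)] with n hn
  have hε : (0 : ℝ) < 1 / ((n : ℝ) + 1) := by positivity
  refine WeakIneq.integral_cutoff_le hD hq hqD hT (stepAt_contDiff 0 _) (stepAt_nonneg 0 _)
    (stepAt_le_one 0 _) hs0 (hW.mono fun P hP => ⟨hP.1, ?_⟩) ?_ hs hst
  · by_contra hc
    exact hP.2 (stepAt_zero hε (by linarith))
  · have hne : ∀ᵐ P : ℝ × ℝ, P.2 - (α + κ * P.1) ≠ 0 := by
      have hm : MeasurableSet {P : ℝ × ℝ | P.2 - (α + κ * P.1) = 0} :=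
        measurableSet_eq_fun (by fun_prop) measurable_const
      rw [ae_iff]
      simp only [ne_eq, not_not]
      rw [Measure.volume_eq_prod, Measure.measure_prod_null hm]
      refine Eventually.of_forall fun t => ?_
      have : (Prod.mk t ⁻¹' {P : ℝ × ℝ | P.2 - (α + κ * P.1) = 0}) = {α + κ * t} := by
        ext x; simp [sub_eq_zero]
      simp [this]
    filter_upwards [hsgn, hne] with P hP hP0 hPs
    by_cases hmem : P.2 - (α + κ * P.1) ∈ Icc (0 : ℝ) (0 + 1 / ((n : ℝ) + 1))
    · refine mul_nonpos_of_nonneg_of_nonpos (stepAt_deriv_nonneg 0 hε _) ?_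
      have hgt : 0 < P.2 - (α + κ * P.1) := lt_of_le_of_ne hmem.1 (Ne.symm hP0)
      have := hP hPs (by linarith) (by linarith [hmem.2])
      linarith
    · rw [stepAt_deriv_eq_zero hε hmem, zero_mul]

theorem WeakIneq.integral_Iio_le {D q : ℝ × ℝ → ℝ} {Λ : ℝ} (hD : BddMeas D) (hq : BddMeas q)
    (hqD : ∀ P, |q P| ≤ Λ * |D P|) (hT : TimeL1 D) {s0 α κ δ : ℝ} (hs0 : 0 ≤ s0) (hδ : 0 < δ)
    (hW : WeakIneq {P | s0 < P.1 ∧ P.2 < α + κ * P.1} D q)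
    (hsgn : ∀ᵐ P : ℝ × ℝ, s0 < P.1 → P.2 < α + κ * P.1 → α + κ * P.1 - δ < P.2 → κ * D P ≤ q P)
    {s t : ℝ} (hs : s0 ≤ s) (hst : s ≤ t) :
    ∫ x in Iio (α + κ * t), D (t, x) ≤ ∫ x in Iio (α + κ * s), D (s, x) := by
  have hr : ∀ r, ∫ x in Ioi (-α + -κ * r), D (r, -x) = ∫ x in Iio (α + κ * r), D (r, x) := by
    intro r
    rw [integral_comp_neg_Ioi (-α + -κ * r) (fun x => D (r, x)), integral_Iic_eq_integral_Iio]
    congr 3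
    ring
  rw [← hr, ← hr]
  refine WeakIneq.integral_Ioi_le (D := fun P => D (_root_.reflX P)) (q := fun P => -q (_root_.reflX P)) (Λ := Λ)
    hD.reflX hq.reflX.neg (fun P => by rw [abs_neg]; exact hqD _) hT.reflX hs0 hδ
    (hW.reflX.mono ?_) ?_ hs hst
  · rintro P ⟨h1, h2⟩
    refine ⟨h1, ?_⟩
    simp only [_root_.reflX]
    linarith
  · filter_upwards [measurePreserving_reflX.quasiMeasurePreserving.ae hsgn] with P hP h1 h2 h3
    have := hP h1 (by simp only [_root_.reflX]; linarith) (by simp only [_root_.reflX]; linarith)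
    linarith

theorem WeakIneq.integral_le {D q : ℝ × ℝ → ℝ} {Λ : ℝ} (hD : BddMeas D) (hq : BddMeas q)
    (hqD : ∀ P, |q P| ≤ Λ * |D P|) (hT : TimeL1 D) (hW : WeakIneq univ D q)
    {s t : ℝ} (hs : 0 ≤ s) (hst : s ≤ t) : ∫ x, D (t, x) ≤ ∫ x, D (s, x) := by
  have := WeakIneq.integral_cutoff_le hD hq hqD hT (χ := fun _ => 1) contDiff_const
    (fun _ => zero_le_one) (fun _ => le_rfl) (α := 0) (κ := 0) le_rfl (hW.mono (subset_univ _))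
    (Eventually.of_forall fun P _ => by simp) hs hst
  simpa using this

/-- Iterated running maxima of neighbouring entries, with value `0` at index `0`. -/
def maxIter (R : ℕ → ℝ) : ℕ → ℕ → ℝ
  | 0, i => R i
  | _ + 1, 0 => 0
  | n + 1, i + 1 => max (maxIter R n i) (maxIter R n (i + 1))

section
variable {R : ℕ → ℝ} {M : ℝ}

lemma maxIter_mem (h0 : R 0 = 0) (hM : 0 ≤ M) (hR : ∀ i, R i ∈ Icc 0 M) (n i : ℕ) :
    maxIter R n i ∈ Icc 0 M := by
  induction n generalizing i with
  | zero => exact hR i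
  | succ n ih =>
    cases i with
    | zero => exact ⟨le_rfl, hM⟩
    | succ i => exact ⟨le_max_of_le_left (ih i).1, max_le (ih i).2 (ih (i + 1)).2⟩

lemma maxIter_zero (h0 : R 0 = 0) (n : ℕ) : maxIter R n 0 = 0 := by
  cases n with
  | zero => exact h0
  | succ n => rfl

lemma maxIter_eq_zero {J : ℕ} (hJ : ∀ i, J ≤ i → R i = 0) (n i : ℕ) (hi : J + n ≤ i) :
    maxIter R n i = 0 := by
  induction n generalizing i with
  | zero => exact hJ i hi
  | succ n ih =>
    cases i with
    | zero => rfl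
    | succ i =>
      change max (maxIter R n i) (maxIter R n (i + 1)) = 0
      rw [ih i (by omega), ih (i + 1) (by omega), max_self]

lemma maxIter_mass_le {g : ℝ → ℝ} (h0 : R 0 = 0) (hM : 0 ≤ M) (hR : ∀ i, R i ∈ Icc 0 M)
    (hg : MonotoneOn g (Icc 0 M)) (hg0 : g 0 = 0) {J : ℕ} (hJ : ∀ i, J ≤ i → R i = 0) (n N : ℕ)
    (hN : J + n ≤ N) {F F' : ℕ → ℝ} (hF1 : ∀ i, F i ≤ F' (i + 1)) (hF2 : ∀ i, F' i ≤ F i) :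
    ∑ i ∈ Finset.range N, g (maxIter R n (i + 1)) * (F (i + 2) - F (i + 1)) ≤
    ∑ i ∈ Finset.range N, g (maxIter R (n + 1) (i + 1)) * (F' (i + 2) - F' (i + 1)) := by
  set T : ℕ → ℝ := fun i => g (maxIter R n i) * (F' (i + 1) - F (i + 1)) with hT
  have hTN : T N - T 0 = 0 := by
    simp only [hT]
    rw [maxIter_zero h0, maxIter_eq_zero hJ n N hN, hg0]; ring
  have key : ∑ i ∈ Finset.range N, (T (i + 1) - T i) ≤
      ∑ i ∈ Finset.range N, (g (maxIter R (n + 1) (i + 1)) * (F' (i + 2) - F' (i + 1)) -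
        g (maxIter R n (i + 1)) * (F (i + 2) - F (i + 1))) := by
    refine Finset.sum_le_sum fun i _ => ?_
    have hm := maxIter_mem h0 hM hR n
    change _ ≤ g (max (maxIter R n i) (maxIter R n (i + 1))) * (F' (i + 2) - F' (i + 1)) - _
    simp only [hT]
    have f1 := hF1 (i + 1)
    have f2 := hF2 (i + 1)
    rcases le_total (maxIter R n i) (maxIter R n (i + 1)) with h | h
    · rw [max_eq_right h]
      have := hg (hm i) (hm (i + 1)) h
      nlinarith [mul_nonneg (sub_nonneg.2 this) (sub_nonneg.2 f2)]
    · rw [max_eq_left h]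
      have := hg (hm (i + 1)) (hm i) h
      nlinarith [mul_nonneg (sub_nonneg.2 this) (sub_nonneg.2 f1)]
  rw [Finset.sum_range_sub, hTN, Finset.sum_sub_distrib] at key
  linarith

/-- Total decrease of the sequence. -/
def downVar (s : ℕ → ℝ) (N : ℕ) : ℝ := ∑ i ∈ Finset.range N, max (s i - s (i + 1)) 0

lemma downVar_maxIter_succ_le {H : ℝ → ℝ} (h0 : R 0 = 0) (hM : 0 ≤ M) (hR : ∀ i, R i ∈ Icc 0 M)
    (hH : MonotoneOn H (Icc 0 M)) (n N : ℕ) :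
    downVar (fun i => H (maxIter R (n + 1) i)) N ≤ downVar (fun i => H (maxIter R n i)) N := by
  have hm := maxIter_mem h0 hM hR
  have hmax : ∀ i, H (maxIter R (n + 1) (i + 1)) =
      max (H (maxIter R n i)) (H (maxIter R n (i + 1))) := fun i => by
    change H (max _ _) = _
    rcases le_total (maxIter R n i) (maxIter R n (i + 1)) with h | h
    · rw [max_eq_right h, max_eq_right (hH (hm n i) (hm n _) h)]
    · rw [max_eq_left h, max_eq_left (hH (hm n _) (hm n i) h)]
  unfold downVar
  cases N with
  | zero => simp
  | succ N =>
    rw [Finset.sum_range_succ']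
    have hz : max (H (maxIter R (n + 1) 0) - H (maxIter R (n + 1) (0 + 1))) 0 = 0 := by
      rw [maxIter_zero h0]
      exact max_eq_right (sub_nonpos.2 (hH ⟨le_rfl, hM⟩ (hm _ _) (hm _ _).1))
    rw [hz, add_zero, Finset.sum_range_succ]
    refine le_add_of_le_of_nonneg (Finset.sum_le_sum fun i _ => ?_) (le_max_right _ _)
    simp only [hmax]
    refine max_le ?_ (le_max_right _ _)
    rcases le_total (H (maxIter R n i)) (H (maxIter R n (i + 1))) with h | h
    · rw [max_eq_right h]
      exact le_trans (by linarith [le_max_left (H (maxIter R n (i + 1))) (H (maxIter R n (i + 1 + 1)))])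
        (le_max_right _ _)
    · rw [max_eq_left h]
      exact le_trans (by linarith [le_max_left (H (maxIter R n (i + 1))) (H (maxIter R n (i + 1 + 1)))])
        (le_max_left _ _)

lemma sum_maxIter_le {H : ℝ → ℝ} (h0 : R 0 = 0) (hM : 0 ≤ M) (hR : ∀ i, R i ∈ Icc 0 M)
    (hH : MonotoneOn H (Icc 0 M)) (n N : ℕ) :
    ∑ i ∈ Finset.range N, H (maxIter R n (i + 1)) ≤
      (∑ i ∈ Finset.range N, H (R (i + 1))) + n * downVar (fun i => H (R i)) N := by
  have hm := maxIter_mem h0 hM hR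
  have hD : ∀ n, downVar (fun i => H (maxIter R n i)) N ≤ downVar (fun i => H (R i)) N := by
    intro n
    induction n with
    | zero => exact le_rfl
    | succ n ih => exact (downVar_maxIter_succ_le h0 hM hR hH n N).trans ih
  induction n with
  | zero => simp [maxIter]
  | succ n ih =>
    have e : ∑ i ∈ Finset.range N, H (maxIter R (n + 1) (i + 1)) =
        (∑ i ∈ Finset.range N, H (maxIter R n (i + 1))) + downVar (fun i => H (maxIter R n i)) N := by
      unfold downVar
      rw [← Finset.sum_add_distrib]
      refine Finset.sum_congr rfl fun i _ => ?_
      change H (max _ _) = _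
      rcases le_total (maxIter R n i) (maxIter R n (i + 1)) with h | h
      · have := hH (hm n i) (hm n _) h
        rw [max_eq_right h, max_eq_right (by linarith)]; ring
      · have := hH (hm n _) (hm n i) h
        rw [max_eq_left h, max_eq_left (by linarith)]; ring
    rw [e]
    push_cast
    linarith [hD n]

lemma downVar_sample_le {u : ℝ → ℝ} {H : ℝ → ℝ} {a b h L W : ℝ} (hM : 0 ≤ M) (hL : 0 ≤ L)
    (hW : 0 ≤ W)
    (hu : ∀ x, u x ∈ Icc 0 M) (hH0 : H 0 = 0) (hH : MonotoneOn H (Icc 0 M))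
    (hHL : ∀ r ∈ Icc 0 M, ∀ s ∈ Icc 0 M, |H r - H s| ≤ L * |r - s|) (hh : 0 < h)
    (h0 : u a = 0) (hv : eVariationOn u (Ioo a b) ≤ ENNReal.ofReal W) {J : ℕ}
    (hJ : ∀ i, J ≤ i → u (a + i * h) = 0) (hJ' : ∀ i : ℕ, i < J → a + i * h < b) (N : ℕ) :
    downVar (fun i => H (u (a + i * h))) N ≤ H M + L * W := by
  have hHn : ∀ x, 0 ≤ H (u x) ∧ H (u x) ≤ H M := fun x =>
    ⟨by rw [← hH0]; exact hH ⟨le_rfl, hM⟩ (hu x) (hu x).1, hH (hu x) ⟨hM, le_rfl⟩ (hu x).2⟩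
  have hHM : 0 ≤ H M := (hHn 0).1.trans (hHn 0).2
  set s : ℕ → ℝ := fun i => u (a + i * h) with hs
  have hsum : ∑ i ∈ Finset.Ico 1 (J - 1), |s (i + 1) - s i| ≤ W := by
    have h1 := eVariationOn.sum_le_of_monotoneOn_Icc (f := u) (s := Ioo a b) (m := 1) (n := J - 1)
      (u := fun i : ℕ => a + i * h) (fun i _ j _ hij => by simp only; gcongr) (fun i hi => by
        rw [mem_Icc] at hi
        refine ⟨?_, hJ' i (by omega)⟩
        have : (0 : ℝ) < i := by exact_mod_cast hi.1
        nlinarith)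
    have h2 := h1.trans hv
    have h3 : ∑ i ∈ Finset.Ico 1 (J - 1), edist (u (a + ((i + 1 : ℕ) : ℝ) * h)) (u (a + (i : ℝ) * h))
        = ENNReal.ofReal (∑ i ∈ Finset.Ico 1 (J - 1), |s (i + 1) - s i|) := by
      rw [ENNReal.ofReal_sum_of_nonneg fun _ _ => abs_nonneg _]
      refine Finset.sum_congr rfl fun i _ => ?_
      rw [edist_dist, Real.dist_eq]
    rw [h3] at h2
    exact (ENNReal.ofReal_le_ofReal_iff hW).1 h2
  have hterm : ∀ i ∈ Finset.range N, max (H (s i) - H (s (i + 1))) 0 ≤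
      (if i ∈ Finset.Ico 1 (J - 1) then L * |s (i + 1) - s i| else 0) +
        (if i = J - 1 then H M else 0) := by
    intro i _
    have hn1 : 0 ≤ (if i ∈ Finset.Ico 1 (J - 1) then L * |s (i + 1) - s i| else 0) := by
      split_ifs <;> positivity
    have hn2 : 0 ≤ (if i = J - 1 then H M else 0) := by split_ifs <;> simp [hHM]
    refine max_le ?_ (by linarith)
    by_cases hi1 : i ∈ Finset.Ico 1 (J - 1)
    · rw [if_pos hi1]
      have := hHL _ (hu (a + i * h)) _ (hu (a + ((i + 1 : ℕ) : ℝ) * h))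
      rw [abs_sub_comm (u _)] at this
      have h2 := le_abs_self (H (s i) - H (s (i + 1)))
      simp only [hs] at h2 hn2 ⊢
      linarith
    · by_cases hi2 : i = J - 1
      · rw [if_pos hi2]
        have h1 := (hHn (a + i * h)).2
        have h2 := (hHn (a + ((i + 1 : ℕ) : ℝ) * h)).1
        simp only [hs] at hn1 ⊢
        linarith
      · rcases Nat.eq_zero_or_pos i with rfl | hi3
        · have e : H (s 0) = 0 := by simp [hs, h0, hH0]
          have h2 := (hHn (a + ((0 + 1 : ℕ) : ℝ) * h)).1
          rw [e]
          simp only [hs] at hn1 ⊢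
          linarith
        · have hiJ : J ≤ i := by
            rw [Finset.mem_Ico] at hi1
            omega
          have e1 : H (s i) = 0 := by simp only [hs]; rw [hJ i hiJ, hH0]
          have h2 := (hHn (a + ((i + 1 : ℕ) : ℝ) * h)).1
          rw [e1]
          simp only [hs] at hn1 ⊢
          linarith
  unfold downVar
  refine (Finset.sum_le_sum hterm).trans ?_
  rw [Finset.sum_add_distrib, add_comm]
  refine add_le_add ?_ ?_
  · rw [Finset.sum_ite_eq']
    split_ifs <;> linarith
  · rw [← Finset.sum_filter]
    calc _ ≤ ∑ i ∈ Finset.Ico 1 (J - 1), L * |s (i + 1) - s i| :=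
          Finset.sum_le_sum_of_subset_of_nonneg (fun i hi => (Finset.mem_filter.1 hi).2)
            fun _ _ _ => by positivity
      _ ≤ L * W := by rw [← Finset.mul_sum]; gcongr
end

/-- A nonnegative Lipschitz flux vanishing at the ends of `[0, ρm]`, whose increments are
bounded by `V`. -/
structure FluxOn (f : ℝ → ℝ) (ρm V Λ : ℝ) : Prop where
  pos : 0 ≤ ρm
  speed_nonneg : 0 ≤ V
  lip_nonneg : 0 ≤ Λ
  lip : ∀ a b, |f a - f b| ≤ Λ * |a - b|
  zero : f 0 = 0
  at_max : f ρm = 0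
  nonneg : ∀ a, 0 ≤ f a
  speed : ∀ a b, a ≤ b → f b - f a ≤ V * (b - a)

namespace FluxOn
variable {f : ℝ → ℝ} {ρm V Λ : ℝ}

lemma meas (h : FluxOn f ρm V Λ) : Measurable f := by
  have : LipschitzWith Λ.toNNReal f := LipschitzWith.of_dist_le_mul fun a b => by
    rw [Real.dist_eq, Real.dist_eq, Real.coe_toNNReal _ h.lip_nonneg]; exact h.lip a b
  exact this.continuous.measurable

lemma kflux_le (h : FluxOn f ρm V Λ) (a b : ℝ) : kflux f a b ≤ V * |a - b| := by
  rcases le_total a b with hab | hab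
  · rw [kflux_of_ge hab, abs_sub_comm, abs_of_nonneg (sub_nonneg.2 hab)]; exact h.speed a b hab
  · rw [kflux_of_le hab, abs_of_nonneg (sub_nonneg.2 hab)]; exact h.speed b a hab

lemma le_mul (h : FluxOn f ρm V Λ) {a : ℝ} (ha : 0 ≤ a) : f a ≤ V * a := by
  have := h.speed 0 a ha
  rw [h.zero] at this
  linarith

lemma abs_le (h : FluxOn f ρm V Λ) (a : ℝ) : |f a| ≤ Λ * |a| := by
  have := h.lip a 0
  rwa [h.zero, sub_zero, sub_zero] at this

end FluxOn

lemma BddMeas.of_range {X : Type*} [MeasurableSpace X] {u : X → ℝ} {ρm : ℝ} (hm : Measurable u)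
    (hr : ∀ x, u x ∈ Icc 0 ρm) : BddMeas u :=
  ⟨hm, ρm, fun x => by rw [abs_of_nonneg (hr x).1]; exact (hr x).2⟩

lemma BddMeas.comp_lip {X : Type*} [MeasurableSpace X] {f : ℝ → ℝ} {ρm V Λ : ℝ}
    (h : FluxOn f ρm V Λ) {u : X → ℝ} (hu : BddMeas u) : BddMeas (fun x => f (u x)) := by
  refine ⟨h.meas.comp hu.1, ?_⟩
  obtain ⟨B, hB⟩ := hu.2
  exact ⟨Λ * B, fun x => (h.abs_le _).trans (mul_le_mul_of_nonneg_left (hB x) h.lip_nonneg)⟩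

section
variable {f : ℝ → ℝ} {ρm V Λ : ℝ} {Ω : Set (ℝ × ℝ)} {u : ℝ × ℝ → ℝ}

lemma KruzhkovOn.weak_self (hK : KruzhkovOn f ρm Ω u) (hf : FluxOn f ρm V Λ)
    (hr : ∀ P, u P ∈ Icc 0 ρm) : WeakIneq Ω u (fun P => f (u P)) :=
  (hK 0 ⟨le_rfl, hf.pos⟩).congr (fun P _ _ => by rw [sub_zero, abs_of_nonneg (hr P).1])
    (fun P _ _ => by rw [kflux_of_le (hr P).1, hf.zero, sub_zero])

lemma KruzhkovOn.weak_neg (hK : KruzhkovOn f ρm Ω u) (hf : FluxOn f ρm V Λ)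
    (hm : Measurable u) (hr : ∀ P, u P ∈ Icc 0 ρm) :
    WeakIneq Ω (fun P => -u P) (fun P => -f (u P)) := by
  have hu := BddMeas.of_range hm hr
  have h := (hK ρm ⟨hf.pos, le_rfl⟩).add (weakIneq_const Ω (-ρm) 0)
    (hu.sub (.const ρm)).abs (hu.kflux hf.lip hf.meas (.const ρm)) (.const _) (.const _)
  refine h.congr (fun P _ _ => ?_) (fun P _ _ => ?_)
  · rw [abs_sub_comm, abs_of_nonneg (sub_nonneg.2 (hr P).2)]; ring
  · rw [kflux_of_ge (hr P).2, hf.at_max]; ring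

lemma KruzhkovOn.weak_max (hK : KruzhkovOn f ρm Ω u) (hf : FluxOn f ρm V Λ)
    (hm : Measurable u) (hr : ∀ P, u P ∈ Icc 0 ρm) {k : ℝ} (hk : k ∈ Icc 0 ρm) :
    WeakIneq Ω (fun P => max (u P) k - k) (fun P => f (max (u P) k) - f k) := by
  have hu := BddMeas.of_range hm hr
  have hfu := hu.comp_lip hf
  have h := ((hK k hk).add ((hK.weak_self hf hr).add (weakIneq_const Ω (-k) (-f k)) hu hfu
    (.const _) (.const _)) (hu.sub (.const k)).abs (hu.kflux hf.lip hf.meas (.const k))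
    (hu.add (.const _)) (hfu.add (.const _))).const_mul (a := 1 / 2) (by norm_num)
  refine h.congr (fun P _ _ => ?_) (fun P _ _ => ?_)
  · rcases le_total (u P) k with h | h
    · rw [max_eq_right h, abs_of_nonpos (by linarith)]; ring
    · rw [max_eq_left h, abs_of_nonneg (by linarith)]; ring
  · rcases le_total (u P) k with h | h
    · rw [max_eq_right h, kflux_of_ge h]; ring
    · rw [max_eq_left h, kflux_of_le h]; ring

lemma TimeL1.max_sub (h : TimeL1 u) (hm : Measurable u) (hr : ∀ P, u P ∈ Icc 0 ρm) {k : ℝ}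
    (hk : 0 ≤ k) : TimeL1 (fun P => max (u P) k - k) := by
  refine h.of_le (C := 1) ((hm.max measurable_const).sub measurable_const) (fun t _ x => ?_)
    (fun s t _ _ x => ?_)
  · have := (hr (t, x)).1
    rw [one_mul, abs_of_nonneg (sub_nonneg.2 (le_max_right _ _)), abs_of_nonneg this]
    linarith [max_le (show u (t, x) ≤ u (t, x) + k by linarith) (show k ≤ u (t, x) + k by linarith)]
  · rw [one_mul, sub_sub_sub_cancel_right]
    exact abs_max_sub_max_le_abs _ _ _

lemma KruzhkovOn.integral_max_le (hK : KruzhkovOn f ρm univ u) (hf : FluxOn f ρm V Λ)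
    (hm : Measurable u) (hr : ∀ P, u P ∈ Icc 0 ρm) (hT : TimeL1 u) {k : ℝ} (hk : k ∈ Icc 0 ρm)
    {s t : ℝ} (hs : 0 ≤ s) (hst : s ≤ t) :
    ∫ x, (max (u (t, x)) k - k) ≤ ∫ x, (max (u (s, x)) k - k) := by
  have hu := BddMeas.of_range hm hr
  have hb : BddMeas (fun P => max (u P) k) := BddMeas.of_range (ρm := ρm) (hm.max measurable_const)
    fun P => ⟨(hr P).1.trans (le_max_left _ _), max_le (hr P).2 hk.2⟩
  exact WeakIneq.integral_le (D := fun P => max (u P) k - k) (q := fun P => f (max (u P) k) - f k)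
    (Λ := Λ) (hb.sub (.const k)) ((hb.comp_lip hf).sub (.const _)) (fun P => hf.lip _ _)
    (hT.max_sub hm hr hk.1) (hK.weak_max hf hm hr hk) hs hst

end

namespace EvolSol
variable {f : ℝ → ℝ} {M W A B K ρm V Λ : ℝ} {u : ℝ × ℝ → ℝ}

lemma range (h : EvolSol f M W A B K u) (P : ℝ × ℝ) : u P ∈ Icc 0 M := (h.box P.1).range P.2

lemma range' (h : EvolSol f M W A B K u) (hM : M ≤ ρm) (P : ℝ × ℝ) : u P ∈ Icc 0 ρm :=
  ⟨(h.range P).1, (h.range P).2.trans hM⟩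

lemma kruzhkovOn (h : EvolSol f M W A B K u) : KruzhkovOn f ρm univ u := fun k _ => h.kruzhkov k

lemma timeL1 (h : EvolSol f M W A B K u) : TimeL1 u where
  int t _ := (h.box t).integrable
  cont s hs := by
    refine squeeze_zero (fun t => integral_nonneg fun _ => abs_nonneg _) (fun t => h.lip s t) ?_
    have : Continuous fun t : ℝ => K * |t - s| := by fun_prop
    have := this.tendsto s
    simp only [sub_self, abs_zero, mul_zero] at this
    exact this.mono_left nhdsWithin_le_nhds

variable (h : EvolSol f M W A B K u) (hf : FluxOn f ρm V Λ) (hM : M ≤ ρm)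
include h hf hM

lemma integral_eq {s t : ℝ} (hs : 0 ≤ s) (hst : s ≤ t) : ∫ x, u (t, x) = ∫ x, u (s, x) := by
  have hr := h.range' hM
  have hu := BddMeas.of_range h.meas hr
  have hK : KruzhkovOn f ρm univ u := h.kruzhkovOn
  refine le_antisymm (WeakIneq.integral_le (Λ := Λ) hu (hu.comp_lip hf) (fun P => hf.abs_le _)
    h.timeL1 (hK.weak_self hf hr) hs hst) ?_
  have := WeakIneq.integral_le (D := fun P => -u P) (q := fun P => -f (u P)) (Λ := Λ) hu.neg
    (hu.comp_lip hf).neg (fun P => by rw [abs_neg, abs_neg]; exact hf.abs_le _)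
    h.timeL1.neg (hK.weak_neg hf h.meas hr) hs hst
  rw [integral_neg, integral_neg] at this
  linarith

/-- Finite propagation on the left, with minimal speed `m`. -/
lemma integral_Iio_le {m : ℝ} (hm : ∀ r ∈ Icc 0 M, m * r ≤ f r) (α : ℝ) {s t : ℝ} (hs : 0 ≤ s)
    (hst : s ≤ t) : ∫ x in Iio (α + m * t), u (t, x) ≤ ∫ x in Iio (α + m * s), u (s, x) := by
  have hr := h.range' hM
  have hu := BddMeas.of_range h.meas hr
  have hK : KruzhkovOn f ρm univ u := h.kruzhkovOn
  exact WeakIneq.integral_Iio_le (Λ := Λ) (δ := 1) hu (hu.comp_lip hf) (fun P => hf.abs_le _)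
    h.timeL1 le_rfl one_pos ((hK.weak_self hf hr).mono (subset_univ _))
    (Eventually.of_forall fun P _ _ _ => hm _ (h.range P)) hs hst

lemma integral_Ioi_le (α : ℝ) {s t : ℝ} (hs : 0 ≤ s)
    (hst : s ≤ t) : ∫ x in Ioi (α + V * t), u (t, x) ≤ ∫ x in Ioi (α + V * s), u (s, x) := by
  have hr := h.range' hM
  have hu := BddMeas.of_range h.meas hr
  have hK : KruzhkovOn f ρm univ u := h.kruzhkovOn
  exact WeakIneq.integral_Ioi_le (Λ := Λ) (δ := 1) hu (hu.comp_lip hf) (fun P => hf.abs_le _)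
    h.timeL1 le_rfl one_pos ((hK.weak_self hf hr).mono (subset_univ _))
    (Eventually.of_forall fun P _ _ _ => hf.le_mul (hr P).1) hs hst

lemma ae_zero_left {m a : ℝ} (hm : ∀ r ∈ Icc 0 M, m * r ≤ f r) (h0 : ∀ᵐ x, x < a → u (0, x) = 0)
    {t : ℝ} (ht : 0 ≤ t) : ∀ᵐ x, x < a + m * t → u (t, x) = 0 := by
  have h1 := h.integral_Iio_le hf hM hm a le_rfl ht
  have h2 : ∫ x in Iio (a + m * 0), u (0, x) = 0 := by
    rw [mul_zero, add_zero, setIntegral_congr_ae (g := fun _ => 0) measurableSet_Iio]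
    · simp
    · filter_upwards [h0] with x hx hx' using hx hx'
  rw [h2] at h1
  have h3 := le_antisymm h1 (integral_nonneg fun x => (h.range (t, x)).1)
  rw [integral_eq_zero_iff_of_nonneg (fun x => (h.range (t, x)).1)
    (h.box t).integrable.integrableOn, Filter.EventuallyEq, ae_restrict_iff' measurableSet_Iio] at h3
  exact h3

lemma ae_zero_right {b : ℝ} (h0 : ∀ᵐ x, b < x → u (0, x) = 0)
    {t : ℝ} (ht : 0 ≤ t) : ∀ᵐ x, b + V * t < x → u (t, x) = 0 := by
  have h1 := h.integral_Ioi_le hf hM b le_rfl ht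
  have h2 : ∫ x in Ioi (b + V * 0), u (0, x) = 0 := by
    rw [mul_zero, add_zero, setIntegral_congr_ae (g := fun _ => 0) measurableSet_Ioi]
    · simp
    · filter_upwards [h0] with x hx hx' using hx hx'
  rw [h2] at h1
  have h3 := le_antisymm h1 (integral_nonneg fun x => (h.range (t, x)).1)
  rw [integral_eq_zero_iff_of_nonneg (fun x => (h.range (t, x)).1)
    (h.box t).integrable.integrableOn, Filter.EventuallyEq, ae_restrict_iff' measurableSet_Ioi] at h3
  exact h3

omit hf hM in
lemma integral_Iio_add_Ioi (t z : ℝ) :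
    ∫ x, u (t, x) = (∫ x in Iio z, u (t, x)) + ∫ x in Ioi z, u (t, x) := by
  have hi := (h.box t).integrable
  rw [← integral_add_compl (s := Iio z) measurableSet_Iio hi, compl_Iio,
    integral_Ici_eq_integral_Ioi]

/-- The cumulative mass decreases in time. -/
lemma cum_antitone (z : ℝ) {s t : ℝ} (hs : 0 ≤ s) (hst : s ≤ t) :
    ∫ x in Iio z, u (t, x) ≤ ∫ x in Iio z, u (s, x) := by
  have := h.integral_Iio_le hf hM (m := 0) (fun r _ => by rw [zero_mul]; exact hf.nonneg r) z hs hst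
  simpa using this

/-- The cumulative mass increases along lines of maximal speed. -/
lemma cum_le_shift (z : ℝ) {s t : ℝ} (hs : 0 ≤ s) (hst : s ≤ t) :
    ∫ x in Iio z, u (s, x) ≤ ∫ x in Iio (z + V * (t - s)), u (t, x) := by
  have h1 := h.integral_Ioi_le hf hM (z - V * s) hs hst
  rw [show z - V * s + V * s = z by ring, show z - V * s + V * t = z + V * (t - s) by ring] at h1
  have h2 := h.integral_Iio_add_Ioi s z
  have h3 := h.integral_Iio_add_Ioi t (z + V * (t - s))
  have h4 := h.integral_eq hf hM hs hst
  linarith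

end EvolSol

/-- A dual pair `(g, H)`: the convex function `r ↦ g r * r - H r` has derivative `g` and
Legendre dual `H ∘ g⁻¹` on `[0, M]`. -/
structure DualPair (g H : ℝ → ℝ) (M L : ℝ) : Prop where
  M_nonneg : 0 ≤ M
  L_nonneg : 0 ≤ L
  g_meas : Measurable g
  H_meas : Measurable H
  g_zero : g 0 = 0
  H_zero : H 0 = 0
  g_mono : MonotoneOn g (Icc 0 M)
  H_mono : MonotoneOn H (Icc 0 M)
  H_lip : ∀ r ∈ Icc 0 M, ∀ s ∈ Icc 0 M, |H r - H s| ≤ L * |r - s|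
  young : ∀ r ∈ Icc 0 M, ∀ k ∈ Icc 0 M, g k * r - H k ≤ g r * r - H r

namespace DualPair
variable {g H : ℝ → ℝ} {M L : ℝ} (h : DualPair g H M L)
include h

lemma zero_mem : (0 : ℝ) ∈ Icc 0 M := ⟨le_rfl, h.M_nonneg⟩
lemma top_mem : M ∈ Icc 0 M := ⟨h.M_nonneg, le_rfl⟩

lemma g_mem {r : ℝ} (hr : r ∈ Icc 0 M) : g r ∈ Icc 0 (g M) :=
  ⟨by rw [← h.g_zero]; exact h.g_mono h.zero_mem hr hr.1, h.g_mono hr h.top_mem hr.2⟩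

lemma H_nonneg {r : ℝ} (hr : r ∈ Icc 0 M) : 0 ≤ H r := by
  rw [← h.H_zero]; exact h.H_mono h.zero_mem hr hr.1

lemma energy_nonneg {r : ℝ} (hr : r ∈ Icc 0 M) : 0 ≤ g r * r - H r := by
  have := h.young r hr 0 h.zero_mem
  rwa [h.g_zero, h.H_zero, zero_mul, sub_zero] at this

lemma energy_le {r : ℝ} (hr : r ∈ Icc 0 M) : g r * r - H r ≤ g M * r := by
  have h1 := h.H_nonneg hr
  have h2 := mul_le_mul_of_nonneg_right (h.g_mem hr).2 hr.1
  linarith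

lemma defect_le {r s : ℝ} (hr : r ∈ Icc 0 M) (hs : s ∈ Icc 0 M) :
    g r * r - H r ≤ (g s * r - H s) + g M * |r - s| := by
  have h1 := h.young s hs r hr
  have h2 := h.g_mem hr
  have h3 := h.g_mem hs
  have h4 : (g r - g s) * (r - s) ≤ g M * |r - s| := by
    refine (le_abs_self _).trans ?_
    rw [abs_mul]
    refine mul_le_mul_of_nonneg_right ?_ (abs_nonneg _)
    rw [abs_le]
    constructor <;> linarith [h2.1, h2.2, h3.1, h3.2]
  nlinarith

lemma integrable_energy {w : ℝ → ℝ} (hw : Integrable w) (hwm : Measurable w)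
    (hr : ∀ x, w x ∈ Icc 0 M) : Integrable fun x => g (w x) * w x - H (w x) := by
  refine (hw.const_mul (g M)).mono' (((h.g_meas.comp hwm).mul hwm).sub
    (h.H_meas.comp hwm)).aestronglyMeasurable (Eventually.of_forall fun x => ?_)
  rw [Real.norm_eq_abs, abs_of_nonneg (h.energy_nonneg (hr x))]
  exact h.energy_le (hr x)

lemma integrable_affine {w s : ℝ → ℝ} (hw : Integrable w) (hwr : ∀ x, w x ∈ Icc 0 M)
    (hs : Integrable s) (hsm : Measurable s) (hsr : ∀ x, s x ∈ Icc 0 M) :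
    Integrable fun x => g (s x) * w x - H (s x) := by
  refine Integrable.sub ?_ ?_
  · refine hw.bdd_mul (c := g M) (h.g_meas.comp hsm).aestronglyMeasurable
      (Eventually.of_forall fun x => ?_)
    rw [Real.norm_eq_abs, abs_of_nonneg (h.g_mem (hsr x)).1]
    exact (h.g_mem (hsr x)).2
  · refine (hs.const_mul L).mono' (h.H_meas.comp hsm).aestronglyMeasurable
      (Eventually.of_forall fun x => ?_)
    have := h.H_lip _ (hsr x) 0 h.zero_mem
    rwa [h.H_zero, sub_zero, sub_zero, abs_of_nonneg (hsr x).1] at this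

end DualPair

lemma integral_Iio_sub_Iio {w : ℝ → ℝ} (hw : Integrable w) (x y : ℝ) :
    (∫ z in Iio y, w z) - (∫ z in Iio x, w z) = ∫ z in x..y, w z := by
  rw [← integral_Iic_eq_integral_Iio, ← integral_Iic_eq_integral_Iio]
  exact intervalIntegral.integral_Iic_sub_Iic hw.integrableOn hw.integrableOn

lemma integral_sample_shift_le {u : ℝ → ℝ} {W : ℝ}
    (hu : eVariationOn u univ ≤ ENNReal.ofReal W) (hW : 0 ≤ W) {δ : ℝ} (hδ : 0 < δ) (a : ℝ) :
    Integrable (fun x => u x - u (a + δ * ⌊(x - a) / δ⌋)) ∧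
      ∫ x, |u x - u (a + δ * ⌊(x - a) / δ⌋)| ≤ δ * W := by
  have hv : eVariationOn (fun y => u (a + y)) univ ≤ ENNReal.ofReal W :=
    (eVariationOn.comp_le_of_monotoneOn u (t := univ) (s := univ) (fun y => a + y)
      (fun x _ y _ hxy => by simpa using hxy) (mapsTo_univ _ _)).trans hu
  obtain ⟨h1, h2⟩ := integral_sample_le hv hW hδ
  have e : ∀ x, u (a + (x - a)) = u x := fun x => by congr 1; ring
  constructor
  · have := h1.comp_sub_right a
    simpa only [e] using this
  · rw [← integral_sub_right_eq_self _ a] at h2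
    simpa only [e] using h2

/-- Lower bound of the energy of the cells of a function. -/
lemma DualPair.energy_cells_le {g H : ℝ → ℝ} {M L : ℝ} (hp : DualPair g H M L) {w : ℝ → ℝ}
    (hw : Integrable w) (hwm : Measurable w) (hr : ∀ x, w x ∈ Icc 0 M) {a δ : ℝ} (hδ : 0 ≤ δ)
    {k : ℕ → ℝ} (hk : ∀ i, k i ∈ Icc 0 M) (N : ℕ) :
    ∑ i ∈ Finset.range N, (g (k i) * ((∫ z in Iio (a + ((i + 2 : ℕ) : ℝ) * δ), w z) -
      (∫ z in Iio (a + ((i + 1 : ℕ) : ℝ) * δ), w z)) - δ * H (k i)) ≤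
    ∫ x, (g (w x) * w x - H (w x)) := by
  have hE := hp.integrable_energy hw hwm hr
  have h1 : ∀ i : ℕ, g (k i) * ((∫ z in Iio (a + ((i + 2 : ℕ) : ℝ) * δ), w z) -
      (∫ z in Iio (a + ((i + 1 : ℕ) : ℝ) * δ), w z)) - δ * H (k i) ≤
      ∫ x in (a + ((i + 1 : ℕ) : ℝ) * δ)..(a + ((i + 1 + 1 : ℕ) : ℝ) * δ),
        (g (w x) * w x - H (w x)) := by
    intro i
    have hii := hw.intervalIntegrable (a := a + ((i + 1 : ℕ) : ℝ) * δ)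
      (b := a + ((i + 2 : ℕ) : ℝ) * δ)
    rw [integral_Iio_sub_Iio hw]
    have e : ∫ x in (a + ((i + 1 : ℕ) : ℝ) * δ)..(a + ((i + 2 : ℕ) : ℝ) * δ),
        (g (k i) * w x - H (k i)) =
        g (k i) * (∫ x in (a + ((i + 1 : ℕ) : ℝ) * δ)..(a + ((i + 2 : ℕ) : ℝ) * δ), w x) -
          δ * H (k i) := by
      rw [intervalIntegral.integral_sub (hii.const_mul _) intervalIntegrable_const,
        intervalIntegral.integral_const_mul, intervalIntegral.integral_const, smul_eq_mul]
      push_cast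
      ring
    rw [← e]
    refine intervalIntegral.integral_mono_on (by push_cast; nlinarith)
      ((hii.const_mul _).sub intervalIntegrable_const) hE.intervalIntegrable fun x _ => ?_
    exact hp.young _ (hr x) _ (hk i)
  refine (Finset.sum_le_sum fun i _ => h1 i).trans ?_
  have h2 := intervalIntegral.sum_integral_adjacent_intervals (n := N) (μ := volume)
    (a := fun i : ℕ => a + ((i + 1 : ℕ) : ℝ) * δ) (f := fun x => g (w x) * w x - H (w x))
    fun i _ => hE.intervalIntegrable
  rw [h2, intervalIntegral.integral_of_le (by push_cast; nlinarith [show (0 : ℝ) ≤ N * δ by positivity])]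
  exact setIntegral_le_integral hE (Eventually.of_forall fun x => hp.energy_nonneg (hr x))

/-- Upper bound of the energy by its sampled version. -/
lemma DualPair.le_energy_cells {g H : ℝ → ℝ} {M L : ℝ} (hp : DualPair g H M L) {W R : ℝ}
    (hW : 0 ≤ W) {w : ℝ → ℝ} (hw : BVBox M W R w) {a δ : ℝ} (hδ : 0 < δ)
    (ha : ∀ x ≤ a, w x = 0) {N : ℕ} (hN : ∀ x, a + (N + 1) * δ ≤ x → w x = 0) :
    ∫ x, (g (w x) * w x - H (w x)) ≤
    (∑ i ∈ Finset.range N, (g (w (a + ((i + 1 : ℕ) : ℝ) * δ)) *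
      ((∫ z in Iio (a + ((i + 2 : ℕ) : ℝ) * δ), w z) -
      (∫ z in Iio (a + ((i + 1 : ℕ) : ℝ) * δ), w z)) - δ * H (w (a + ((i + 1 : ℕ) : ℝ) * δ)))) +
    g M * (δ * W) := by
  set s : ℝ → ℝ := fun x => w (a + δ * ⌊(x - a) / δ⌋) with hs
  obtain ⟨i1, i2⟩ := integral_sample_shift_le hw.var hW hδ a
  have hsm : Measurable s := hw.meas.comp (by fun_prop)
  have hsi : Integrable s := (hw.integrable.sub i1).congr (Eventually.of_forall fun x => by
    simp [hs])
  have hsr : ∀ x, s x ∈ Icc 0 M := fun x => hw.range _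
  have hφ := hp.integrable_affine hw.integrable hw.range hsi hsm hsr
  have h1 : ∫ x, (g (w x) * w x - H (w x)) ≤
      (∫ x, (g (s x) * w x - H (s x))) + g M * (δ * W) := by
    have j1 : Integrable fun x => g M * |w x - s x| := i1.abs.const_mul _
    calc _ ≤ ∫ x, ((g (s x) * w x - H (s x)) + g M * |w x - s x|) :=
          integral_mono (hp.integrable_energy hw.integrable hw.meas hw.range) (hφ.add j1)
            fun x => hp.defect_le (hw.range x) (hsr x)
      _ = (∫ x, (g (s x) * w x - H (s x))) + g M * ∫ x, |w x - s x| := by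
          rw [integral_add hφ j1, integral_const_mul]
      _ ≤ _ := by
          have := mul_le_mul_of_nonneg_left i2 (hp.g_mem hp.top_mem).1
          simp only [hs]; linarith
  refine h1.trans (add_le_add_left (le_of_eq ?_) _)
  have h2 := intervalIntegral.sum_integral_adjacent_intervals (n := N) (μ := volume)
    (a := fun i : ℕ => a + ((i + 1 : ℕ) : ℝ) * δ) (f := fun x => g (s x) * w x - H (s x))
    fun i _ => hφ.intervalIntegrable
  have hvan : ∀ x, x ∉ Ico (a + ((0 + 1 : ℕ) : ℝ) * δ) (a + ((N + 1 : ℕ) : ℝ) * δ) →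
      g (s x) * w x - H (s x) = 0 := by
    intro x hx
    have hs0 : s x = 0 := by
      by_cases h1 : x < a + δ
      · refine ha _ ?_
        have : ⌊(x - a) / δ⌋ ≤ 0 := by
          rw [Int.floor_le_iff, div_lt_iff₀ hδ]; push_cast; linarith
        have : (⌊(x - a) / δ⌋ : ℝ) ≤ 0 := by exact_mod_cast this
        nlinarith
      · refine hN _ ?_
        have hx2 : a + ((N + 1 : ℕ) : ℝ) * δ ≤ x := by
          by_contra h2
          exact hx ⟨by push_cast; linarith, not_le.1 h2⟩
        have : ((N + 1 : ℕ) : ℤ) ≤ ⌊(x - a) / δ⌋ := by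
          rw [Int.le_floor, le_div_iff₀ hδ]; push_cast at hx2 ⊢; linarith
        have : (N + 1 : ℝ) ≤ ⌊(x - a) / δ⌋ := by exact_mod_cast this
        nlinarith
    rw [hs0, hp.g_zero, hp.H_zero]; ring
  have hle : a + ((0 + 1 : ℕ) : ℝ) * δ ≤ a + ((N + 1 : ℕ) : ℝ) * δ := by
    push_cast; nlinarith [show (0 : ℝ) ≤ N * δ by positivity]
  have h3 : ∫ x, (g (s x) * w x - H (s x)) =
      ∫ x in (a + ((0 + 1 : ℕ) : ℝ) * δ)..(a + ((N + 1 : ℕ) : ℝ) * δ),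
        (g (s x) * w x - H (s x)) := by
    rw [intervalIntegral.integral_of_le hle, ← integral_Ico_eq_integral_Ioc,
      setIntegral_eq_integral_of_forall_compl_eq_zero hvan]
  rw [h3, ← h2]
  refine Finset.sum_congr rfl fun i _ => ?_
  have hle' : a + ((i + 1 : ℕ) : ℝ) * δ ≤ a + ((i + 2 : ℕ) : ℝ) * δ := by push_cast; nlinarith
  have hii := hw.integrable.intervalIntegrable (a := a + ((i + 1 : ℕ) : ℝ) * δ)
      (b := a + ((i + 2 : ℕ) : ℝ) * δ)
  set k := w (a + ((i + 1 : ℕ) : ℝ) * δ) with hk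
  have h4 : ∫ x in (a + ((i + 1 : ℕ) : ℝ) * δ)..(a + ((i + 2 : ℕ) : ℝ) * δ),
      (g (s x) * w x - H (s x)) =
      ∫ x in (a + ((i + 1 : ℕ) : ℝ) * δ)..(a + ((i + 2 : ℕ) : ℝ) * δ), (g k * w x - H k) := by
    rw [intervalIntegral.integral_of_le hle', intervalIntegral.integral_of_le hle',
      ← integral_Ico_eq_integral_Ioc, ← integral_Ico_eq_integral_Ioc]
    refine setIntegral_congr_fun measurableSet_Ico fun x hx => ?_
    have hfl : ⌊(x - a) / δ⌋ = ((i + 1 : ℕ) : ℤ) := by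
      rw [Int.floor_eq_iff, le_div_iff₀ hδ, div_lt_iff₀ hδ]
      have h1 := hx.1
      have h2 := hx.2
      push_cast at h1 h2 ⊢
      constructor <;> linarith
    have : s x = k := by
      simp only [hs, hk, hfl]
      congr 1
      push_cast
      ring
    simp only [this]
  rw [integral_Iio_sub_Iio hw.integrable, h4,
    intervalIntegral.integral_sub (hii.const_mul _) intervalIntegrable_const,
    intervalIntegral.integral_const_mul, intervalIntegral.integral_const, smul_eq_mul]
  push_cast
  ring

lemma EvolSol.energy_lower {f g H u₀ : ℝ → ℝ} {M W W₁ A A' B K ρm V Λ L a b : ℝ} {u : ℝ × ℝ → ℝ}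
    (h : EvolSol f M W A B K u) (hf : FluxOn f ρm V Λ) (hM : M ≤ ρm) (hV : 0 < V)
    (hp : DualPair g H M L) (hW : 0 ≤ W) (hW₁ : 0 ≤ W₁) (hu₀ : BVBox M W A' u₀)
    (hae : ∀ᵐ x, u (0, x) = u₀ x) (ha : ∀ x ≤ a, u₀ x = 0) (hb : ∀ x, b ≤ x → u₀ x = 0)
    (hv : eVariationOn u₀ (Ioo a b) ≤ ENNReal.ofReal W₁) {t : ℝ} (ht : 0 ≤ t) :
    (∫ x, (g (u₀ x) * u₀ x - H (u₀ x))) - V * t * (H M + L * W₁) ≤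
      ∫ x, (g (u (t, x)) * u (t, x) - H (u (t, x))) := by
  rcases ht.eq_or_lt with rfl | ht
  · refine le_of_eq ?_
    rw [mul_zero, zero_mul, sub_zero]
    refine integral_congr_ae ?_
    filter_upwards [hae] with x hx
    rw [hx]
  have key : ∀ n : ℕ, (∫ x, (g (u₀ x) * u₀ x - H (u₀ x))) - V * t * (H M + L * W₁) ≤
      (∫ x, (g (u (t, x)) * u (t, x) - H (u (t, x)))) + g M * (V * t / ((n : ℝ) + 1) * W) := by
    intro n'
    obtain ⟨n, hn⟩ : ∃ n, n = n' + 1 := ⟨_, rfl⟩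
    have hn0 : (0 : ℝ) < n := by rw [hn]; positivity
    have hnn : ((n' : ℝ) + 1) = n := by rw [hn]; push_cast; ring
    rw [hnn]
    set δ := V * t / n with hδ
    have hδ0 : 0 < δ := by positivity
    set R : ℕ → ℝ := fun i => u₀ (a + i * δ) with hR
    have hRr : ∀ i, R i ∈ Icc 0 M := fun i => hu₀.range _
    have hR0 : R 0 = 0 := ha _ (by simp)
    set J : ℕ := ⌈(b - a) / δ⌉₊ with hJ
    have hJ1 : ∀ i, J ≤ i → R i = 0 := by
      intro i hi
      refine hb _ ?_
      have : (b - a) / δ ≤ i := Nat.ceil_le.1 hi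
      rw [div_le_iff₀ hδ0] at this
      linarith
    have hJ2 : ∀ i : ℕ, i < J → a + i * δ < b := by
      intro i hi
      have : (i : ℝ) < (b - a) / δ := Nat.lt_ceil.1 hi
      rw [lt_div_iff₀ hδ0] at this
      linarith
    set N := J + n with hN
    set F : ℕ → ℕ → ℝ := fun j i => ∫ z in Iio (a + i * δ), u (j * (t / n), z) with hF
    have hτ : ∀ j : ℕ, (0 : ℝ) ≤ j * (t / n) := fun j => by positivity
    have hτ1 : ∀ j : ℕ, (j : ℝ) * (t / n) ≤ ((j + 1 : ℕ) : ℝ) * (t / n) := fun j => by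
      push_cast; nlinarith [show 0 < t / n by positivity]
    have hF1 : ∀ j i, F j i ≤ F (j + 1) (i + 1) := by
      intro j i
      have := h.cum_le_shift hf hM (a + i * δ) (hτ j) (hτ1 j)
      refine this.trans_eq ?_
      simp only [hF]
      congr 3
      simp only [hδ]
      push_cast
      ring
    have hF2 : ∀ j i, F (j + 1) i ≤ F j i := fun j i => h.cum_antitone hf hM _ (hτ j) (hτ1 j)
    have hind : ∀ j ≤ n, ∑ i ∈ Finset.range N, g (R (i + 1)) * (F 0 (i + 2) - F 0 (i + 1)) ≤
        ∑ i ∈ Finset.range N, g (maxIter R j (i + 1)) * (F j (i + 2) - F j (i + 1)) := by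
      intro j hj
      induction j with
      | zero => exact le_rfl
      | succ j ih =>
        exact (ih (by omega)).trans (maxIter_mass_le hR0 hp.M_nonneg hRr hp.g_mono hp.g_zero hJ1 j N
          (by omega) (hF1 j) (hF2 j))
    have s1 := hp.le_energy_cells hW hu₀ hδ0 ha (N := N) (fun x hx => hb x (by
      have := Nat.le_ceil ((b - a) / δ)
      rw [div_le_iff₀ hδ0] at this
      rw [← hJ] at this
      have h2 : (J : ℝ) ≤ N := by exact_mod_cast Nat.le_add_right J n
      nlinarith))
    have s2 := hp.energy_cells_le (h.box t).integrable (h.box t).meas (h.box t).range (a := a)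
      hδ0.le (k := fun i => maxIter R n (i + 1))
      (fun i => maxIter_mem hR0 hp.M_nonneg hRr n (i + 1)) N
    have s3 := hind n le_rfl
    have s4 := sum_maxIter_le hR0 hp.M_nonneg hRr hp.H_mono n N
    have s5 := downVar_sample_le hp.M_nonneg hp.L_nonneg hW₁ hu₀.range hp.H_zero hp.H_mono hp.H_lip
      hδ0 (ha a le_rfl) hv hJ1 hJ2 N
    have e0 : ∀ y, ∫ z in Iio y, u (((0 : ℕ) : ℝ) * (t / n), z) = ∫ z in Iio y, u₀ z := by
      intro y
      refine setIntegral_congr_ae measurableSet_Iio ?_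
      filter_upwards [hae] with x hx _
      rw [Nat.cast_zero, zero_mul, hx]
    have en : (n : ℝ) * (t / n) = t := by field_simp
    simp only [hF, en, e0] at s3
    rw [Finset.sum_sub_distrib, ← Finset.mul_sum] at s1 s2
    have s6 : (n : ℝ) * downVar (fun i => H (R i)) N ≤ n * (H M + L * W₁) := by gcongr
    have s7 := mul_le_mul_of_nonneg_left (s4.trans (add_le_add_right s6 _)) hδ0.le
    have e7 : δ * (n * (H M + L * W₁)) = V * t * (H M + L * W₁) := by
      simp only [hδ]; field_simp
    rw [mul_add, e7] at s7
    simp only [hR] at s1 s2 s3 s7 ⊢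
    linarith
  refine ge_of_tendsto (x := atTop) (f := fun n : ℕ =>
    (∫ x, (g (u (t, x)) * u (t, x) - H (u (t, x)))) + g M * (V * t / ((n : ℝ) + 1) * W)) ?_
    (Eventually.of_forall key)
  have h1 : Tendsto (fun n : ℕ => V * t / ((n : ℝ) + 1)) atTop (nhds 0) := by
    have := (tendsto_one_div_add_atTop_nhds_zero_nat (𝕜 := ℝ)).const_mul (V * t)
    rw [mul_zero] at this
    refine this.congr fun n => ?_
    ring
  have h2 := ((h1.mul_const W).const_mul (g M)).const_add
    (∫ x, (g (u (t, x)) * u (t, x) - H (u (t, x))))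
  rw [zero_mul, mul_zero, add_zero] at h2
  exact h2

/-- A convex running cost `e` on `[0, M]` with `e 0 = 0`, decomposed into its linear part and the
energy of a dual pair, which is also a superposition of the functions `r ↦ max r k - k`. -/
structure CostOn (e g H : ℝ → ℝ) (M L c₀ : ℝ) : Prop where
  dual : DualPair g H M L
  lin_nonneg : 0 ≤ c₀
  meas : Measurable e
  eq : ∀ r ∈ Icc 0 M, e r = c₀ * r + (g r * r - H r)
  mono : MonotoneOn e (Icc 0 M)
  rep : ∃ w : ℝ → ℝ, ContinuousOn w (Icc 0 M) ∧ (∀ k ∈ Icc 0 M, 0 ≤ w k) ∧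
    ∀ r ∈ Icc 0 M, g r * r - H r = ∫ k in (0 : ℝ)..M, w k * (max r k - k)

namespace CostOn
variable {e g H : ℝ → ℝ} {M L c₀ : ℝ} (h : CostOn e g H M L c₀)
include h

lemma zero : e 0 = 0 := by
  rw [h.eq 0 h.dual.zero_mem, h.dual.g_zero, h.dual.H_zero]; ring

lemma mem {r : ℝ} (hr : r ∈ Icc 0 M) : e r ∈ Icc 0 (e M) :=
  ⟨by rw [← h.zero]; exact h.mono h.dual.zero_mem hr hr.1, h.mono hr h.dual.top_mem hr.2⟩

lemma top_nonneg : 0 ≤ e M := (h.mem h.dual.top_mem).1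

lemma le_mul {r : ℝ} (hr : r ∈ Icc 0 M) : e r ≤ (c₀ + g M) * r := by
  rw [h.eq r hr]
  linarith [h.dual.energy_le hr]

lemma integrable {w : ℝ → ℝ} (hw : Integrable w) (hwm : Measurable w)
    (hr : ∀ x, w x ∈ Icc 0 M) : Integrable fun x => e (w x) := by
  refine (hw.const_mul (c₀ + g M)).mono' (h.meas.comp hwm).aestronglyMeasurable
    (Eventually.of_forall fun x => ?_)
  rw [Real.norm_eq_abs, abs_of_nonneg (h.mem (hr x)).1]
  exact h.le_mul (hr x)

lemma integral_eq {w : ℝ → ℝ} (hw : Integrable w) (hwm : Measurable w)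
    (hr : ∀ x, w x ∈ Icc 0 M) :
    ∫ x, e (w x) = c₀ * (∫ x, w x) + ∫ x, (g (w x) * w x - H (w x)) := by
  rw [← integral_const_mul, ← integral_add (hw.const_mul _) (h.dual.integrable_energy hw hwm hr)]
  exact integral_congr_ae (Eventually.of_forall fun x => h.eq _ (hr x))

/-- Comparison of energies from comparison of truncations. -/
lemma energy_le_of_max {w w' : ℝ → ℝ} (hw : Integrable w) (hwm : Measurable w)
    (hr : ∀ x, w x ∈ Icc 0 M) (hw' : Integrable w') (hwm' : Measurable w')
    (hr' : ∀ x, w' x ∈ Icc 0 M)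
    (hle : ∀ k ∈ Icc 0 M, ∫ x, (max (w x) k - k) ≤ ∫ x, (max (w' x) k - k)) :
    ∫ x, (g (w x) * w x - H (w x)) ≤ ∫ x, (g (w' x) * w' x - H (w' x)) := by
  obtain ⟨ω, hωc, hω0, hω⟩ := h.rep
  have hM := h.dual.M_nonneg
  have hωi : Integrable ω (volume.restrict (Ioc 0 M)) :=
    (hωc.integrableOn_Icc).mono_set Ioc_subset_Icc_self
  have hp : ∀ {w : ℝ → ℝ}, Integrable w → Measurable w → (∀ x, w x ∈ Icc 0 M) →
      Integrable (fun P : ℝ × ℝ => ω P.2 * (max (w P.1) P.2 - P.2))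
        (volume.prod (volume.restrict (Ioc 0 M))) := by
    intro w hw hwm hr
    have h1 := hw.mul_prod hωi
    refine h1.norm.mono' ((hωi.aestronglyMeasurable.comp_snd).mul (Measurable.aestronglyMeasurable
      (by fun_prop))) ?_
    have hmem : ∀ᵐ P ∂((volume : Measure ℝ).prod (volume.restrict (Ioc 0 M))), P.2 ∈ Ioc 0 M :=
      Measure.quasiMeasurePreserving_snd.ae (ae_restrict_mem measurableSet_Ioc)
    filter_upwards [hmem] with P hP
    have h2 := (hr P.1).1
    rw [norm_mul, norm_mul, mul_comm]
    refine mul_le_mul_of_nonneg_right ?_ (norm_nonneg _)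
    rw [Real.norm_eq_abs, Real.norm_eq_abs, abs_of_nonneg h2,
      abs_of_nonneg (sub_nonneg.2 (le_max_right _ _)), sub_le_iff_le_add]
    exact max_le (by linarith [hP.1]) (by linarith)
  have hE : ∀ {w : ℝ → ℝ}, Integrable w → Measurable w → (∀ x, w x ∈ Icc 0 M) →
      ∫ x, (g (w x) * w x - H (w x)) = ∫ k in Ioc 0 M, ω k * ∫ x, (max (w x) k - k) := by
    intro w hw hwm hr
    calc _ = ∫ x, ∫ k in Ioc 0 M, ω k * (max (w x) k - k) :=
          integral_congr_ae (Eventually.of_forall fun x => by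
            simp only
            rw [hω _ (hr x), intervalIntegral.integral_of_le hM])
      _ = ∫ k in Ioc 0 M, ∫ x, ω k * (max (w x) k - k) :=
          integral_integral_swap (f := fun x k => ω k * (max (w x) k - k)) (hp hw hwm hr)
      _ = _ := by simp only [integral_const_mul]
  have hi : ∀ {w : ℝ → ℝ}, Integrable w → Measurable w → (∀ x, w x ∈ Icc 0 M) →
      Integrable (fun k => ω k * ∫ x, (max (w x) k - k)) (volume.restrict (Ioc 0 M)) := by
    intro w hw hwm hr
    have := (hp hw hwm hr).integral_prod_right
    simpa only [integral_const_mul] using this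
  rw [hE hw hwm hr, hE hw' hwm' hr']
  refine setIntegral_mono_on (hi hw hwm hr) (hi hw' hwm' hr') measurableSet_Ioc fun k hk => ?_
  exact mul_le_mul_of_nonneg_left (hle k (Ioc_subset_Icc_self hk)) (hω0 k (Ioc_subset_Icc_self hk))

end CostOn

section
variable {f e g H u₀ : ℝ → ℝ} {M W W₁ A A' B K ρm V Λ L a b c₀ : ℝ} {u : ℝ × ℝ → ℝ}

lemma EvolSol.cost_upper (h : EvolSol f M W A B K u) (hf : FluxOn f ρm V Λ) (hM : M ≤ ρm)
    (hc : CostOn e g H M L c₀) (hae : ∀ᵐ x, u (0, x) = u₀ x) {t : ℝ} (ht : 0 ≤ t) :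
    ∫ x, e (u (t, x)) ≤ ∫ x, e (u₀ x) := by
  have e0 : ∫ x, e (u₀ x) = ∫ x, e (u (0, x)) := by
    refine integral_congr_ae ?_
    filter_upwards [hae] with x hx
    rw [hx]
  have b := h.box
  rw [e0, hc.integral_eq (b t).integrable (b t).meas (b t).range,
    hc.integral_eq (b 0).integrable (b 0).meas (b 0).range, h.integral_eq hf hM le_rfl ht]
  refine add_le_add_right (hc.energy_le_of_max (b t).integrable (b t).meas (b t).range
    (b 0).integrable (b 0).meas (b 0).range fun k hk => ?_) _
  exact KruzhkovOn.integral_max_le h.kruzhkovOn hf h.meas (h.range' hM) h.timeL1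
    ⟨hk.1, hk.2.trans hM⟩ le_rfl ht

lemma EvolSol.cost_lower (h : EvolSol f M W A B K u) (hf : FluxOn f ρm V Λ) (hM : M ≤ ρm)
    (hV : 0 < V) (hc : CostOn e g H M L c₀) (hW : 0 ≤ W) (hW₁ : 0 ≤ W₁) (hu₀ : BVBox M W A' u₀)
    (hae : ∀ᵐ x, u (0, x) = u₀ x) (ha : ∀ x ≤ a, u₀ x = 0) (hb : ∀ x, b ≤ x → u₀ x = 0)
    (hv : eVariationOn u₀ (Ioo a b) ≤ ENNReal.ofReal W₁) {t : ℝ} (ht : 0 ≤ t) :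
    (∫ x, e (u₀ x)) - V * t * (H M + L * W₁) ≤ ∫ x, e (u (t, x)) := by
  have b := h.box
  have h1 := h.energy_lower hf hM hV hc.dual hW hW₁ hu₀ hae ha hb hv ht
  have h2 : ∫ x, u₀ x = ∫ x, u (0, x) := by
    refine integral_congr_ae ?_
    filter_upwards [hae] with x hx
    rw [hx]
  rw [hc.integral_eq (b t).integrable (b t).meas (b t).range,
    hc.integral_eq hu₀.integrable hu₀.meas hu₀.range, h.integral_eq hf hM le_rfl ht, h2]
  linarith
end

lemma BVBox.of_Ioo {M W R a b : ℝ} {u : ℝ → ℝ} (hab : a < b) (ha : |a| ≤ R) (hb : |b| ≤ R)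
    (hW : 0 ≤ W) (hr : ∀ x, u x ∈ Icc 0 M) (hv : eVariationOn u (Ioo a b) ≤ ENNReal.ofReal W)
    (hz : ∀ x, x ∉ Ioo a b → u x = 0) : BVBox M (2 * W + 2 * M) R u where
  range := hr
  var := by
    have hM : 0 ≤ M := (hr 0).1.trans (hr 0).2
    have hbv : BoundedVariationOn u (Ioo a b) := ne_top_of_le_ne_top ENNReal.ofReal_ne_top hv
    have hmid : (a + b) / 2 ∈ Ioo a b := ⟨by linarith, by linarith⟩
    set B : ℝ → ℝ := fun x => variationOnFromTo u (Ioo a b) ((a + b) / 2) x with hB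
    have hBW : ∀ x, |B x| ≤ W := fun x =>
      (variationOnFromTo.abs_le_eVariationOn hbv).trans
        ((ENNReal.toReal_mono ENNReal.ofReal_ne_top hv).trans_eq (ENNReal.toReal_ofReal hW))
    have key := eVariationOn_le_of_dominated (u := u) (S := univ) (a := -W - M) (b := W + M)
      (A := fun x => if x ≤ a then -W - M else if b ≤ x then W + M else B x) ?_ ?_
    · refine key.trans (ENNReal.ofReal_le_ofReal (by linarith))
    · intro x _
      have := abs_le.1 (hBW x)
      split_ifs <;> constructor <;> linarith
    · intro x _ y _ hxy
      have h1 := abs_le.1 (hBW x)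
      have h2 := abs_le.1 (hBW y)
      have h3 := hr x
      have h4 := hr y
      by_cases hxa : x ≤ a
      · rw [if_pos hxa, hz x (fun h => absurd h.1 hxa.not_gt), sub_zero, abs_of_nonneg h4.1]
        by_cases hya : y ≤ a
        · rw [if_pos hya, hz y (fun h => absurd h.1 hya.not_gt)]; linarith
        · rw [if_neg hya]
          split_ifs <;> linarith [h4.2]
      · have hya : ¬ y ≤ a := fun h => hxa (hxy.trans h)
        rw [if_neg hxa, if_neg hya]
        by_cases hyb : b ≤ y
        · rw [if_pos hyb, hz y (fun h => absurd h.2 hyb.not_gt), zero_sub, abs_neg,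
            abs_of_nonneg h3.1]
          by_cases hxb : b ≤ x
          · rw [if_pos hxb, hz x (fun h => absurd h.2 hxb.not_gt)]; linarith
          · rw [if_neg hxb]; linarith [h3.2]
        · have hxb : ¬ b ≤ x := fun h => hyb (h.trans hxy)
          rw [if_neg hyb, if_neg hxb]
          push Not at hxa hya hyb hxb
          exact variationOnFromTo.abs_sub_le_sub_of_le hbv.locallyBoundedVariationOn
            hmid ⟨hxa, hxb⟩ ⟨hya, hyb⟩ hxy
  supp := fun x hx => hz x fun h => by
    have h1 := abs_le.1 ha
    have h2 := abs_le.1 hb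
    have := abs_lt.2 (show -R < x ∧ x < R from ⟨by linarith [h.1], by linarith [h.2]⟩)
    linarith

/-- The balance functional of the cost excess `q` at the turning point `y`. -/
def bal (q : ℝ → ℝ) (y : ℝ) : ℝ := (∫ x in (-1 : ℝ)..y, q x) - (∫ x in y..1, q x) + 2 * y

section bal
variable {q q' : ℝ → ℝ}

lemma bal_sub (hq : Integrable q) (y z : ℝ) :
    bal q z - bal q y = 2 * (∫ x in y..z, q x) + 2 * (z - y) := by
  have h : ∀ a b, IntervalIntegrable q volume a b := fun a b => hq.intervalIntegrable
  have h1 := intervalIntegral.integral_add_adjacent_intervals (h (-1) y) (h y z)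
  have h2 := intervalIntegral.integral_add_adjacent_intervals (h y z) (h z 1)
  unfold bal
  linarith

lemma bal_le (hq : Integrable q) (h0 : ∀ x, 0 ≤ q x) {y z : ℝ} (hyz : y ≤ z) :
    2 * (z - y) ≤ bal q z - bal q y := by
  rw [bal_sub hq]
  have := intervalIntegral.integral_nonneg (μ := volume) hyz (fun x _ => h0 x)
  linarith

lemma abs_sub_le_bal (hq : Integrable q) (h0 : ∀ x, 0 ≤ q x) (y z : ℝ) :
    2 * |z - y| ≤ |bal q z - bal q y| := by
  rcases le_total y z with h | h
  · rw [abs_of_nonneg (sub_nonneg.2 h)]; exact (bal_le hq h0 h).trans (le_abs_self _)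
  · rw [abs_sub_comm z, abs_of_nonneg (sub_nonneg.2 h), abs_sub_comm]
    exact (bal_le hq h0 h).trans (le_abs_self _)

lemma abs_bal_sub_bal_le (hq : Integrable q) (hq' : Integrable q') {y : ℝ} (hy : y ∈ Icc (-1 : ℝ) 1) :
    |bal q y - bal q' y| ≤ ∫ x, |q x - q' x| := by
  have i : Integrable fun x => q x - q' x := hq.sub hq'
  have e : bal q y - bal q' y = (∫ x in (-1 : ℝ)..y, (q x - q' x)) - ∫ x in y..1, (q x - q' x) := by
    rw [intervalIntegral.integral_sub hq.intervalIntegrable hq'.intervalIntegrable,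
      intervalIntegral.integral_sub hq.intervalIntegrable hq'.intervalIntegrable]
    unfold bal; ring
  have h1 := intervalIntegral.abs_integral_le_integral_abs (μ := volume) (f := fun x => q x - q' x) hy.1
  have h2 := intervalIntegral.abs_integral_le_integral_abs (μ := volume) (f := fun x => q x - q' x) hy.2
  have h3 := intervalIntegral.integral_add_adjacent_intervals
    (i.abs.intervalIntegrable (a := -1) (b := y)) (i.abs.intervalIntegrable (a := y) (b := 1))
  have h4 : (∫ x in (-1 : ℝ)..1, |q x - q' x|) ≤ ∫ x, |q x - q' x| := by
    rw [intervalIntegral.integral_of_le (by norm_num)]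
    exact setIntegral_le_integral i.abs (Eventually.of_forall fun x => abs_nonneg _)
  rw [e]
  exact (abs_sub _ _).trans (by linarith)

lemma continuous_bal (hq : Integrable q) : Continuous (bal q) := by
  have e : bal q = fun z => bal q 0 + (2 * (∫ x in (0 : ℝ)..z, q x) + 2 * (z - 0)) := by
    funext z; rw [← bal_sub hq]; ring
  rw [e]
  have := hq.continuous_primitive 0
  fun_prop

lemma exists_bal_eq_zero (hq : Integrable q) (h0 : ∀ x, 0 ≤ q x) :
    ∃ y ∈ Ioo (-1 : ℝ) 1, bal q y = 0 := by
  have h := intervalIntegral.integral_nonneg (μ := volume) (a := -1) (b := 1) (by norm_num)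
    (fun x _ => h0 x)
  have hl : bal q (-1) < 0 := by simp only [bal, intervalIntegral.integral_same]; linarith
  have hr : 0 < bal q 1 := by simp only [bal, intervalIntegral.integral_same]; linarith
  exact intermediate_value_Ioo (by norm_num) (continuous_bal hq).continuousOn ⟨hl, hr⟩

lemma bal_reflect (q : ℝ → ℝ) (y : ℝ) : bal (fun x => q (-x)) (-y) = -bal q y := by
  unfold bal
  rw [intervalIntegral.integral_comp_neg, intervalIntegral.integral_comp_neg]
  simp only [neg_neg]; ring

lemma setIntegral_sub_eq_bal (hq : Integrable q) {y : ℝ} (hy : y ∈ Icc (-1 : ℝ) 1) :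
    (∫ x in Ioo (-1) y, (1 + q x)) - (∫ x in Ioo y 1, (1 + q x)) = bal q y := by
  rw [← integral_Ioc_eq_integral_Ioo, ← integral_Ioc_eq_integral_Ioo,
    ← intervalIntegral.integral_of_le hy.1, ← intervalIntegral.integral_of_le hy.2,
    intervalIntegral.integral_add (by simp) hq.intervalIntegrable,
    intervalIntegral.integral_add (by simp) hq.intervalIntegrable]
  simp only [intervalIntegral.integral_const, smul_eq_mul]
  unfold bal; ring
end bal

lemma BddMeas.mul {X : Type*} [MeasurableSpace X] {g h : X → ℝ} (hg : BddMeas g)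
    (hh : BddMeas h) : BddMeas (fun x => g x * h x) := by
  obtain ⟨hg, B, hB⟩ := hg
  obtain ⟨hh, B', hB'⟩ := hh
  refine ⟨hg.mul hh, B * B', fun x => ?_⟩
  rw [abs_mul]
  exact mul_le_mul (hB x) (hB' x) (abs_nonneg _) ((abs_nonneg _).trans (hB x))

lemma WeakIneq.congr_ae {Ω : Set (ℝ × ℝ)} {D q D' q' : ℝ × ℝ → ℝ} (h : WeakIneq Ω D q)
    (hD : ∀ᵐ P : ℝ × ℝ, 0 < P.1 → P ∈ Ω → D P = D' P)
    (hq : ∀ᵐ P : ℝ × ℝ, 0 < P.1 → P ∈ Ω → q P = q' P) : WeakIneq Ω D' q' := by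
  intro φ hφ hs
  refine (h φ hφ hs).trans_eq (integral_congr_ae ?_)
  filter_upwards [hD, hq] with P h1 h2
  by_cases hP : φ P = 0
  · simp [dT_eq_zero_of_zero hφ hP, dX_eq_zero_of_zero hφ hP]
  · have h0 : 0 < P.1 := by
      by_contra h0
      exact hP (hφ.zero P (not_lt.1 h0))
    rw [h1 h0 (hs P hP), h2 h0 (hs P hP)]

/-- The side of the curve `x = η t` on which a point lies. -/
def side (η : ℝ → ℝ) (P : ℝ × ℝ) : ℝ := Real.sign (P.2 - η P.1)

lemma bddMeas_side {η : ℝ → ℝ} (hη : Measurable η) : BddMeas (side η) :=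
  ⟨measurable_real_sign.comp (measurable_snd.sub (hη.comp measurable_fst)), 1,
    fun _ => abs_sign_le_one _⟩

lemma integral_sign_mul_deriv {ψ ψ' : ℝ → ℝ} (h : ∀ x, HasDerivAt ψ (ψ' x) x)
    (hψ' : Continuous ψ') (hc : HasCompactSupport ψ) (a : ℝ) :
    ∫ x, Real.sign (x - a) * ψ' x = -2 * ψ a := by
  have hd : deriv ψ = ψ' := funext fun x => (h x).deriv
  have hC : ContDiff ℝ 1 ψ := contDiff_one_iff_deriv.2 ⟨fun x => (h x).differentiableAt, hd ▸ hψ'⟩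
  have h1 := HasCompactSupport.integral_Ioi_deriv_eq hC hc a
  have h2 := HasCompactSupport.integral_Iic_deriv_eq hC hc a
  rw [hd] at h1 h2
  have hcc : HasCompactSupport ψ' := hd ▸ hc.deriv
  have hi : Integrable ψ' := hψ'.integrable_of_hasCompactSupport hcc
  have hs : Integrable fun x => Real.sign (x - a) * ψ' x :=
    BddMeas.integrable_mul ⟨measurable_real_sign.comp (measurable_id.sub_const a), 1,
      fun _ => abs_sign_le_one _⟩ hi
  rw [← intervalIntegral.integral_Iic_add_Ioi (b := a) hs.integrableOn hs.integrableOn]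
  have e1 : ∫ x in Ioi a, Real.sign (x - a) * ψ' x = -ψ a := by
    rw [← h1]
    refine setIntegral_congr_fun measurableSet_Ioi fun x hx => ?_
    have : 0 < x - a := sub_pos.2 hx
    simp only [Real.sign_of_pos this, one_mul]
  have e2 : ∫ x in Iic a, Real.sign (x - a) * ψ' x = -ψ a := by
    rw [← h2, integral_Iic_eq_integral_Iio, integral_Iic_eq_integral_Iio, ← integral_neg]
    refine setIntegral_congr_fun measurableSet_Iio fun x hx => ?_
    have : x - a < 0 := sub_neg.2 hx
    simp only [Real.sign_of_neg this, neg_mul, one_mul]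
  rw [e1, e2]; ring

lemma IsTest.slice_cpt {φ : ℝ × ℝ → ℝ} (h : IsTest φ) (t : ℝ) :
    HasCompactSupport fun x => φ (t, x) := by
  refine HasCompactSupport.of_support_subset_isCompact (K := Prod.snd '' tsupport φ)
    (h.cpt.isCompact.image continuous_snd) fun x hx => ⟨(t, x), subset_tsupport _ hx, rfl⟩

lemma integral_side_mul_dX {φ : ℝ × ℝ → ℝ} (h : IsTest φ) {η : ℝ → ℝ} (hη : Measurable η) :
    ∫ P, side η P * dX φ P = -2 * ∫ t in Ioi (0 : ℝ), φ (t, η t) := by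
  have hi : Integrable (fun P => side η P * dX φ P) :=
    (bddMeas_side hη).integrable_mul h.integrable_dX
  have e : ∫ t in Ioi (0 : ℝ), φ (t, η t) = ∫ t, φ (t, η t) :=
    setIntegral_eq_integral_of_forall_compl_eq_zero fun t ht => h.zero _ (not_lt.1 ht)
  rw [e, ← integral_const_mul, Measure.volume_eq_prod, integral_prod _ hi]
  refine integral_congr_ae (Eventually.of_forall fun t => ?_)
  exact integral_sign_mul_deriv (fun x => hasDerivAt_dX h.smooth t x)
    ((continuous_dX h.smooth).comp (by fun_prop)) (h.slice_cpt t) (η t)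

/-- Hughes' entropy inequalities with the interface term absorbed in the flux. -/
def HughesEntropy (f : ℝ → ℝ) (ρm : ℝ) (η : ℝ → ℝ) (p : ℝ × ℝ → ℝ) : Prop :=
  ∀ k ∈ Icc 0 ρm, WeakIneq univ (fun P => |p P - k|)
    (fun P => side η P * (kflux f (p P) k - f k))

lemma entropy_integral_eq {f : ℝ → ℝ} {ρm V Λ : ℝ} (hf : FluxOn f ρm V Λ) {η : ℝ → ℝ}
    (hη : Measurable η) {p : ℝ × ℝ → ℝ} (hp : BddMeas p) (k : ℝ) {φ : ℝ × ℝ → ℝ} (h : IsTest φ) :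
    (∫ t in Ioi (0 : ℝ), ∫ x : ℝ, (|p (t, x) - k| * dT φ (t, x) +
      Real.sign (p (t, x) - k) * (Real.sign (x - η t) * f (p (t, x)) - Real.sign (x - η t) * f k) *
        dX φ (t, x))) + 2 * ∫ t in Ioi (0 : ℝ), f k * φ (t, η t) =
    ∫ P, (|p P - k| * dT φ P + side η P * (kflux f (p P) k - f k) * dX φ P) := by
  have hD := (hp.sub (.const k)).abs
  have hq := (bddMeas_side hη).mul (hp.kflux hf.lip hf.meas (.const k))
  have i1 : Integrable (fun P => |p P - k| * dT φ P + side η P * kflux f (p P) k * dX φ P) :=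
    (hD.integrable_mul h.integrable_dT).add (hq.integrable_mul h.integrable_dX)
  have i2 : Integrable (fun P => side η P * dX φ P) :=
    (bddMeas_side hη).integrable_mul h.integrable_dX
  have e1 : ∫ P, (|p P - k| * dT φ P + side η P * (kflux f (p P) k - f k) * dX φ P) =
      (∫ P, (|p P - k| * dT φ P + side η P * kflux f (p P) k * dX φ P)) -
        f k * ∫ P, side η P * dX φ P := by
    rw [← integral_const_mul, ← integral_sub i1 (i2.const_mul _)]
    refine integral_congr_ae (Eventually.of_forall fun P => ?_)
    simp only; ring
  rw [e1, integral_side_mul_dX h hη, integral_const_mul, Measure.volume_eq_prod,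
    integral_prod _ i1]
  have e2 : ∀ t x : ℝ, |p (t, x) - k| * dT φ (t, x) +
      Real.sign (p (t, x) - k) * (Real.sign (x - η t) * f (p (t, x)) - Real.sign (x - η t) * f k) *
        dX φ (t, x) = |p (t, x) - k| * dT φ (t, x) + side η (t, x) * kflux f (p (t, x)) k *
          dX φ (t, x) := fun t x => by
    simp only [side, kflux]; ring
  simp only [e2]
  rw [setIntegral_eq_integral_of_forall_compl_eq_zero]
  · ring
  · intro t ht
    have h0 : ∀ x, φ (t, x) = 0 := fun x => h.zero _ (not_lt.1 ht)
    simp [dT_eq_zero_of_zero h (h0 _), dX_eq_zero_of_zero h (h0 _)]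

/-- The data of the evacuation problem after normalisation: `f` is the flux, `e` the cost
excess, `m` the speed at density `M` and `ub` the initial datum extended by `0`. -/
structure HughesData (f e g H : ℝ → ℝ) (ρm V Λ m M L c₀ TV : ℝ) (ub : ℝ → ℝ) : Prop where
  flux : FluxOn f ρm V Λ
  V_pos : 0 < V
  m_pos : 0 < m
  m_le : m ≤ V
  slope : ∀ r ∈ Icc 0 M, m * r ≤ f r
  M_le : M ≤ ρm
  cost : CostOn e g H M L c₀
  cost_nonneg : ∀ r, 0 ≤ e r
  cost_lip : ∃ Λe : ℝ, ∀ r s, |e r - e s| ≤ Λe * |r - s|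
  range : ∀ x, ub x ∈ Icc 0 M
  zero : ∀ x, x ∉ Ioo (-1 : ℝ) 1 → ub x = 0
  TV_nonneg : 0 ≤ TV
  var : eVariationOn ub (Ioo (-1) 1) ≤ ENNReal.ofReal TV
  small : V * (3 * (H M + e M) + L * TV) < 2 * m

namespace HughesData
variable {f e g H : ℝ → ℝ} {ρm V Λ m M L c₀ TV : ℝ} {ub : ℝ → ℝ}

lemma M_nonneg (S : HughesData f e g H ρm V Λ m M L c₀ TV ub) : 0 ≤ M := S.cost.dual.M_nonneg

lemma reflect (S : HughesData f e g H ρm V Λ m M L c₀ TV ub) :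
    HughesData f e g H ρm V Λ m M L c₀ TV (fun x => ub (-x)) :=
  { S with
    range := fun x => S.range _
    zero := fun x hx => S.zero _ fun h => hx ⟨by linarith [h.2], by linarith [h.1]⟩
    var := (eVariationOn.comp_le_of_antitoneOn ub (fun x => -x) (fun x _ y _ h => neg_le_neg h)
      (t := Ioo (-1) 1) (fun x (hx : x ∈ Ioo (-1 : ℝ) 1) => show -x ∈ Ioo (-1 : ℝ) 1 from
        ⟨by linarith [hx.2], by linarith [hx.1]⟩)).trans S.var }

variable (S : HughesData f e g H ρm V Λ m M L c₀ TV ub)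
include S

lemma box : BVBox M (2 * TV + 2 * M) 1 ub :=
  BVBox.of_Ioo (by norm_num) (by norm_num) (by norm_num) S.TV_nonneg S.range S.var S.zero

lemma side_box {a : ℝ} (ha : a ∈ Ioo (-1 : ℝ) 1) :
    BVBox M (2 * TV + 2 * M) 1 ((Ioo a 1).indicator ub) := by
  refine BVBox.of_Ioo ha.2 (abs_le.2 ⟨ha.1.le, ha.2.le⟩) (by norm_num) S.TV_nonneg (fun x => ?_) ?_
    (fun x hx => indicator_of_notMem hx _)
  · by_cases h : x ∈ Ioo a 1
    · rw [indicator_of_mem h]; exact S.range x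
    · rw [indicator_of_notMem h]; exact ⟨le_rfl, S.M_nonneg⟩
  · rw [eVariationOn.congr (fun x hx => indicator_of_mem hx ub)]
    exact (eVariationOn.mono ub (Ioo_subset_Ioo_left ha.1.le)).trans S.var

lemma exists_side {a : ℝ} (ha : a ∈ Ioo (-1 : ℝ) 1) :
    ∃ B K : ℝ, 0 ≤ B ∧ 0 ≤ K ∧ ∃ u, EvolSol f M (2 * TV + 2 * M) 1 B K u ∧
      ∀ᵐ x, u (0, x) = (Ioo a 1).indicator ub x :=
  exists_evolSol S.flux.lip_nonneg S.flux.lip S.M_nonneg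
    (by linarith [S.M_nonneg, S.TV_nonneg]) zero_le_one (S.side_box ha)

variable {a A B K : ℝ} {u : ℝ × ℝ → ℝ} (hu : EvolSol f M (2 * TV + 2 * M) A B K u)
  (hae : ∀ᵐ x, u (0, x) = (Ioo a 1).indicator ub x)
include hu hae

lemma side_zero_left {t : ℝ} (ht : 0 ≤ t) : ∀ᵐ x, x < a + m * t → u (t, x) = 0 := by
  refine hu.ae_zero_left S.flux S.M_le S.slope ?_ ht
  filter_upwards [hae] with x hx hxa
  rw [hx, indicator_of_notMem fun h => absurd h.1 hxa.le.not_gt]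

lemma side_zero_right {t : ℝ} (ht : 0 ≤ t) : ∀ᵐ x, 1 + V * t < x → u (t, x) = 0 := by
  refine hu.ae_zero_right S.flux S.M_le ?_ ht
  filter_upwards [hae] with x hx hxa
  rw [hx, indicator_of_notMem fun h => absurd h.2 hxa.le.not_gt]

omit hu hae in
lemma integral_side_cost (ha : a < 1) :
    ∫ x, e ((Ioo a 1).indicator ub x) = ∫ x in a..1, e (ub x) := by
  rw [intervalIntegral.integral_of_le ha.le, integral_Ioc_eq_integral_Ioo,
    ← integral_indicator measurableSet_Ioo]
  refine integral_congr_ae (Eventually.of_forall fun x => ?_)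
  by_cases h : x ∈ Ioo a 1
  · simp only [indicator_of_mem h]
  · simp only [indicator_of_notMem h, S.cost.zero]

lemma integrable_cost (t : ℝ) : Integrable fun x => e (u (t, x)) :=
  S.cost.integrable (hu.box t).integrable (hu.box t).meas (hu.box t).range

lemma side_upper (ha : a ∈ Ioo (-1 : ℝ) 1) {b t : ℝ} (hb : b ≤ 1) (ht : 0 ≤ t) :
    ∫ x in b..1, e (u (t, x)) ≤ ∫ x in a..1, e (ub x) := by
  rw [← S.integral_side_cost ha.2, intervalIntegral.integral_of_le hb]
  exact (setIntegral_le_integral (S.integrable_cost hu hae t)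
    (Eventually.of_forall fun x => (S.cost.mem (hu.range _)).1)).trans
    (hu.cost_upper S.flux S.M_le S.cost hae ht)

lemma side_lower (ha : a ∈ Ioo (-1 : ℝ) 1) {b t : ℝ} (hab : a ≤ b) (hb : b ≤ 1) (ht : 0 ≤ t) :
    (∫ x in a..1, e (ub x)) - V * t * (H M + e M + L * TV) - e M * (b - a) ≤
      ∫ x in b..1, e (u (t, x)) := by
  have i := S.integrable_cost hu hae t
  have hθ := S.cost.top_nonneg
  have h1 := hu.cost_lower S.flux S.M_le S.V_pos S.cost (by linarith [S.M_nonneg, S.TV_nonneg])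
    S.TV_nonneg (S.side_box ha) hae (a := a) (b := 1)
    (fun x hx => indicator_of_notMem (fun h => absurd h.1 hx.not_gt) _)
    (fun x hx => indicator_of_notMem (fun h => absurd h.2 hx.not_gt) _)
    (by
      rw [eVariationOn.congr (fun x hx => indicator_of_mem hx ub)]
      exact (eVariationOn.mono ub (Ioo_subset_Ioo_left ha.1.le)).trans S.var) ht
  rw [S.integral_side_cost ha.2] at h1
  have hVt : 0 ≤ V * t := mul_nonneg S.V_pos.le ht
  have hmt : 0 ≤ m * t := mul_nonneg S.m_pos.le ht
  have j1 : Integrable ((Ioc b 1).indicator fun x => e (u (t, x))) := i.indicator measurableSet_Ioc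
  have j2 : Integrable ((Icc a b).indicator fun _ => e M) := by
    rw [integrable_indicator_iff measurableSet_Icc]; simp [integrableOn_const_iff]
  have j3 : Integrable ((Icc 1 (1 + V * t)).indicator fun _ => e M) := by
    rw [integrable_indicator_iff measurableSet_Icc]; simp [integrableOn_const_iff]
  have j23 : Integrable fun x => (Icc a b).indicator (fun _ => e M) x +
    (Icc 1 (1 + V * t)).indicator (fun _ => e M) x := j2.add j3
  have h2 : ∫ x, e (u (t, x)) ≤ ∫ x, ((Ioc b 1).indicator (fun x => e (u (t, x))) x +
      ((Icc a b).indicator (fun _ => e M) x + (Icc 1 (1 + V * t)).indicator (fun _ => e M) x)) := by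
    refine integral_mono_ae i (j1.add j23) ?_
    filter_upwards [S.side_zero_left hu hae ht, S.side_zero_right hu hae ht] with x hl hr
    have p1 : 0 ≤ (Ioc b 1).indicator (fun x => e (u (t, x))) x :=
      indicator_nonneg (fun x _ => (S.cost.mem (hu.range _)).1) _
    have p2 : 0 ≤ (Icc a b).indicator (fun _ => e M) x := indicator_nonneg (fun _ _ => hθ) _
    have p3 : 0 ≤ (Icc 1 (1 + V * t)).indicator (fun _ => e M) x :=
      indicator_nonneg (fun _ _ => hθ) _
    have hle := (S.cost.mem (hu.range (t, x))).2
    by_cases c1 : x ∈ Ioc b 1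
    · rw [indicator_of_mem c1]; linarith
    · by_cases c2 : x ∈ Icc a b
      · rw [indicator_of_mem c2]; linarith
      · by_cases c3 : x ∈ Icc 1 (1 + V * t)
        · rw [indicator_of_mem c3]; linarith
        · have : u (t, x) = 0 := by
            by_cases hx : x ≤ b
            · refine hl ?_
              by_contra hc
              exact c2 ⟨by linarith, hx⟩
            · refine hr ?_
              by_contra hc
              have : 1 < x := by
                by_contra h'
                exact c1 ⟨not_le.1 hx, not_lt.1 h'⟩
              exact c3 ⟨this.le, not_lt.1 hc⟩
          rw [this, S.cost.zero]; linarith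
  rw [integral_add j1 j23, integral_add j2 j3, integral_indicator measurableSet_Ioc,
    integral_indicator_const _ measurableSet_Icc, integral_indicator_const _ measurableSet_Icc,
    ← intervalIntegral.integral_of_le hb] at h2
  simp only [Measure.real, Real.volume_Icc, smul_eq_mul] at h2
  rw [ENNReal.toReal_ofReal (by linarith), ENNReal.toReal_ofReal (by linarith)] at h2
  linarith

end HughesData

lemma ae_prod_of_forall_ae {p : ℝ × ℝ → Prop} (hp : MeasurableSet {P | p P})
    (h : ∀ t, ∀ᵐ x, p (t, x)) : ∀ᵐ P, p P := by
  rw [Measure.volume_eq_prod, Measure.ae_prod_iff_ae_ae hp]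
  exact Eventually.of_forall h

lemma ae_neg {p : ℝ → Prop} (h : ∀ᵐ x, p x) : ∀ᵐ x, p (-x) :=
  (Measure.measurePreserving_neg (volume : Measure ℝ)).quasiMeasurePreserving.ae h

/-- Normalised entropy solutions of Hughes' model. -/
structure HughesSol (f e : ℝ → ℝ) (ρm : ℝ) (ub η : ℝ → ℝ) (p : ℝ × ℝ → ℝ) : Prop where
  meas : Measurable p
  range : ∀ P, p P ∈ Icc 0 ρm
  time : TimeL1 p
  init : ∀ᵐ x, p (0, x) = ub x
  mem : ∀ t, η t ∈ Ioo (-1 : ℝ) 1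
  meas_eta : Measurable η
  lip : ∃ Q : ℝ, ∀ s t, 0 ≤ s → 0 ≤ t → |η t - η s| ≤ Q * |t - s|
  balance : ∀ t, 0 ≤ t → bal (fun x => e (p (t, x))) (η t) = 0
  entropy : HughesEntropy f ρm η p

lemma kflux_zero_sub {f : ℝ → ℝ} (hf : f 0 = 0) {k : ℝ} (hk : 0 ≤ k) : kflux f 0 k - f k = 0 := by
  rw [kflux_of_ge hk, hf]; ring

lemma side_neg (η : ℝ → ℝ) (P : ℝ × ℝ) : side (fun t => -η t) P = -side η (reflX P) := by
  unfold side reflX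
  rw [← Real.sign_neg]; congr 1; ring

lemma HughesSol.reflect {f e : ℝ → ℝ} {ρm : ℝ} {ub η : ℝ → ℝ} {p : ℝ × ℝ → ℝ}
    (h : HughesSol f e ρm ub η p) :
    HughesSol f e ρm (fun x => ub (-x)) (fun t => -η t) (fun P => p (reflX P)) where
  meas := h.meas.comp measurable_reflX
  range P := h.range _
  time := h.time.reflX
  init := by
    have := ae_neg h.init
    simpa [reflX] using this
  mem t := ⟨by linarith [(h.mem t).2], by linarith [(h.mem t).1]⟩
  meas_eta := h.meas_eta.neg
  lip := h.lip.imp fun Q hQ s t hs ht => by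
    rw [neg_sub_neg, abs_sub_comm]; exact hQ s t hs ht
  balance t ht := by
    have := bal_reflect (fun x => e (p (t, x))) (η t)
    rw [h.balance t ht, neg_zero] at this
    exact this
  entropy k hk := (h.entropy k hk).reflX.congr (fun _ _ _ => rfl) fun P _ _ => by
    rw [side_neg]; ring

lemma bal_zero_dist {q q' : ℝ → ℝ} (hq : Integrable q) (hq' : Integrable q') (h0 : ∀ x, 0 ≤ q x)
    {y y' : ℝ} (hy' : y' ∈ Icc (-1 : ℝ) 1) (h : bal q y = 0)
    (h' : bal q' y' = 0) : 2 * |y' - y| ≤ ∫ x, |q x - q' x| := by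
  refine (abs_sub_le_bal hq h0 y y').trans ?_
  rw [h, ← h']
  exact abs_bal_sub_bal_le hq hq' hy'

lemma eVariationOn_max_le {u w : ℝ → ℝ} {W : ℝ} (hW : 0 ≤ W)
    (hu : eVariationOn u univ ≤ ENNReal.ofReal W) (hw : eVariationOn w univ ≤ ENNReal.ofReal W) :
    eVariationOn (fun x => max (u x) (w x)) univ ≤ ENNReal.ofReal (2 * W) := by
  have := eVariationOn_le_of_dominated (u := fun x => max (u x) (w x)) (S := univ) (a := 0)
    (b := 2 * W) (A := fun x => varFn u x + varFn w x)
    (fun x _ => ⟨add_nonneg (varFn_nonneg _ _) (varFn_nonneg _ _), by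
      linarith [varFn_le hu hW x, varFn_le hw hW x]⟩)
    (fun x _ y _ hxy => by
      have h1 := abs_sub_le_varFn hu hxy
      have h2 := abs_sub_le_varFn hw hxy
      have h3 := abs_max_sub_max_le_max (u y) (w y) (u x) (w x)
      have h4 : max |u y - u x| |w y - w x| ≤ |u y - u x| + |w y - w x| :=
        max_le (by linarith [abs_nonneg (w y - w x)]) (by linarith [abs_nonneg (u y - u x)])
      linarith)
  rwa [sub_zero] at this

namespace HughesData
variable {f e g H : ℝ → ℝ} {ρm V Λ m M L c₀ TV : ℝ} {ub : ℝ → ℝ}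
  (S : HughesData f e g H ρm V Λ m M L c₀ TV ub)
include S

lemma reflect_zero {ξ₀ : ℝ} (h : bal (fun x => e (ub x)) ξ₀ = 0) :
    bal (fun x => e (ub (-x))) (-ξ₀) = 0 := by
  have := bal_reflect (fun x => e (ub x)) ξ₀
  rw [h, neg_zero] at this
  exact this

lemma integral_cost_reflect (ξ₀ : ℝ) :
    ∫ x in -ξ₀..1, e (ub (-x)) = ∫ x in (-1 : ℝ)..ξ₀, e (ub x) := by
  have := intervalIntegral.integral_comp_neg (a := -ξ₀) (b := 1) (fun x => e (ub x))
  rw [this, neg_neg]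

end HughesData

/-- The superposition of the right-moving solution and the reflected left-moving one. -/
def glue (ur ul : ℝ × ℝ → ℝ) (P : ℝ × ℝ) : ℝ := max (ur P) (ul (reflX P))

namespace HughesData
variable {f e g H : ℝ → ℝ} {ρm V Λ m M L c₀ TV : ℝ} {ub : ℝ → ℝ}
  (S : HughesData f e g H ρm V Λ m M L c₀ TV ub)
  {ξ₀ B K B' K' : ℝ} {ur ul : ℝ × ℝ → ℝ} (hξ : ξ₀ ∈ Ioo (-1 : ℝ) 1)
  (hz : bal (fun x => e (ub x)) ξ₀ = 0)
  (hr : EvolSol f M (2 * TV + 2 * M) 1 B K ur)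
  (har : ∀ᵐ x, ur (0, x) = (Ioo ξ₀ 1).indicator ub x)
  (hl : EvolSol f M (2 * TV + 2 * M) 1 B' K' ul)
  (hal : ∀ᵐ x, ul (0, x) = (Ioo (-ξ₀) 1).indicator (fun x => ub (-x)) x)

include S hl hal in
lemma left_zero {t : ℝ} (ht : 0 ≤ t) : ∀ᵐ x, ξ₀ - m * t < x → ul (t, -x) = 0 := by
  filter_upwards [ae_neg (S.reflect.side_zero_left hl hal ht)] with x hx hxt
  exact hx (by linarith)

include hr hl in
lemma glue_meas : Measurable (glue ur ul) := hr.meas.max (hl.meas.comp measurable_reflX)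

include hr hl in
lemma glue_range (P : ℝ × ℝ) : glue ur ul P ∈ Icc 0 M :=
  ⟨(hr.range P).1.trans (le_max_left _ _), max_le (hr.range P).2 (hl.range _).2⟩

include hr hl in
lemma glue_integrable (t : ℝ) : Integrable fun x => glue ur ul (t, x) :=
  (hr.box t).integrable.sup (hl.box t).integrable.comp_neg

include hr hl in
lemma glue_lip (s t : ℝ) :
    ∫ x, |glue ur ul (t, x) - glue ur ul (s, x)| ≤ (K + K') * |t - s| := by
  have i1 : Integrable fun x => |ur (t, x) - ur (s, x)| :=
    ((hr.box t).integrable.sub (hr.box s).integrable).abs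
  have i2 : Integrable fun x => |ul (t, x) - ul (s, x)| :=
    ((hl.box t).integrable.sub (hl.box s).integrable).abs
  have i3 : Integrable fun x => |ul (t, -x) - ul (s, -x)| := i2.comp_neg
  have e2 : ∫ x, |ul (t, -x) - ul (s, -x)| = ∫ x, |ul (t, x) - ul (s, x)| :=
    integral_neg_eq_self (fun x => |ul (t, x) - ul (s, x)|) volume
  have : ∫ x, |glue ur ul (t, x) - glue ur ul (s, x)| ≤
      ∫ x, (|ur (t, x) - ur (s, x)| + |ul (t, -x) - ul (s, -x)|) := by
    refine integral_mono ((glue_integrable hr hl t).sub (glue_integrable hr hl s)).abs (i1.add i3)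
      fun x => (abs_max_sub_max_le_max _ _ _ _).trans ?_
    exact max_le (by simp [reflX]) (by simp [reflX])
  rw [integral_add i1 i3, e2] at this
  have h1 := hr.lip s t
  have h2 := hl.lip s t
  linarith

include hr hl in
lemma glue_time : TimeL1 (glue ur ul) where
  int t _ := glue_integrable hr hl t
  cont s hs := by
    refine squeeze_zero (fun t => integral_nonneg fun _ => abs_nonneg _)
      (fun t => glue_lip hr hl s t) ?_
    have : Continuous fun t : ℝ => (K + K') * |t - s| := by fun_prop
    have := this.tendsto s
    simp only [sub_self, abs_zero, mul_zero] at this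
    exact this.mono_left nhdsWithin_le_nhds

include S hr har hl hal

lemma glue_right {t : ℝ} (ht : 0 ≤ t) :
    ∀ᵐ x, ξ₀ - m * t < x → glue ur ul (t, x) = ur (t, x) := by
  filter_upwards [S.left_zero hl hal ht] with x hx h
  rw [glue, reflX, hx h]
  exact max_eq_left (hr.range _).1

lemma glue_left {t : ℝ} (ht : 0 ≤ t) :
    ∀ᵐ x, x < ξ₀ + m * t → glue ur ul (t, x) = ul (t, -x) := by
  filter_upwards [S.side_zero_left hr har ht] with x hx h
  rw [glue, reflX, hx h]
  exact max_eq_right (hl.range _).1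

lemma glue_init : ∀ᵐ x, glue ur ul (0, x) = ub x := by
  have hne : ∀ᵐ x : ℝ, x ≠ ξ₀ := by simp [ae_iff, measure_singleton]
  filter_upwards [har, ae_neg hal, hne] with x h1 h2 h3
  rw [glue, reflX, h1, h2]
  by_cases hx : x ∈ Ioo (-1 : ℝ) 1
  · rcases lt_or_gt_of_ne h3 with h | h
    · rw [indicator_of_notMem (fun h' => absurd h'.1 h.not_gt),
        indicator_of_mem (show -x ∈ Ioo (-ξ₀) 1 from ⟨by linarith, by linarith [hx.1]⟩), neg_neg]
      exact max_eq_right (S.range x).1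
    · rw [indicator_of_mem (show x ∈ Ioo ξ₀ 1 from ⟨h, hx.2⟩),
        indicator_of_notMem (fun h' => by linarith [h'.1])]
      exact max_eq_left (S.range x).1
  · have h0 := S.zero x hx
    have e1 : (Ioo ξ₀ 1).indicator ub x = 0 := by
      by_cases h : x ∈ Ioo ξ₀ 1
      · rw [indicator_of_mem h, h0]
      · exact indicator_of_notMem h _
    have e2 : (Ioo (-ξ₀) 1).indicator (fun x => ub (-x)) (-x) = 0 := by
      by_cases h : -x ∈ Ioo (-ξ₀) 1
      · rw [indicator_of_mem h, neg_neg, h0]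
      · exact indicator_of_notMem h _
    rw [e1, e2, h0, max_self]

include hξ hz

lemma glue_bal {t : ℝ} (ht : 0 ≤ t) :
    |bal (fun x => e (glue ur ul (t, x))) ξ₀| ≤ V * t * (H M + e M + L * TV) := by
  have hξ' : -ξ₀ ∈ Ioo (-1 : ℝ) 1 := ⟨by linarith [hξ.2], by linarith [hξ.1]⟩
  have hmt : 0 ≤ m * t := mul_nonneg S.m_pos.le ht
  have er : ∫ x in ξ₀..1, e (glue ur ul (t, x)) = ∫ x in ξ₀..1, e (ur (t, x)) := by
    refine intervalIntegral.integral_congr_ae ?_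
    rw [uIoc_of_le hξ.2.le]
    filter_upwards [S.glue_right hr har hl hal ht] with x hx hxm
    rw [hx (by linarith [hxm.1])]
  have el : ∫ x in (-1 : ℝ)..ξ₀, e (glue ur ul (t, x)) = ∫ x in -ξ₀..1, e (ul (t, x)) := by
    have h := intervalIntegral.integral_comp_neg (a := -ξ₀) (b := 1)
      (fun x => e (glue ur ul (t, x)))
    rw [neg_neg] at h
    rw [← h]
    refine intervalIntegral.integral_congr_ae ?_
    rw [uIoc_of_le hξ'.2.le]
    have hne : ∀ᵐ x : ℝ, x ≠ -ξ₀ := by simp [ae_iff, measure_singleton]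
    filter_upwards [ae_neg (S.glue_left hr har hl hal ht), hne] with x hx hne hxm
    have : -ξ₀ < x := hxm.1
    rw [hx (by linarith), neg_neg]
  have r1 := S.side_upper hr har hξ hξ.2.le ht
  have r2 := S.side_lower hr har hξ le_rfl hξ.2.le ht
  have l1 := S.reflect.side_upper hl hal hξ' hξ'.2.le ht
  have l2 := S.reflect.side_lower hl hal hξ' le_rfl hξ'.2.le ht
  rw [S.integral_cost_reflect] at l1 l2
  unfold bal at hz ⊢
  rw [er, el, abs_le]
  constructor <;> linarith

/-- The turning curve stays strictly inside the vacuum cone. -/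
lemma glue_cone {t y : ℝ} (ht : 0 < t)
    (hy : bal (fun x => e (glue ur ul (t, x))) y = 0) : |y - ξ₀| < m * t := by
  have hi : Integrable fun x => e (glue ur ul (t, x)) :=
    S.cost.integrable (glue_integrable hr hl t) ((glue_meas hr hl).comp measurable_prodMk_left)
      (fun x => glue_range hr hl _)
  have h1 := abs_sub_le_bal hi (fun x => S.cost_nonneg _) ξ₀ y
  have h2 := S.glue_bal hξ hz hr har hl hal ht.le
  rw [hy, zero_sub, abs_neg] at h1
  have h3 : V * (3 * (H M + e M) + L * TV) * t < 2 * m * t := mul_lt_mul_of_pos_right S.small ht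
  have h4 : 0 ≤ V * t * (H M + e M) := mul_nonneg (mul_nonneg S.V_pos.le ht.le)
    (add_nonneg (S.cost.dual.H_nonneg S.cost.dual.top_mem) S.cost.top_nonneg)
  linarith

end HughesData

lemma measurableSet_setOf_imp {X : Type*} [MeasurableSpace X] {p q : X → Prop}
    (hp : MeasurableSet {x | p x}) (hq : MeasurableSet {x | q x}) :
    MeasurableSet {x | p x → q x} := by
  have : {x | p x → q x} = {x | p x}ᶜ ∪ {x | q x} := by
    ext x; simp only [mem_ofPred_eq, mem_union, mem_compl_iff]; tauto
  rw [this]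
  exact hp.compl.union hq

lemma measurableSet_setOf_eq_fun {X : Type*} [MeasurableSpace X] {u w : X → ℝ} (hu : Measurable u)
    (hw : Measurable w) : MeasurableSet {x | u x = w x} := measurableSet_eq_fun hu hw

namespace HughesData
variable {f e g H : ℝ → ℝ} {ρm V Λ m M L c₀ TV : ℝ} {ub : ℝ → ℝ}
  (S : HughesData f e g H ρm V Λ m M L c₀ TV ub)
  {ξ₀ B K B' K' : ℝ} {ur ul : ℝ × ℝ → ℝ} (hξ : ξ₀ ∈ Ioo (-1 : ℝ) 1)
  (hz : bal (fun x => e (ub x)) ξ₀ = 0)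
  (hr : EvolSol f M (2 * TV + 2 * M) 1 B K ur)
  (har : ∀ᵐ x, ur (0, x) = (Ioo ξ₀ 1).indicator ub x)
  (hl : EvolSol f M (2 * TV + 2 * M) 1 B' K' ul)
  (hal : ∀ᵐ x, ul (0, x) = (Ioo (-ξ₀) 1).indicator (fun x => ub (-x)) x)
include S hr har hl hal

omit hl hal in
lemma ae_right_zero : ∀ᵐ P : ℝ × ℝ, 0 < P.1 → P.2 < ξ₀ + m * P.1 → ur P = 0 := by
  refine ae_prod_of_forall_ae (measurableSet_setOf_imp (measurableSet_lt (by fun_prop) (by fun_prop))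
    (measurableSet_setOf_imp (measurableSet_lt (by fun_prop) (by fun_prop))
      (measurableSet_setOf_eq_fun hr.meas measurable_const))) fun t => ?_
  by_cases ht : 0 < t
  · filter_upwards [S.side_zero_left hr har ht.le] with x hx _ using hx
  · exact Eventually.of_forall fun x h => absurd h ht

omit hr har in
lemma ae_left_zero : ∀ᵐ P : ℝ × ℝ, 0 < P.1 → ξ₀ - m * P.1 < P.2 → ul (reflX P) = 0 := by
  refine ae_prod_of_forall_ae (measurableSet_setOf_imp (measurableSet_lt (by fun_prop) (by fun_prop))
    (measurableSet_setOf_imp (measurableSet_lt (by fun_prop) (by fun_prop))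
      (measurableSet_setOf_eq_fun (hl.meas.comp measurable_reflX) measurable_const))) fun t => ?_
  by_cases ht : 0 < t
  · filter_upwards [S.left_zero hl hal ht.le] with x hx _ using hx
  · exact Eventually.of_forall fun x h => absurd h ht

lemma glue_entropy {η : ℝ → ℝ} (hη : ∀ t, 0 < t → |η t - ξ₀| < m * t) :
    HughesEntropy f ρm η (glue ur ul) := by
  intro k hk
  have bu : BddMeas ur := .of_range hr.meas hr.range
  have bl : BddMeas ul := .of_range hl.meas hl.range
  have aux : ∀ {u : ℝ × ℝ → ℝ}, BddMeas u → WeakIneq univ (fun P => |u P - k|)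
      (fun P => kflux f (u P) k) → BddMeas (fun P => |u P - k| + -k) ∧
      BddMeas (fun P => kflux f (u P) k + -f k) ∧
      WeakIneq univ (fun P => |u P - k| + -k) (fun P => kflux f (u P) k + -f k) := by
    intro u hu h
    have b1 := (hu.sub (.const k)).abs
    have b2 := hu.kflux S.flux.lip S.flux.meas (.const k)
    exact ⟨b1.add (.const _), b2.add (.const _),
      h.add (weakIneq_const univ (-k) (-f k)) b1 b2 (.const _) (.const _)⟩
  obtain ⟨r1, r2, r3⟩ := aux bu (hr.kruzhkov k)
  obtain ⟨l1, l2, l3⟩ := aux bl (hl.kruzhkov k)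
  have hsum := (r3.add l3.reflX r1 r2 l1.reflX l2.reflX.neg).add (weakIneq_const univ k 0)
    (r1.add l1.reflX) (r2.add l2.reflX.neg) (.const _) (.const _)
  have hzero := kflux_zero_sub S.flux.zero hk.1
  have cases : ∀ᵐ P : ℝ × ℝ, 0 < P.1 →
      (ur P = 0 ∧ ul (reflX P) = 0 ∧ side η P = 0) ∨ (ul (reflX P) = 0 ∧ side η P = 1) ∨
        (ur P = 0 ∧ side η P = -1) := by
    filter_upwards [S.ae_right_zero hr har, S.ae_left_zero hl hal] with P h1 h2 hP
    have hc := abs_lt.1 (hη P.1 hP)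
    rcases lt_trichotomy P.2 (η P.1) with h | h | h
    · exact Or.inr (Or.inr ⟨h1 hP (by linarith), Real.sign_of_neg (by linarith)⟩)
    · exact Or.inl ⟨h1 hP (by linarith), h2 hP (by linarith), by simp [side, h]⟩
    · exact Or.inr (Or.inl ⟨h2 hP (by linarith), Real.sign_of_pos (by linarith)⟩)
  refine hsum.congr_ae ?_ ?_
  · filter_upwards [cases] with P hP h0 _
    have p1 := (hr.range P).1
    have p2 := (hl.range (reflX P)).1
    have hk' : |(0 : ℝ) - k| = k := by rw [zero_sub, abs_neg, abs_of_nonneg hk.1]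
    rcases hP h0 with ⟨h1, h2, -⟩ | ⟨h2, -⟩ | ⟨h1, -⟩
    · simp only [glue, h1, h2, max_self, hk']; ring
    · simp only [glue, h2, max_eq_left p1, hk']; ring
    · simp only [glue, h1, max_eq_right p2, hk']; ring
  · filter_upwards [cases] with P hP h0 _
    have p1 := (hr.range P).1
    have p2 := (hl.range (reflX P)).1
    have hk' : kflux f 0 k = f k := by linarith
    rcases hP h0 with ⟨h1, h2, h3⟩ | ⟨h2, h3⟩ | ⟨h1, h3⟩
    · simp only [h1, h2, h3, hk']; ring
    · simp only [glue, h2, max_eq_left p1, hk', h3]; ring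
    · simp only [glue, h1, max_eq_right p2, hk', h3]; ring

include hξ hz in
lemma exists_glue_sol : ∃ η, HughesSol f e ρm ub η (glue ur ul) := by
  have hi : ∀ t, Integrable fun x => e (glue ur ul (t, x)) := fun t =>
    S.cost.integrable (glue_integrable hr hl t) ((glue_meas hr hl).comp measurable_prodMk_left)
      (fun x => glue_range hr hl _)
  choose y hy hy0 using fun t => exists_bal_eq_zero (hi t) fun x => S.cost_nonneg _
  obtain ⟨Λe, hΛ⟩ := S.cost_lip
  have hΛ0 : 0 ≤ Λe := by
    have := (abs_nonneg _).trans (hΛ 1 0)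
    simpa using this
  have hlip : ∀ s t, |y t - y s| ≤ Λe * (K + K') * |t - s| := by
    intro s t
    have h1 := bal_zero_dist (hi s) (hi t) (fun x => S.cost_nonneg _) ⟨(hy t).1.le, (hy t).2.le⟩
      (hy0 s) (hy0 t)
    have h2 : ∫ x, |e (glue ur ul (s, x)) - e (glue ur ul (t, x))| ≤
        ∫ x, Λe * |glue ur ul (t, x) - glue ur ul (s, x)| :=
      integral_mono ((hi s).sub (hi t)).abs
        (((glue_integrable hr hl t).sub (glue_integrable hr hl s)).abs.const_mul _)
        fun x => (hΛ _ _).trans_eq (by rw [abs_sub_comm])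
    rw [integral_const_mul] at h2
    have h3 := mul_le_mul_of_nonneg_left (glue_lip hr hl s t) hΛ0
    have h4 := abs_nonneg (y t - y s)
    linarith
  refine ⟨fun t => y (max t 0), glue_meas hr hl, fun P => ?_, glue_time hr hl,
    S.glue_init hr har hl hal, fun t => hy _, ?_, ⟨Λe * (K + K'), fun s t hs ht => ?_⟩,
    fun t ht => ?_, S.glue_entropy hr har hl hal fun t ht => ?_⟩
  · exact ⟨(glue_range hr hl P).1, (glue_range hr hl P).2.trans S.M_le⟩
  · have : Continuous y := (LipschitzWith.of_dist_le_mul (K := (Λe * (K + K')).toNNReal) fun a b => by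
      rw [Real.dist_eq, Real.dist_eq]
      exact (hlip b a).trans (mul_le_mul_of_nonneg_right (Real.le_coe_toNNReal _)
        (abs_nonneg _))).continuous
    exact (this.comp (by fun_prop : Continuous fun t : ℝ => max t 0)).measurable
  · simp only [max_eq_left hs, max_eq_left ht]; exact hlip s t
  · simp only [max_eq_left ht]; exact hy0 t
  · simp only [max_eq_left ht.le]
    exact S.glue_cone hξ hz hr har hl hal ht (hy0 t)

omit har hal in
lemma glue_var (t : ℝ) :
    eVariationOn (fun x => glue ur ul (t, x)) univ ≤ ENNReal.ofReal (2 * (2 * TV + 2 * M)) := by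
  refine eVariationOn_max_le (by linarith [S.TV_nonneg, S.M_nonneg]) (hr.box t).var ?_
  exact (eVariationOn.comp_le_of_antitoneOn (fun x => ul (t, x)) (t := univ) (s := univ)
    (fun x => -x) (fun x _ y _ h => neg_le_neg h) (mapsTo_univ _ _)).trans (hl.box t).var

end HughesData

/-- The two one-sided solutions issued from the balance point `ξ₀` of the initial datum. -/
structure SidePair (f e g H : ℝ → ℝ) (ρm V Λ m M L c₀ TV : ℝ) (ub : ℝ → ℝ)
    (ξ₀ B K B' K' : ℝ) (ur ul : ℝ × ℝ → ℝ) : Prop where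
  data : HughesData f e g H ρm V Λ m M L c₀ TV ub
  mem : ξ₀ ∈ Ioo (-1 : ℝ) 1
  bal_zero : bal (fun x => e (ub x)) ξ₀ = 0
  K_nonneg : 0 ≤ K
  K'_nonneg : 0 ≤ K'
  right : EvolSol f M (2 * TV + 2 * M) 1 B K ur
  right_init : ∀ᵐ x, ur (0, x) = (Ioo ξ₀ 1).indicator ub x
  left : EvolSol f M (2 * TV + 2 * M) 1 B' K' ul
  left_init : ∀ᵐ x, ul (0, x) = (Ioo (-ξ₀) 1).indicator (fun x => ub (-x)) x

lemma EvolSol.translate_le {f : ℝ → ℝ} {M W A B K : ℝ} {u : ℝ × ℝ → ℝ}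
    (h : EvolSol f M W A B K u) (hW : 0 ≤ W) (t a b : ℝ) :
    ∫ x, |u (t - a, x - b) - u (t, x)| ≤ K * |a| + W * |b| := by
  have i1 : Integrable fun x => |u (t - a, x - b) - u (t - a, x)| :=
    (((h.box _).integrable.comp_sub_right b).sub (h.box _).integrable).abs
  have i2 : Integrable fun x => |u (t - a, x) - u (t, x)| :=
    ((h.box _).integrable.sub (h.box _).integrable).abs
  have h1 := h.lip t (t - a)
  rw [show t - a - t = -a by ring, abs_neg] at h1
  have h2 := integral_translate_le (h.box (t - a)).var hW (-b)
  rw [abs_neg] at h2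
  have h3 : ∫ x, |u (t - a, x - b) - u (t, x)| ≤
      ∫ x, (|u (t - a, x - b) - u (t - a, x)| + |u (t - a, x) - u (t, x)|) :=
    integral_mono (((h.box _).integrable.comp_sub_right b).sub (h.box _).integrable).abs
      (i1.add i2) fun x => abs_sub_le _ _ _
  rw [integral_add i1 i2] at h3
  simp only [← sub_eq_add_neg] at h2
  linarith

lemma EvolSol.continuous_translate {f : ℝ → ℝ} {M W A B K : ℝ} {u : ℝ × ℝ → ℝ}
    (h : EvolSol f M W A B K u) (hW : 0 ≤ W) (hK : 0 ≤ K) (R ε : ℝ) (hε : 0 < ε) :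
    ∃ δ > 0, ∀ z : ℝ × ℝ, ‖z‖ < δ →
      ∫ P in Metric.closedBall (0 : ℝ × ℝ) R, |u (P - z) - u P| ≤ ε := by
  refine ⟨ε / (2 * |R| * (K + W) + 1), by positivity, fun z hz => ?_⟩
  have hb : BddMeas u := .of_range h.meas h.range
  have hm : Measurable fun P : ℝ × ℝ => |u (P - z) - u P| :=
    ((h.meas.comp (measurable_id.sub_const z)).sub h.meas).abs
  have hz1 : |z.1| ≤ ‖z‖ := norm_fst_le z
  have hz2 : |z.2| ≤ ‖z‖ := norm_snd_le z
  have hi : IntegrableOn (fun P : ℝ × ℝ => |u (P - z) - u P|)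
      (Icc (-R) R ×ˢ Icc (-R) R) := by
    refine Measure.integrableOn_of_bounded (M := M) ?_ hm.aestronglyMeasurable
      (Eventually.of_forall fun P => ?_)
    · exact (isCompact_Icc.prod isCompact_Icc).measure_ne_top
    · rw [Real.norm_eq_abs, abs_abs, abs_le]
      have h1 := h.range P
      have h2 := h.range (P - z)
      constructor <;> linarith [h1.1, h1.2, h2.1, h2.2]
  have hball : Metric.closedBall (0 : ℝ × ℝ) R = Icc (-R) R ×ˢ Icc (-R) R := by
    have : (0 : ℝ × ℝ) = (0, 0) := rfl
    rw [this, ← closedBall_prod_same, Real.closedBall_eq_Icc, zero_sub, zero_add]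
  rw [hball]
  rw [Measure.volume_eq_prod] at hi ⊢
  rw [setIntegral_prod _ hi]
  have hin : ∀ t ∈ Icc (-R) R, ∫ x in Icc (-R) R, |u ((t, x) - z) - u (t, x)| ≤
      K * |z.1| + W * |z.2| := fun t _ =>
    (setIntegral_le_integral (((h.box _).integrable.comp_sub_right z.2).sub
      (h.box t).integrable).abs (Eventually.of_forall fun _ => abs_nonneg _)).trans
      (h.translate_le hW t z.1 z.2)
  have h4 : ∫ t in Icc (-R) R, ∫ x in Icc (-R) R, |u ((t, x) - z) - u (t, x)| ≤
      ∫ t in Icc (-R) R, (K * |z.1| + W * |z.2|) :=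
    setIntegral_mono_on (by
      rw [IntegrableOn, ← Measure.prod_restrict] at hi
      exact hi.integral_prod_left) (by simp [integrableOn_const_iff]) measurableSet_Icc hin
  refine h4.trans ?_
  rw [setIntegral_const, smul_eq_mul, Measure.real, Real.volume_Icc]
  have h5 : (ENNReal.ofReal (R - -R)).toReal ≤ 2 * |R| := by
    rw [ENNReal.toReal_ofReal']
    exact max_le (by linarith [le_abs_self R]) (by positivity)
  have h6 : K * |z.1| + W * |z.2| ≤ (K + W) * ‖z‖ := by
    have := mul_le_mul_of_nonneg_left hz1 hK
    have := mul_le_mul_of_nonneg_left hz2 hW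
    linarith
  have h7 : ‖z‖ * (2 * |R| * (K + W) + 1) < ε := (lt_div_iff₀ (by positivity)).1 hz
  have h8 := mul_le_mul h5 h6 (by positivity) (by positivity)
  have := norm_nonneg z
  linarith

namespace SidePair
variable {f e g H : ℝ → ℝ} {ρm V Λ m M L c₀ TV : ℝ} {ub : ℝ → ℝ}
  {ξ₀ B K B' K' : ℝ} {ur ul : ℝ × ℝ → ℝ}

lemma swap (Q : SidePair f e g H ρm V Λ m M L c₀ TV ub ξ₀ B K B' K' ur ul) :
    SidePair f e g H ρm V Λ m M L c₀ TV (fun x => ub (-x)) (-ξ₀) B' K' B K ul ur where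
  data := Q.data.reflect
  mem := ⟨by linarith [Q.mem.2], by linarith [Q.mem.1]⟩
  bal_zero := Q.data.reflect_zero Q.bal_zero
  K_nonneg := Q.K'_nonneg
  K'_nonneg := Q.K_nonneg
  right := Q.left
  right_init := Q.left_init
  left := Q.right
  left_init := by simpa using Q.right_init

end SidePair

namespace HughesSol
variable {f e : ℝ → ℝ} {ρm V Λ : ℝ} {ub η : ℝ → ℝ} {p : ℝ × ℝ → ℝ}
  (h : HughesSol f e ρm ub η p) (hf : FluxOn f ρm V Λ)
include h hf

lemma weak_max {k : ℝ} (hk : k ∈ Icc 0 ρm) :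
    WeakIneq univ (fun P => max (p P) k - k) (fun P => side η P * (f (max (p P) k) - f k)) := by
  have hp := BddMeas.of_range h.meas h.range
  have hs := bddMeas_side h.meas_eta
  have b : ∀ k, BddMeas fun P => |p P - k| := fun k => (hp.sub (.const k)).abs
  have b' : ∀ k, BddMeas fun P => side η P * (kflux f (p P) k - f k) := fun k =>
    hs.mul ((hp.kflux hf.lip hf.meas (.const k)).sub (.const _))
  have h1 := (((h.entropy k hk).add (h.entropy 0 ⟨le_rfl, hf.pos⟩) (b k) (b' k) (b 0) (b' 0)).add
    (weakIneq_const univ (-k) 0) ((b k).add (b 0)) ((b' k).add (b' 0)) (.const _)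
    (.const _)).const_mul (a := 1 / 2) (by norm_num)
  refine h1.congr (fun P _ _ => ?_) (fun P _ _ => ?_)
  · have h0 := (h.range P).1
    rw [sub_zero, abs_of_nonneg h0]
    rcases le_total (p P) k with h | h
    · rw [max_eq_right h, abs_of_nonpos (by linarith)]; ring
    · rw [max_eq_left h, abs_of_nonneg (by linarith)]; ring
  · rw [kflux_of_le (h.range P).1, hf.zero]
    rcases le_total (p P) k with h | h
    · rw [max_eq_right h, kflux_of_ge h]; ring
    · rw [max_eq_left h, kflux_of_le h]; ring

lemma integral_max_le {k : ℝ} (hk : k ∈ Icc 0 ρm) {s t : ℝ} (hs : 0 ≤ s) (hst : s ≤ t) :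
    ∫ x, (max (p (t, x)) k - k) ≤ ∫ x, (max (p (s, x)) k - k) := by
  have hb : BddMeas (fun P => max (p P) k) := BddMeas.of_range (ρm := ρm)
    (h.meas.max measurable_const)
    fun P => ⟨(h.range P).1.trans (le_max_left _ _), max_le (h.range P).2 hk.2⟩
  refine WeakIneq.integral_le (D := fun P => max (p P) k - k)
    (q := fun P => side η P * (f (max (p P) k) - f k)) (Λ := Λ) (hb.sub (.const k))
    ((bddMeas_side h.meas_eta).mul ((hb.comp_lip hf).sub (.const _))) (fun P => ?_)
    (h.time.max_sub h.meas h.range hk.1) (h.weak_max hf hk) hs hst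
  rw [abs_mul]
  have h1 := mul_le_mul_of_nonneg_right (show |side η P| ≤ 1 from abs_sign_le_one _)
    (abs_nonneg (f (max (p P) k) - f k))
  have h2 := hf.lip (max (p P) k) k
  linarith

lemma mass_le {t : ℝ} (ht : 0 ≤ t) : ∫ x, p (t, x) ≤ ∫ x, ub x := by
  have h1 := h.integral_max_le hf (k := 0) ⟨le_rfl, hf.pos⟩ le_rfl ht
  have h2 : ∀ t x, max (p (t, x)) 0 - 0 = p (t, x) := fun t x => by
    rw [sub_zero, max_eq_left (h.range _).1]
  simp only [h2] at h1
  exact h1.trans_eq (integral_congr_ae h.init)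

lemma ae_le {M : ℝ} (hM : M ∈ Icc 0 ρm) (hub : ∀ x, ub x ≤ M) {t : ℝ} (ht : 0 ≤ t) :
    ∀ᵐ x, p (t, x) ≤ M := by
  have h1 := h.integral_max_le hf hM le_rfl ht
  have h2 : ∫ x, (max (p (0, x)) M - M) = 0 := by
    refine integral_eq_zero_of_ae ?_
    filter_upwards [h.init] with x hx
    rw [hx, max_eq_right (hub x), sub_self]; rfl
  have h0 : ∀ x, 0 ≤ max (p (t, x)) M - M := fun x => sub_nonneg.2 (le_max_right _ _)
  have h3 : ∫ x, (max (p (t, x)) M - M) = 0 :=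
    le_antisymm (h1.trans_eq h2) (integral_nonneg h0)
  have h4 := (integral_eq_zero_iff_of_nonneg h0
    ((h.time.max_sub h.meas h.range hM.1).int t ht)).1 h3
  filter_upwards [h4] with x hx
  have : max (p (t, x)) M - M = 0 := hx
  linarith [le_max_left (p (t, x)) M]

end HughesSol

lemma TimeL1.integral_Ioi_le_init {D : ℝ × ℝ → ℝ} (h : TimeL1 D) {α κ N t : ℝ} (hκ : 0 ≤ κ)
    (ht : 0 < t) (h0 : ∀ᵐ x, -N ≤ D (0, x))
    (hmon : ∀ s, 0 < s → s ≤ t →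
      ∫ x in Ioi (α + κ * t), D (t, x) ≤ ∫ x in Ioi (α + κ * s), D (s, x)) :
    ∫ x in Ioi (α + κ * t), D (t, x) ≤ ∫ x in Ioi α, D (0, x) := by
  have hkey : ∀ s, 0 < s → s ≤ t → ∫ x in Ioi (α + κ * t), D (t, x) ≤
      (∫ x in Ioi α, D (0, x)) + N * (κ * s) + ∫ x, |D (s, x) - D (0, x)| := fun s hs hst => by
    have i0 := h.int 0 le_rfl
    have is := h.int s hs.le
    have hαs : α ≤ α + κ * s := by have := mul_nonneg hκ hs.le; linarith
    have h1 : ∫ x in Ioi (α + κ * s), D (s, x) ≤ (∫ x in Ioi (α + κ * s), D (0, x)) +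
        ∫ x, |D (s, x) - D (0, x)| := by
      have h2 : (∫ x in Ioi (α + κ * s), D (s, x)) - (∫ x in Ioi (α + κ * s), D (0, x)) ≤
          ∫ x in Ioi (α + κ * s), |D (s, x) - D (0, x)| := by
        rw [← integral_sub is.integrableOn i0.integrableOn]
        exact integral_mono (is.sub i0).integrableOn (is.sub i0).abs.integrableOn
          fun x => le_abs_self _
      have h3 : ∫ x in Ioi (α + κ * s), |D (s, x) - D (0, x)| ≤ ∫ x, |D (s, x) - D (0, x)| :=
        setIntegral_le_integral (is.sub i0).abs (Eventually.of_forall fun _ => abs_nonneg _)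
      linarith
    have h4 : (∫ x in Ioi α, D (0, x)) =
        (∫ x in Ioc α (α + κ * s), D (0, x)) + ∫ x in Ioi (α + κ * s), D (0, x) := by
      rw [← setIntegral_union (Ioc_disjoint_Ioi le_rfl) measurableSet_Ioi i0.integrableOn
        i0.integrableOn, Ioc_union_Ioi_eq_Ioi hαs]
    have h5 : -(N * (κ * s)) ≤ ∫ x in Ioc α (α + κ * s), D (0, x) := by
      have h6 : ∫ x in Ioc α (α + κ * s), -N ≤ ∫ x in Ioc α (α + κ * s), D (0, x) :=
        integral_mono_ae (by simp) i0.integrableOn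
          (ae_restrict_of_ae h0)
      rw [setIntegral_const, Measure.real, Real.volume_Ioc, ENNReal.toReal_ofReal (by linarith),
        smul_eq_mul] at h6
      linarith
    have := hmon s hs hst
    linarith
  have hlim : Tendsto (fun s => (∫ x in Ioi α, D (0, x)) + N * (κ * s) +
      ∫ x, |D (s, x) - D (0, x)|) (nhdsWithin 0 (Ioi 0)) (nhds ((∫ x in Ioi α, D (0, x)) +
        N * (κ * 0) + 0)) := by
    refine (Tendsto.mono_left ?_ nhdsWithin_le_nhds).add
      ((h.cont 0 le_rfl).mono_left (nhdsWithin_mono _ Ioi_subset_Ici_self))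
    exact Continuous.tendsto (by fun_prop) 0
  rw [mul_zero, mul_zero, add_zero, add_zero] at hlim
  refine ge_of_tendsto hlim ?_
  filter_upwards [Ioc_mem_nhdsGT ht] with s hs using hkey s hs.1 hs.2

lemma ae_imp_zero_of_setIntegral_nonpos {D : ℝ → ℝ} (hD : Integrable D) (h0 : ∀ᵐ x, 0 ≤ D x)
    {S : Set ℝ} (hS : MeasurableSet S) (h : ∫ x in S, D x ≤ 0) : ∀ᵐ x, x ∈ S → D x = 0 := by
  have h0' : 0 ≤ᵐ[volume.restrict S] D := ae_restrict_of_ae h0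
  have h1 := (setIntegral_eq_zero_iff_of_nonneg_ae h0' hD.integrableOn).1
    (le_antisymm h (integral_nonneg_of_ae h0'))
  rwa [Filter.EventuallyEq, ae_restrict_iff' hS] at h1

namespace HughesData
variable {f e g H : ℝ → ℝ} {ρm V Λ m M L c₀ TV : ℝ} {ub : ℝ → ℝ}
  (S : HughesData f e g H ρm V Λ m M L c₀ TV ub)
include S

lemma cost_zero : e 0 = 0 := S.cost.zero

lemma integrable_comp {w : ℝ → ℝ} (hw : Integrable w) : Integrable fun x => e (w x) := by
  obtain ⟨Λe, hΛ⟩ := S.cost_lip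
  refine (hw.abs.const_mul Λe).mono' (S.cost.meas.comp_aemeasurable
    hw.aemeasurable).aestronglyMeasurable (Eventually.of_forall fun x => ?_)
  have := hΛ (w x) 0
  rwa [S.cost_zero, sub_zero, sub_zero] at this

end HughesData

namespace HughesSol
variable {f e g H : ℝ → ℝ} {ρm V Λ m M L c₀ TV : ℝ} {ub η : ℝ → ℝ} {p : ℝ × ℝ → ℝ}
  {ξ₀ B K B' K' : ℝ} {ur ul : ℝ × ℝ → ℝ}

lemma eta_eq_of_ae (h : HughesSol f e ρm ub η p)
    (S : HughesData f e g H ρm V Λ m M L c₀ TV ub) {w : ℝ → ℝ} {y t : ℝ} (ht : 0 ≤ t)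
    (hw : ∀ᵐ x, p (t, x) = w x) (hy : y ∈ Ioo (-1 : ℝ) 1)
    (hb : bal (fun x => e (w x)) y = 0) : η t = y := by
  have i1 := h.time.int t ht
  have i2 : Integrable w := i1.congr hw
  have h1 := bal_zero_dist (S.integrable_comp i1) (S.integrable_comp i2)
    (fun x => S.cost_nonneg _) (Ioo_subset_Icc_self hy) (h.balance t ht) hb
  have h2 : ∫ x, |e (p (t, x)) - e (w x)| = 0 := by
    refine integral_eq_zero_of_ae ?_
    filter_upwards [hw] with x hx
    rw [hx, sub_self, abs_zero]; rfl
  have h3 : |y - η t| ≤ 0 := by linarith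
  linarith [abs_nonpos_iff.1 h3]

lemma kruzhkov_right (h : HughesSol f e ρm ub η p) (hf : FluxOn f ρm V Λ) {α κ s : ℝ} (hs : 0 < s)
    (hη : ∀ t, 0 < t → η t ≤ α + κ * t) :
    KruzhkovOn f ρm {P | s < P.1 ∧ α + κ * P.1 < P.2} p := fun k hk => by
  have hp := BddMeas.of_range h.meas h.range
  have h1 : WeakIneq {P : ℝ × ℝ | s < P.1 ∧ α + κ * P.1 < P.2} (fun P => |p P - k|)
      (fun P => kflux f (p P) k - f k) :=
    ((h.entropy k hk).mono (subset_univ _)).congr (fun _ _ _ => rfl) fun P hP h0 => by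
      have : side η P = 1 := Real.sign_of_pos (by
        have := hη P.1 h0
        linarith [hP.2])
      rw [this, one_mul]
  refine (h1.add (weakIneq_const _ 0 (f k)) (hp.sub (.const k)).abs
    ((hp.kflux hf.lip hf.meas (.const k)).sub (.const _)) (.const _) (.const _)).congr
    (fun _ _ _ => by ring) fun _ _ _ => by ring

lemma compare_right (h : HughesSol f e ρm ub η p)
    (Q : SidePair f e g H ρm V Λ m M L c₀ TV ub ξ₀ B K B' K' ur ul) {κ : ℝ} (hκ : 0 ≤ κ)
    (hη : ∀ t, 0 < t → η t ≤ ξ₀ + κ * t)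
    (hs : ∀ s, 0 < s → ∃ δ > 0, ∀ᵐ P : ℝ × ℝ, s < P.1 → ξ₀ + κ * P.1 < P.2 →
      P.2 < ξ₀ + κ * P.1 + δ → kflux f (p P) (ur P) ≤ κ * |p P - ur P|) {t : ℝ} (ht : 0 < t) :
    ∀ᵐ x, ξ₀ + κ * t < x → p (t, x) = ur (t, x) := by
  have hf := Q.data.flux
  have hW : 0 ≤ 2 * TV + 2 * M := by linarith [Q.data.M_nonneg, Q.data.TV_nonneg]
  have hr := Q.right.range' Q.data.M_le
  have hp := BddMeas.of_range h.meas h.range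
  have hu := BddMeas.of_range Q.right.meas hr
  have hT : TimeL1 fun P => |p P - ur P| := h.time.abs_sub Q.right.timeL1
  have h1 := hT.integral_Ioi_le_init (α := ξ₀) (N := 0) hκ ht (Eventually.of_forall fun x => by
    rw [neg_zero]; exact abs_nonneg _) fun s hs0 hst => by
      obtain ⟨δ, hδ, hsgn⟩ := hs (s / 2) (half_pos hs0)
      refine WeakIneq.integral_Ioi_le (q := fun P => kflux f (p P) (ur P)) (Λ := Λ) (s0 := s / 2)
        (hp.sub hu).abs (hp.kflux hf.lip hf.meas hu) (fun P => ?_) hT (half_pos hs0).le hδ ?_ hsgn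
        (by linarith) hst
      · rw [abs_abs]; exact abs_kflux_le hf.lip _ _
      · exact KruzhkovOn.doubling hf.lip_nonneg hf.lip hf.meas h.meas Q.right.meas h.range hr
          (half_pos hs0) (fun P hP => hP.1.le) (h.kruzhkov_right hf (half_pos hs0) hη)
          Q.right.kruzhkovOn (Q.right.continuous_translate hW Q.K_nonneg)
  have h2 : ∫ x in Ioi ξ₀, |p (0, x) - ur (0, x)| = 0 := by
    refine integral_eq_zero_of_ae ?_
    rw [Filter.EventuallyEq, ae_restrict_iff' measurableSet_Ioi]
    filter_upwards [h.init, Q.right_init] with x h1 h2 hx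
    have : (Ioo ξ₀ 1).indicator ub x = ub x := by
      by_cases hx1 : x < 1
      · rw [indicator_of_mem (show x ∈ Ioo ξ₀ 1 from ⟨hx, hx1⟩)]
      · rw [indicator_of_notMem fun h => hx1 h.2, Q.data.zero _ fun h => hx1 h.2]
    rw [h1, h2, this, sub_self, abs_zero]; rfl
  have h3 := ae_imp_zero_of_setIntegral_nonpos (hT.int t ht.le)
    (Eventually.of_forall fun x => abs_nonneg _) measurableSet_Ioi (h1.trans_eq h2)
  filter_upwards [h3] with x hx hx1
  linarith [abs_eq_zero.1 (hx hx1)]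

lemma init_eta (h : HughesSol f e ρm ub η p)
    (Q : SidePair f e g H ρm V Λ m M L c₀ TV ub ξ₀ B K B' K' ur ul) : η 0 = ξ₀ :=
  h.eta_eq_of_ae Q.data le_rfl h.init Q.mem Q.bal_zero

lemma ae_le_data (h : HughesSol f e ρm ub η p)
    (S : HughesData f e g H ρm V Λ m M L c₀ TV ub) {t : ℝ} (ht : 0 ≤ t) :
    ∀ᵐ x, p (t, x) ≤ M :=
  h.ae_le S.flux ⟨S.M_nonneg, S.M_le⟩ (fun x => (S.range x).2) ht

/-- Mass on the right of a line of slope at most `m` starting at the initial turning point is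
conserved. -/
lemma mass_right (h : HughesSol f e ρm ub η p)
    (S : HughesData f e g H ρm V Λ m M L c₀ TV ub)
    (hη : ∀ t, 0 < t → η t ≤ ξ₀ + m * t) {t : ℝ} (ht : 0 < t) :
    ∫ x in Ioi ξ₀, ub x ≤ ∫ x in Ioi (ξ₀ + m * t), p (t, x) := by
  have hf := S.flux
  have hp := BddMeas.of_range h.meas h.range
  have hT : TimeL1 fun P => -p P := h.time.neg
  have hM : ∀ᵐ P : ℝ × ℝ, 0 < P.1 → p P ≤ M := by
    refine ae_prod_of_forall_ae (measurableSet_setOf_imp (measurableSet_lt measurable_const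
      measurable_fst) (measurableSet_le h.meas measurable_const)) fun t => ?_
    by_cases ht : 0 < t
    · filter_upwards [h.ae_le_data S ht.le] with x hx _ using hx
    · exact Eventually.of_forall fun x h => absurd h ht
  have h1 := hT.integral_Ioi_le_init (α := ξ₀) (N := M) S.m_pos.le ht (by
    filter_upwards [h.ae_le_data S le_rfl] with x hx using neg_le_neg hx) fun s hs0 hst => by
      refine WeakIneq.integral_Ioi_le (q := fun P => -f (p P)) (Λ := Λ) (s0 := s / 2) (δ := 1)
        hp.neg (hp.comp_lip hf).neg (fun P => ?_) hT (half_pos hs0).le one_pos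
        ((h.kruzhkov_right hf (half_pos hs0) hη).weak_neg hf h.meas h.range) ?_
        (by linarith) hst
      · rw [abs_neg, abs_neg]; exact hf.abs_le _
      · filter_upwards [hM] with P hP h1 _ _
        have := S.slope (p P) ⟨(h.range P).1, hP ((half_pos hs0).trans h1)⟩
        linarith
  rw [integral_neg, integral_neg] at h1
  have h2 : ∫ x in Ioi ξ₀, p (0, x) = ∫ x in Ioi ξ₀, ub x :=
    integral_congr_ae (ae_restrict_of_ae h.init)
  linarith

/-- No mass survives in the cone of slope `m` issued from the initial turning point. -/
lemma cone_zero (h : HughesSol f e ρm ub η p)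
    (S : HughesData f e g H ρm V Λ m M L c₀ TV ub)
    (hη : ∀ t, 0 < t → |η t - ξ₀| ≤ m * t) {t : ℝ} (ht : 0 < t) :
    ∀ᵐ x, |x - ξ₀| < m * t → p (t, x) = 0 := by
  have h1 := h.mass_right S (ξ₀ := ξ₀) (fun t ht => by linarith [(abs_le.1 (hη t ht)).2]) ht
  have h2 := h.reflect.mass_right S.reflect (ξ₀ := -ξ₀)
    (fun t ht => by linarith [(abs_le.1 (hη t ht)).1]) ht
  have h3 := h.mass_le S.flux ht.le
  have hmt := mul_pos S.m_pos ht
  have ip := h.time.int t ht.le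
  have ib : Integrable ub := (h.time.int 0 le_rfl).congr h.init
  have e1 : ∫ x in Ioi (-ξ₀), ub (-x) = ∫ x in Iic ξ₀, ub x := by
    simp
  have e2 : ∫ x in Ioi (-ξ₀ + m * t), p (reflX (t, x)) = ∫ x in Iic (ξ₀ - m * t), p (t, x) := by
    have := integral_comp_neg_Ioi (-ξ₀ + m * t) fun x => p (t, x)
    rw [show -(-ξ₀ + m * t) = ξ₀ - m * t by ring] at this
    exact this
  rw [e1, e2] at h2
  have e3 : ∫ x, ub x = (∫ x in Iic ξ₀, ub x) + ∫ x in Ioi ξ₀, ub x :=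
    (intervalIntegral.integral_Iic_add_Ioi ib.integrableOn ib.integrableOn).symm
  have e4 : ∫ x, p (t, x) = (∫ x in Iic (ξ₀ + m * t), p (t, x)) +
      ∫ x in Ioi (ξ₀ + m * t), p (t, x) :=
    (intervalIntegral.integral_Iic_add_Ioi ip.integrableOn ip.integrableOn).symm
  have e5 : ∫ x in Iic (ξ₀ + m * t), p (t, x) = (∫ x in Iic (ξ₀ - m * t), p (t, x)) +
      ∫ x in Ioc (ξ₀ - m * t) (ξ₀ + m * t), p (t, x) := by
    rw [← setIntegral_union (Iic_disjoint_Ioc le_rfl) measurableSet_Ioc ip.integrableOn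
      ip.integrableOn, Iic_union_Ioc_eq_Iic (by linarith)]
  have h4 := ae_imp_zero_of_setIntegral_nonpos ip (Eventually.of_forall fun x => (h.range _).1)
    (measurableSet_Ioc (a := ξ₀ - m * t) (b := ξ₀ + m * t)) (by linarith)
  filter_upwards [h4] with x hx hx1
  have := abs_lt.1 hx1
  exact hx ⟨by linarith [this.1], by linarith [this.2]⟩

end HughesSol

namespace HughesSol
variable {f e g H : ℝ → ℝ} {ρm V Λ m M L c₀ TV : ℝ} {ub η : ℝ → ℝ} {p : ℝ × ℝ → ℝ}
  {ξ₀ B K B' K' : ℝ} {ur ul : ℝ × ℝ → ℝ}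

section cost
variable (h : HughesSol f e ρm ub η p)
  (Q : SidePair f e g H ρm V Λ m M L c₀ TV ub ξ₀ B K B' K' ur ul)
  {κ y t : ℝ} (hκ : V ≤ κ) (hη : ∀ t, 0 < t → |η t - ξ₀| ≤ κ * t) (ht : 0 < t)
include h Q hκ hη ht

lemma eq_right_fast : ∀ᵐ x, ξ₀ + κ * t < x → p (t, x) = ur (t, x) := by
  refine h.compare_right Q (Q.data.V_pos.le.trans hκ)
    (fun t ht => by linarith [(abs_le.1 (hη t ht)).2]) (fun s _ => ⟨1, one_pos,
      Eventually.of_forall fun P _ _ _ => ?_⟩) ht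
  exact (Q.data.flux.kflux_le _ _).trans (mul_le_mul_of_nonneg_right hκ (abs_nonneg _))

lemma right_cost (hy : y ≤ ξ₀ + κ * t) (hy1 : y ≤ 1) :
    ∫ x in y..1, e (p (t, x)) =
      (∫ x in y..min 1 (ξ₀ + κ * t), e (p (t, x))) +
        ∫ x in (min 1 (ξ₀ + κ * t))..1, e (ur (t, x)) := by
  have ip : Integrable fun x => e (p (t, x)) := Q.data.integrable_comp (h.time.int t ht.le)
  rw [← intervalIntegral.integral_add_adjacent_intervals (b := min 1 (ξ₀ + κ * t))
    ip.intervalIntegrable ip.intervalIntegrable]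
  congr 1
  refine intervalIntegral.integral_congr_ae ?_
  filter_upwards [h.eq_right_fast Q hκ hη ht] with x hx hx1
  rw [uIoc_of_le (min_le_left _ _)] at hx1
  have h1 : ξ₀ + κ * t < x := by
    rcases min_lt_iff.1 hx1.1 with h | h
    · exact absurd hx1.2 h.not_ge
    · exact h
  simp only [hx h1]

lemma right_cost_le (hy : y ≤ ξ₀ + κ * t) (hy1 : y ≤ 1) :
    ∫ x in y..1, e (p (t, x)) ≤ e M * (ξ₀ + κ * t - y) + ∫ x in ξ₀..1, e (ub x) := by
  have ip : Integrable fun x => e (p (t, x)) := Q.data.integrable_comp (h.time.int t ht.le)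
  have hθ := Q.data.cost.top_nonneg
  rw [h.right_cost Q hκ hη ht hy hy1]
  refine add_le_add ?_ (Q.data.side_upper Q.right Q.right_init Q.mem (min_le_left _ _) ht.le)
  have h1 : ∫ x in y..min 1 (ξ₀ + κ * t), e (p (t, x)) ≤
      ∫ _ in y..min 1 (ξ₀ + κ * t), e M := by
    refine intervalIntegral.integral_mono_ae (le_min hy1 hy) ip.intervalIntegrable
      intervalIntegrable_const ?_
    filter_upwards [h.ae_le_data Q.data ht.le] with x hx
    exact (Q.data.cost.mem ⟨(h.range _).1, hx⟩).2
  rw [intervalIntegral.integral_const, smul_eq_mul] at h1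
  have h2 := mul_le_mul_of_nonneg_left (min_le_right 1 (ξ₀ + κ * t)) hθ
  linarith

lemma right_cost_ge (hy : y ≤ ξ₀ + κ * t) (hy1 : y ≤ 1) :
    (∫ x in ξ₀..1, e (ub x)) - V * t * (H M + e M + L * TV) - e M * (κ * t) ≤
      ∫ x in y..1, e (p (t, x)) := by
  have hθ := Q.data.cost.top_nonneg
  rw [h.right_cost Q hκ hη ht hy hy1]
  have h0 : 0 ≤ ∫ x in y..min 1 (ξ₀ + κ * t), e (p (t, x)) :=
    intervalIntegral.integral_nonneg_of_forall (le_min hy1 hy) fun x => Q.data.cost_nonneg _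
  have hκt : 0 ≤ κ * t := mul_nonneg (Q.data.V_pos.le.trans hκ) ht.le
  have h1 := Q.data.side_lower Q.right Q.right_init Q.mem (b := min 1 (ξ₀ + κ * t))
    (le_min Q.mem.2.le (by linarith)) (min_le_left _ _) ht.le
  have h2 := mul_le_mul_of_nonneg_left (min_le_right 1 (ξ₀ + κ * t)) hθ
  linarith

lemma eta_sub_le : (2 + e M) * (η t - ξ₀) ≤
    (V * (H M + e M + L * TV) + 2 * e M * κ) * t := by
  have hc := abs_le.1 (hη t ht)
  have hm := h.mem t
  have h1 := h.right_cost_le Q hκ hη ht (y := η t) (by linarith [hc.2]) hm.2.le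
  have h2 := h.reflect.right_cost_ge Q.swap hκ (fun t ht => by
    rw [neg_sub_neg, abs_sub_comm]; exact hη t ht) ht (y := -η t) (by linarith [hc.1])
    (by linarith [hm.1])
  have e1 := Q.data.integral_cost_reflect ξ₀
  have e2 : ∫ x in -η t..1, e (p (reflX (t, x))) = ∫ x in (-1 : ℝ)..η t, e (p (t, x)) := by
    have := intervalIntegral.integral_comp_neg (a := -η t) (b := 1) (fun x => e (p (t, x)))
    rw [neg_neg] at this
    exact this
  rw [e1, e2] at h2
  have b1 := h.balance t ht.le
  have b2 := Q.bal_zero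
  simp only [bal] at b1 b2
  linarith

end cost

lemma abs_eta_sub_le (h : HughesSol f e ρm ub η p)
    (Q : SidePair f e g H ρm V Λ m M L c₀ TV ub ξ₀ B K B' K' ur ul)
    {κ t : ℝ} (hκ : V ≤ κ) (hη : ∀ t, 0 < t → |η t - ξ₀| ≤ κ * t) (ht : 0 < t) :
    (2 + e M) * |η t - ξ₀| ≤ (V * (H M + e M + L * TV) + 2 * e M * κ) * t := by
  have h1 := h.eta_sub_le Q hκ hη ht
  have h2 := h.reflect.eta_sub_le Q.swap hκ (fun t ht => by
    rw [neg_sub_neg, abs_sub_comm]; exact hη t ht) ht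
  rcases abs_choice (η t - ξ₀) with h3 | h3 <;> rw [h3]
  · exact h1
  · rwa [neg_sub_neg, ← neg_sub] at h2

/-- The turning curve stays in a cone that is strictly slower than the slowest pedestrians. -/
lemma exists_cone (h : HughesSol f e ρm ub η p)
    (Q : SidePair f e g H ρm V Λ m M L c₀ TV ub ξ₀ B K B' K' ur ul) :
    ∃ κ, 0 ≤ κ ∧ κ < m ∧ ∀ t, 0 < t → |η t - ξ₀| ≤ κ * t := by
  set T : Set ℝ := (fun t => |η t - ξ₀| / t) '' Ioi 0 with hT
  obtain ⟨q, hq⟩ := h.lip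
  have h0 := h.init_eta Q
  have hbdd : BddAbove T := by
    refine ⟨q, ?_⟩
    rintro _ ⟨t, ht, rfl⟩
    have ht' : 0 < t := ht
    have := hq 0 t le_rfl ht'.le
    rw [h0, sub_zero, abs_of_pos ht'] at this
    exact (div_le_iff₀ ht').2 this
  have hne : T.Nonempty := ⟨_, 1, mem_Ioi.2 one_pos, rfl⟩
  set κ := sSup T with hκ
  have hle : ∀ t, 0 < t → |η t - ξ₀| ≤ κ * t := fun t ht =>
    (div_le_iff₀ ht).1 (le_csSup hbdd ⟨t, ht, rfl⟩)
  have hκ0 : 0 ≤ κ := by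
    have := (abs_nonneg _).trans (hle 1 one_pos)
    linarith
  have hθ := Q.data.cost.top_nonneg
  have hH := Q.data.cost.dual.H_nonneg Q.data.cost.dual.top_mem
  have hLT := mul_nonneg Q.data.cost.dual.L_nonneg Q.data.TV_nonneg
  have hV := Q.data.V_pos
  have hsm := Q.data.small
  have hml := Q.data.m_le
  have key : ∀ κ', V ≤ κ' → κ ≤ κ' →
      (2 + e M) * κ ≤ V * (H M + e M + L * TV) + 2 * e M * κ' := fun κ' h1 h2 => by
    rw [mul_comm, ← le_div_iff₀ (by linarith)]
    refine csSup_le hne ?_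
    rintro _ ⟨t, ht, rfl⟩
    have ht' : 0 < t := ht
    have := h.abs_eta_sub_le Q h1 (fun t ht => (hle t ht).trans
      (mul_le_mul_of_nonneg_right h2 ht.le)) ht'
    rw [div_le_iff₀ ht', div_mul_eq_mul_div, le_div_iff₀ (by linarith), mul_comm]
    exact this
  refine ⟨κ, hκ0, ?_, hle⟩
  have hVH := mul_nonneg hV.le hH
  have hVθ := mul_nonneg hV.le hθ
  have hVL := mul_nonneg hV.le hLT
  rcases le_or_gt V κ with hVκ | hVκ
  · exfalso
    have h1 := key κ hVκ le_rfl
    have h2 : 3 * (H M + e M) + L * TV < 2 := by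
      have : V * (3 * (H M + e M) + L * TV) < V * 2 := by linarith
      exact lt_of_mul_lt_mul_left this hV.le
    have h3 : (2 - e M) * V ≤ (2 - e M) * κ :=
      mul_le_mul_of_nonneg_left hVκ (by linarith)
    have h4 : V * (3 * (H M + e M) + L * TV) < V * 2 := by linarith
    nlinarith
  · have h1 := key V le_rfl hVκ.le
    have h2 := mul_nonneg hθ hκ0
    nlinarith

lemma eq_right (h : HughesSol f e ρm ub η p)
    (Q : SidePair f e g H ρm V Λ m M L c₀ TV ub ξ₀ B K B' K' ur ul) {κ t : ℝ} (hκ : 0 ≤ κ)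
    (hκm : κ < m) (hη : ∀ t, 0 < t → |η t - ξ₀| ≤ κ * t) (ht : 0 < t) :
    ∀ᵐ x, ξ₀ + κ * t < x → p (t, x) = ur (t, x) := by
  have hηm : ∀ t, 0 < t → |η t - ξ₀| ≤ m * t := fun t ht =>
    (hη t ht).trans (mul_le_mul_of_nonneg_right hκm.le ht.le)
  have hz : ∀ᵐ P : ℝ × ℝ, 0 < P.1 → |P.2 - ξ₀| < m * P.1 → p P = 0 := by
    refine ae_prod_of_forall_ae (measurableSet_setOf_imp (measurableSet_lt (by fun_prop)
      (by fun_prop)) (measurableSet_setOf_imp (measurableSet_lt (by fun_prop) (by fun_prop))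
      (measurableSet_setOf_eq_fun h.meas measurable_const))) fun t => ?_
    by_cases ht : 0 < t
    · filter_upwards [h.cone_zero Q.data hηm ht] with x hx _ using hx
    · exact Eventually.of_forall fun x h => absurd h ht
  refine h.compare_right Q hκ (fun t ht => by linarith [(abs_le.1 (hη t ht)).2])
    (fun s hs => ⟨(m - κ) * s, mul_pos (by linarith) hs, ?_⟩) ht
  filter_upwards [hz, Q.data.ae_right_zero Q.right Q.right_init] with P h1 h2 h3 h4 h5
  have hP : 0 < P.1 := hs.trans h3
  have h6 : (m - κ) * s ≤ (m - κ) * P.1 := mul_le_mul_of_nonneg_left h3.le (by linarith)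
  have h7 : P.2 < ξ₀ + m * P.1 := by linarith
  have h8 := mul_nonneg hκ hP.le
  rw [h1 hP (abs_lt.2 ⟨by linarith, by linarith⟩), h2 hP h7, kflux_self, sub_zero, abs_zero,
    mul_zero]

lemma eq_glue (h : HughesSol f e ρm ub η p)
    (Q : SidePair f e g H ρm V Λ m M L c₀ TV ub ξ₀ B K B' K' ur ul) {t : ℝ} (ht : 0 < t) :
    ∀ᵐ x, p (t, x) = glue ur ul (t, x) := by
  obtain ⟨κ, hκ, hκm, hη⟩ := h.exists_cone Q
  have hκt : κ * t < m * t := mul_lt_mul_of_pos_right hκm ht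
  have h1 := h.eq_right Q hκ hκm hη ht
  have h2 := ae_neg (h.reflect.eq_right Q.swap hκ hκm (fun t ht => by
    rw [neg_sub_neg, abs_sub_comm]; exact hη t ht) ht)
  have h3 := h.cone_zero Q.data (fun t ht =>
    (hη t ht).trans (mul_le_mul_of_nonneg_right hκm.le ht.le)) ht
  filter_upwards [h1, h2, h3, Q.data.glue_right Q.right Q.right_init Q.left Q.left_init ht.le,
    Q.data.glue_left Q.right Q.right_init Q.left Q.left_init ht.le,
    Q.data.side_zero_left Q.right Q.right_init ht.le] with x h1 h2 h3 h4 h5 h6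
  rcases lt_or_ge (ξ₀ + κ * t) x with hx | hx
  · rw [h1 hx, h4 (by linarith [mul_nonneg hκ ht.le, mul_pos Q.data.m_pos ht])]
  rcases lt_or_ge x (ξ₀ - κ * t) with hx' | hx'
  · have := h2 (by linarith)
    simp only [reflX, neg_neg] at this
    rw [this, h5 (by linarith [mul_nonneg hκ ht.le, mul_pos Q.data.m_pos ht])]
  · rw [h3 (abs_lt.2 ⟨by linarith, by linarith⟩), h4 (by linarith), h6 (by linarith)]

end HughesSol

/-- Well-posedness of the normalised problem. -/
theorem HughesData.exists_unique {f e g H : ℝ → ℝ} {ρm V Λ m M L c₀ TV : ℝ} {ub : ℝ → ℝ}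
    (S : HughesData f e g H ρm V Λ m M L c₀ TV ub) :
    ∃ η p, HughesSol f e ρm ub η p ∧
      (∀ t, eVariationOn (fun x => p (t, x)) univ ≤ ENNReal.ofReal (2 * (2 * TV + 2 * M))) ∧
      ∀ η' p', HughesSol f e ρm ub η' p' →
        (∀ t, 0 ≤ t → η' t = η t) ∧ ∀ t, 0 < t → ∀ᵐ x, p' (t, x) = p (t, x) := by
  have hub : Integrable ub := S.box.integrable
  obtain ⟨ξ₀, hξ, hz⟩ := exists_bal_eq_zero (S.integrable_comp hub) fun x => S.cost_nonneg _
  obtain ⟨B, K, -, hK, ur, hr, har⟩ := S.exists_side hξ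
  obtain ⟨B', K', -, hK', ul, hl, hal⟩ := S.reflect.exists_side (a := -ξ₀)
    ⟨by linarith [hξ.2], by linarith [hξ.1]⟩
  have Q : SidePair f e g H ρm V Λ m M L c₀ TV ub ξ₀ B K B' K' ur ul :=
    ⟨S, hξ, hz, hK, hK', hr, har, hl, hal⟩
  obtain ⟨η, h⟩ := S.exists_glue_sol hξ hz hr har hl hal
  refine ⟨η, _, h, S.glue_var hr hl, fun η' p' h' => ⟨fun t ht => ?_, fun t ht => h'.eq_glue Q ht⟩⟩
  rcases ht.eq_or_lt with rfl | ht
  · rw [h'.init_eta Q, h.init_eta Q]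
  · exact h'.eta_eq_of_ae S ht.le (h'.eq_glue Q ht) (h.mem t) (h.balance t ht.le)

/-- Projection of the real line onto `[0, R]`. -/
def clamp (R r : ℝ) : ℝ := max 0 (min r R)

lemma clamp_mem {R : ℝ} (hR : 0 ≤ R) (r : ℝ) : clamp R r ∈ Icc 0 R :=
  ⟨le_max_left _ _, max_le hR (min_le_right _ _)⟩

lemma clamp_of_mem {R r : ℝ} (h : r ∈ Icc 0 R) : clamp R r = r := by
  rw [clamp, min_eq_left h.2, max_eq_right h.1]

lemma continuous_clamp (R : ℝ) : Continuous (clamp R) := by unfold clamp; fun_prop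

lemma clamp_mono (R : ℝ) : Monotone (clamp R) := fun _ _ h =>
  max_le_max le_rfl (min_le_min h le_rfl)

lemma abs_clamp_sub_le (R a b : ℝ) : |clamp R a - clamp R b| ≤ |a - b| := by
  have h1 := abs_max_sub_max_le_max 0 (min a R) 0 (min b R)
  have h2 := abs_min_sub_min_le_max a R b R
  rw [sub_self, abs_zero, max_eq_right (abs_nonneg (min a R - min b R))] at h1
  rw [sub_self, abs_zero, max_eq_left (abs_nonneg (a - b))] at h2
  exact h1.trans h2

lemma lip_comp_clamp {h h' : ℝ → ℝ} {R : ℝ} (hR : 0 ≤ R)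
    (hd : ∀ x ∈ Icc 0 R, HasDerivWithinAt h (h' x) (Icc 0 R) x) (hc : ContinuousOn h' (Icc 0 R)) :
    ∃ Λ, 0 ≤ Λ ∧ ∀ a b, |h (clamp R a) - h (clamp R b)| ≤ Λ * |a - b| := by
  obtain ⟨Λ, hΛ⟩ := isCompact_Icc.exists_bound_of_continuousOn hc
  have hΛ0 : 0 ≤ Λ := (norm_nonneg _).trans (hΛ 0 ⟨le_rfl, hR⟩)
  refine ⟨Λ, hΛ0, fun a b => ?_⟩
  have := (convex_Icc 0 R).norm_image_sub_le_of_norm_hasDerivWithin_le hd hΛ (clamp_mem hR b)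
    (clamp_mem hR a)
  exact this.trans (mul_le_mul_of_nonneg_left (abs_clamp_sub_le R a b) hΛ0)

/-- The flux extended to the real line by projecting the density. -/
def clampFlux (v : ℝ → ℝ) (R r : ℝ) : ℝ := hughesFlux v (clamp R r)

namespace SpeedH2
variable {ρmax vmax : ℝ} {v v' : ℝ → ℝ} (hv : SpeedH2 ρmax vmax v v') (hρ : 0 < ρmax)
include hv hρ

lemma exists_fluxOn : ∃ Λ, FluxOn (clampFlux v ρmax) ρmax vmax Λ := by
  obtain ⟨Λ, hΛ0, hΛ⟩ := lip_comp_clamp (h := hughesFlux v) (h' := fun x => 1 * v x + x * v' x)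
    hρ.le (fun x hx => (hasDerivWithinAt_id x _).mul (hv.hasDeriv x hx))
    ((continuousOn_const.mul fun x hx => (hv.hasDeriv x hx).continuousWithinAt).add
      (continuousOn_id.mul hv.cont))
  refine ⟨Λ, hρ.le, hv.vmax_pos.le, hΛ0, hΛ, ?_, ?_, fun a => ?_, fun a b hab => ?_⟩
  · rw [clampFlux, clamp_of_mem ⟨le_rfl, hρ.le⟩, hughesFlux, zero_mul]
  · rw [clampFlux, clamp_of_mem ⟨hρ.le, le_rfl⟩, hughesFlux, hv.at_max, mul_zero]
  · have := clamp_mem hρ.le a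
    exact mul_nonneg this.1 (hv.range _ this).1
  · have ha := clamp_mem hρ.le a
    have hb := clamp_mem hρ.le b
    have hm := clamp_mono ρmax hab
    have h1 := mul_le_mul_of_nonneg_left (hv.anti.antitoneOn ha hb hm) ha.1
    have h2 := mul_le_mul_of_nonneg_right (hv.range _ hb).2 (sub_nonneg.2 hm)
    have h3 := (le_abs_self _).trans (abs_clamp_sub_le ρmax b a)
    rw [abs_of_nonneg (sub_nonneg.2 hab)] at h3
    have h4 := mul_le_mul_of_nonneg_left h3 hv.vmax_pos.le
    simp only [clampFlux, hughesFlux]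
    linarith

omit hρ in
lemma slope {M : ℝ} (hM : M ∈ Icc 0 ρmax) : ∀ r ∈ Icc 0 M, v M * r ≤ clampFlux v ρmax r :=
  fun r hr => by
    have hr' : r ∈ Icc 0 ρmax := ⟨hr.1, hr.2.trans hM.2⟩
    rw [clampFlux, clamp_of_mem hr', hughesFlux, mul_comm]
    exact mul_le_mul_of_nonneg_left (hv.anti.antitoneOn hr' hM hr.2) hr.1

end SpeedH2

namespace CostH1
variable {ρmax : ℝ} {c c' c'' : ℝ → ℝ} (hc : CostH1 ρmax c c' c'') (hρ : 0 < ρmax)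
include hc

lemma cont : ContinuousOn c (Icc 0 ρmax) := fun x hx => (hc.hasDeriv x hx).continuousWithinAt

lemma cont' : ContinuousOn c' (Icc 0 ρmax) := fun x hx => (hc.hasDeriv2 x hx).continuousWithinAt

lemma deriv_mono : MonotoneOn c' (Icc 0 ρmax) :=
  monotoneOn_of_hasDerivWithinAt_nonneg (convex_Icc _ _) hc.cont'
    (fun x hx => (hc.hasDeriv2 x (interior_subset hx)).mono interior_subset)
    fun x hx => hc.second_nonneg x (interior_subset hx)

lemma tangent_le {r k : ℝ} (hr : r ∈ Icc 0 ρmax) (hk : k ∈ Icc 0 ρmax) :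
    c k + c' k * (r - k) ≤ c r := by
  have hder : ∀ a ∈ Icc 0 ρmax, ∀ b ∈ Icc 0 ρmax, ∀ x ∈ Ioo a b, HasDerivAt c (c' x) x :=
    fun a ha b hb x hx => (hc.hasDeriv x ⟨ha.1.trans hx.1.le, hx.2.le.trans hb.2⟩).hasDerivAt
      (Icc_mem_nhds (ha.1.trans_lt hx.1) (hx.2.trans_le hb.2))
  rcases lt_trichotomy k r with h | h | h
  · obtain ⟨x, hx, hs⟩ := exists_hasDerivAt_eq_slope c c' h
      (hc.cont.mono (Icc_subset_Icc hk.1 hr.2)) (hder k hk r hr)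
    rw [eq_div_iff (by linarith)] at hs
    have := mul_le_mul_of_nonneg_right (hc.deriv_mono hk
      ⟨hk.1.trans hx.1.le, hx.2.le.trans hr.2⟩ hx.1.le) (sub_nonneg.2 h.le)
    linarith
  · rw [h]; linarith
  · obtain ⟨x, hx, hs⟩ := exists_hasDerivAt_eq_slope c c' h
      (hc.cont.mono (Icc_subset_Icc hr.1 hk.2)) (hder r hr k hk)
    rw [eq_div_iff (by linarith)] at hs
    have := mul_le_mul_of_nonneg_right (hc.deriv_mono
      ⟨hr.1.trans hx.1.le, hx.2.le.trans hk.2⟩ hk hx.2.le) (sub_nonneg.2 h.le)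
    linarith

include hρ in
lemma deriv_zero_nonneg : 0 ≤ c' 0 := by
  have h0 : (0 : ℝ) ∈ Icc 0 ρmax := ⟨le_rfl, hρ.le⟩
  rw [← (hc.hasDeriv 0 h0).derivWithin (uniqueDiffOn_Icc hρ 0 h0)]
  exact hc.mono.monotoneOn.derivWithin_nonneg

lemma rep {M r : ℝ} (hM : M ≤ ρmax) (hr : r ∈ Icc 0 M) :
    c r - c 0 - c' 0 * r = ∫ k in (0 : ℝ)..M, c'' k * (max r k - k) := by
  have hcont : ContinuousOn (fun k => c'' k * (max r k - k)) (Icc 0 M) :=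
    (hc.cont2.mono (Icc_subset_Icc_right hM)).mul (by fun_prop)
  have i1 : IntervalIntegrable (fun k => c'' k * (max r k - k)) volume 0 r :=
    (hcont.mono (Icc_subset_Icc_right hr.2)).intervalIntegrable_of_Icc hr.1
  have i2 : IntervalIntegrable (fun k => c'' k * (max r k - k)) volume r M :=
    (hcont.mono (Icc_subset_Icc_left hr.1)).intervalIntegrable_of_Icc hr.2
  rw [← intervalIntegral.integral_add_adjacent_intervals i1 i2]
  have h2 : ∫ k in r..M, c'' k * (max r k - k) = 0 := by
    rw [intervalIntegral.integral_congr (g := fun _ => 0), intervalIntegral.integral_zero]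
    intro k hk
    rw [uIcc_of_le hr.2] at hk
    simp only [max_eq_right hk.1, sub_self, mul_zero]
  have h1 : ∫ k in (0 : ℝ)..r, c'' k * (max r k - k) =
      (c' r * (r - r) + c r) - (c' 0 * (r - 0) + c 0) := by
    have hsub : Icc 0 r ⊆ Icc 0 ρmax := Icc_subset_Icc_right (hr.2.trans hM)
    refine intervalIntegral.integral_eq_sub_of_hasDerivAt_of_le
      (f := fun k => c' k * (r - k) + c k) hr.1
      (((hc.cont'.mono hsub).mul (by fun_prop)).add (hc.cont.mono hsub)) (fun k hk => ?_) i1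
    have hk' := hsub (Ioo_subset_Icc_self hk)
    have hn : Icc 0 ρmax ∈ nhds k := Icc_mem_nhds hk.1 (hk.2.trans_le (hr.2.trans hM))
    have := (((hc.hasDeriv2 k hk').hasDerivAt hn).mul ((hasDerivAt_id k).const_sub r)).add
      ((hc.hasDeriv k hk').hasDerivAt hn)
    refine this.congr_deriv ?_
    rw [max_eq_left hk.2.le]
    simp
  rw [h1, h2]; ring

lemma hasDeriv_legendre {x : ℝ} (hx : x ∈ Icc 0 ρmax) :
    HasDerivWithinAt (fun r => r * c' r - (c r - 1)) (x * c'' x) (Icc 0 ρmax) x := by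
  have := ((hasDerivWithinAt_id x _).mul (hc.hasDeriv2 x hx)).sub
    ((hc.hasDeriv x hx).sub_const 1)
  refine this.congr_deriv ?_
  simp

include hρ in
lemma costOn {M L : ℝ} (hM : M ∈ Icc 0 ρmax) (hL : ∀ x ∈ Icc 0 M, c'' x * x ≤ L) :
    CostOn (fun r => c (clamp ρmax r) - 1) (fun r => c' (clamp ρmax r) - c' 0)
      (fun r => clamp ρmax r * c' (clamp ρmax r) - (c (clamp ρmax r) - 1)) M L (c' 0) := by
  have hsub : Icc 0 M ⊆ Icc 0 ρmax := Icc_subset_Icc_right hM.2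
  have hcl : ∀ r ∈ Icc 0 M, clamp ρmax r = r := fun r hr => clamp_of_mem (hsub hr)
  have h0 : (0 : ℝ) ∈ Icc 0 M := ⟨le_rfl, hM.1⟩
  have mc : Measurable fun r => c (clamp ρmax r) := (hc.cont.comp_continuous
    (continuous_clamp ρmax) (clamp_mem hρ.le)).measurable
  have mc' : Measurable fun r => c' (clamp ρmax r) := (hc.cont'.comp_continuous
    (continuous_clamp ρmax) (clamp_mem hρ.le)).measurable
  have hd : ∀ x ∈ Icc 0 M, HasDerivWithinAt (fun r => r * c' r - (c r - 1)) (x * c'' x)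
      (Icc 0 M) x := fun x hx => (hc.hasDeriv_legendre (hsub hx)).mono hsub
  have hpos : ∀ x ∈ Icc 0 M, 0 ≤ x * c'' x := fun x hx =>
    mul_nonneg hx.1 (hc.second_nonneg x (hsub hx))
  refine ⟨⟨hM.1, ?_, mc'.sub_const _, ?_, ?_, ?_, ?_, ?_, ?_, ?_⟩, hc.deriv_zero_nonneg hρ,
    mc.sub_const _, ?_, ?_, ?_⟩
  · have := hL 0 h0
    rwa [mul_zero] at this
  · exact ((continuous_clamp ρmax).measurable.mul mc').sub (mc.sub_const _)
  · simp only [hcl 0 h0, sub_self]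
  · simp only [hcl 0 h0, hc.at_zero]; ring
  · intro r hr s hs h
    simp only [hcl r hr, hcl s hs]
    exact sub_le_sub_right (hc.deriv_mono (hsub hr) (hsub hs) h) _
  · intro r hr s hs h
    simp only [hcl r hr, hcl s hs]
    exact monotoneOn_of_hasDerivWithinAt_nonneg (convex_Icc 0 M)
      (fun x hx => (hd x hx).continuousWithinAt)
      (fun x hx => (hd x (interior_subset hx)).mono interior_subset)
      (fun x hx => hpos x (interior_subset hx)) hr hs h
  · intro r hr s hs
    simp only [hcl r hr, hcl s hs]
    refine (convex_Icc 0 M).norm_image_sub_le_of_norm_hasDerivWithin_le hd (fun x hx => ?_) hs hr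
    rw [Real.norm_eq_abs, abs_of_nonneg (hpos x hx), mul_comm]
    exact hL x hx
  · intro r hr k hk
    simp only [hcl r hr, hcl k hk]
    have := hc.tangent_le (hsub hr) (hsub hk)
    linarith
  · intro r hr
    simp only [hcl r hr]; ring
  · intro r hr s hs h
    simp only [hcl r hr, hcl s hs]
    exact sub_le_sub_right (hc.mono.monotoneOn (hsub hr) (hsub hs) h) _
  · refine ⟨c'', hc.cont2.mono hsub, fun k hk => hc.second_nonneg k (hsub hk), fun r hr => ?_⟩
    simp only [hcl r hr]
    rw [← hc.rep hM.2 hr, hc.at_zero]; ring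

end CostH1

/-- The initial datum truncated at height `M` and extended by `0` outside `(-1, 1)`. -/
def truncDatum (M : ℝ) (ρ₀ : ℝ → ℝ) (x : ℝ) : ℝ := if x ∈ Ioo (-1 : ℝ) 1 then clamp M (ρ₀ x) else 0

lemma eVariationOn_truncDatum_le (M : ℝ) (ρ₀ : ℝ → ℝ) :
    eVariationOn (truncDatum M ρ₀) (Ioo (-1) 1) ≤ eVariationOn ρ₀ (Ioo (-1) 1) := by
  have h1 : eVariationOn (truncDatum M ρ₀) (Ioo (-1) 1) =
      eVariationOn (clamp M ∘ ρ₀) (Ioo (-1) 1) := eVariationOn.congr fun x hx => if_pos hx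
  rw [h1]
  have h2 : LipschitzOnWith 1 (clamp M) univ := LipschitzOnWith.of_dist_le_mul fun a _ b _ => by
    rw [NNReal.coe_one, one_mul]; exact abs_clamp_sub_le M a b
  have := h2.comp_eVariationOn_le (mapsTo_univ ρ₀ (Ioo (-1) 1))
  rwa [ENNReal.coe_one, one_mul] at this

/-- The cost excess extended to the real line by projecting the density. -/
def clampCost (c : ℝ → ℝ) (R r : ℝ) : ℝ := c (clamp R r) - 1

lemma ae_le_essSup_of_range {R : ℝ} {ρ₀ : ℝ → ℝ}
    (hrange : ∀ x ∈ Ioo (-1 : ℝ) 1, ρ₀ x ∈ Icc 0 R) :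
    ∀ᵐ x ∂(volume.restrict (Ioo (-1 : ℝ) 1)),
      ρ₀ x ≤ essSup ρ₀ (volume.restrict (Ioo (-1 : ℝ) 1)) :=
  ae_le_essSup ⟨R, by
    rw [eventually_map]
    exact (ae_restrict_mem measurableSet_Ioo).mono fun x hx => (hrange x hx).2⟩

lemma nonneg_of_ae_le {R M : ℝ} {ρ₀ : ℝ → ℝ} (hrange : ∀ x ∈ Ioo (-1 : ℝ) 1, ρ₀ x ∈ Icc 0 R)
    (h : ∀ᵐ x ∂(volume.restrict (Ioo (-1 : ℝ) 1)), ρ₀ x ≤ M) : 0 ≤ M := by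
  have : NeZero (volume.restrict (Ioo (-1 : ℝ) 1)) := ⟨by
    rw [Ne, Measure.restrict_eq_zero, Real.volume_Ioo]; norm_num⟩
  obtain ⟨x, hx, hx'⟩ := (h.and (ae_restrict_mem measurableSet_Ioo)).exists
  exact (hrange x hx').1.trans hx

lemma truncDatum_ae_eq {R M : ℝ} {ρ₀ : ℝ → ℝ} (hrange : ∀ x ∈ Ioo (-1 : ℝ) 1, ρ₀ x ∈ Icc 0 R)
    (h : ∀ᵐ x ∂(volume.restrict (Ioo (-1 : ℝ) 1)), ρ₀ x ≤ M) :
    ∀ᵐ x, (if x ∈ Ioo (-1 : ℝ) 1 then ρ₀ x else 0) = truncDatum M ρ₀ x := by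
  rw [ae_restrict_iff' measurableSet_Ioo] at h
  filter_upwards [h] with x hx
  unfold truncDatum
  split_ifs with h1
  · exact (clamp_of_mem ⟨(hrange x h1).1, hx h1⟩).symm
  · rfl

lemma hughesData_truncDatum {ρmax vmax : ℝ} (hρ : 0 < ρmax) {c c' c'' : ℝ → ℝ}
    (hc : CostH1 ρmax c c' c'') {v v' : ℝ → ℝ} (hv : SpeedH2 ρmax vmax v v') {ρ₀ : ℝ → ℝ}
    (hBV : BoundedVariationOn ρ₀ (Ioo (-1 : ℝ) 1)) {M C L : ℝ} (hM0 : 0 ≤ M) (hMlt : M < ρmax)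
    (hC : C = sSup ((fun x => c' x * x) '' Icc 0 M))
    (hL : L = sSup ((fun x => c'' x * x) '' Icc 0 M))
    (hsmall : vmax / 2 * (L * (eVariationOn ρ₀ (Ioo (-1 : ℝ) 1)).toReal + 3 * C) < v M) :
    ∃ Λ g H, HughesData (clampFlux v ρmax) (clampCost c ρmax) g H ρmax vmax Λ (v M) M L (c' 0)
      (eVariationOn ρ₀ (Ioo (-1 : ℝ) 1)).toReal (truncDatum M ρ₀) := by
  have hM : M ∈ Icc 0 ρmax := ⟨hM0, hMlt.le⟩
  have hsub : Icc 0 M ⊆ Icc 0 ρmax := Icc_subset_Icc_right hMlt.le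
  have bdd : ∀ h : ℝ → ℝ, ContinuousOn h (Icc 0 ρmax) →
      ∀ x ∈ Icc 0 M, h x * x ≤ sSup ((fun x => h x * x) '' Icc 0 M) := fun h hh x hx =>
    le_csSup (isCompact_Icc.bddAbove_image ((hh.mono hsub).mul continuousOn_id)) ⟨x, hx, rfl⟩
  obtain ⟨Λ, hΛ⟩ := hv.exists_fluxOn hρ
  refine ⟨Λ, _, _, hΛ, hv.vmax_pos, ?_, (hv.range M hM).2, hv.slope hM, hMlt.le,
    hc.costOn hρ hM (fun x hx => hL ▸ bdd c'' hc.cont2 x hx), fun r => ?_, ?_, fun x => ?_,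
    fun x hx => if_neg hx, ENNReal.toReal_nonneg, ?_, ?_⟩
  · rw [← hv.at_max]; exact hv.anti hM ⟨hρ.le, le_rfl⟩ hMlt
  · exact sub_nonneg.2 (hc.one_le _ (clamp_mem hρ.le r))
  · obtain ⟨Λe, -, h⟩ := lip_comp_clamp hρ.le hc.hasDeriv hc.cont'
    refine ⟨Λe, fun r s => ?_⟩
    simp only [clampCost, sub_sub_sub_cancel_right]
    exact h r s
  · unfold truncDatum
    split_ifs
    · exact clamp_mem hM0 _
    · exact ⟨le_rfl, hM0⟩
  · rw [ENNReal.ofReal_toReal hBV]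
    exact eVariationOn_truncDatum_le M ρ₀
  · have h1 : c' M * M ≤ C := hC ▸ bdd c' hc.cont' M ⟨hM0, le_rfl⟩
    simp only [clampCost, clamp_of_mem hM]
    have h2 := mul_le_mul_of_nonneg_left h1 hv.vmax_pos.le
    linarith

section conversion
variable {ρmax : ℝ} {v c ρ₀ ub : ℝ → ℝ} {ρ : ℝ → ℝ → ℝ} {ξ : ℝ → ℝ} {Λ V : ℝ}

lemma entropy_expr_eq (hf : FluxOn (clampFlux v ρmax) ρmax V Λ) {η : ℝ → ℝ} (hη : Measurable η)
    {p : ℝ × ℝ → ℝ} (hm : Measurable p) (hr : ∀ P, p P ∈ Icc 0 ρmax)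
    (hp : ∀ t, 0 < t → ∀ x, p (t, x) = ρ t x) (hηξ : ∀ t, 0 < t → η t = ξ t)
    {k : ℝ} (hk : k ∈ Icc 0 ρmax) {φ : ℝ × ℝ → ℝ} (h : IsTest φ) :
    (∫ t in Ioi (0 : ℝ), ∫ x : ℝ,
          (|ρ t x - k| * (fderiv ℝ φ (t, x)) (1, 0)
            + hughesKruzhkov v ξ t x (ρ t x) k * (fderiv ℝ φ (t, x)) (0, 1)))
        + 2 * ∫ t in Ioi (0 : ℝ), hughesFlux v k * φ (t, ξ t) =
      ∫ P, (|p P - k| * dT φ P + side η P * (kflux (clampFlux v ρmax) (p P) k -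
        clampFlux v ρmax k) * dX φ P) := by
  rw [← entropy_integral_eq hf hη (.of_range hm hr) k h]
  have hfk : ∀ r ∈ Icc 0 ρmax, clampFlux v ρmax r = hughesFlux v r := fun r hr => by
    rw [clampFlux, clamp_of_mem hr]
  congr 1
  · refine setIntegral_congr_fun measurableSet_Ioi fun t ht => ?_
    refine integral_congr_ae (Eventually.of_forall fun x => ?_)
    have h1 := hr (t, x)
    rw [hp t ht] at h1
    simp only [hp t ht, hηξ t ht, hfk _ h1, hfk k hk, hughesKruzhkov, hughesF, dT, dX]
  · congr 1
    refine setIntegral_congr_fun measurableSet_Ioi fun t ht => ?_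
    simp only [hfk k hk, hηξ t ht]

lemma continuousOn_bal {q : ℝ × ℝ → ℝ} (hq : TimeL1 q) {η : ℝ → ℝ}
    (hη : ContinuousOn η (Ici 0)) (hmem : ∀ t, η t ∈ Ioo (-1 : ℝ) 1) :
    ContinuousOn (fun t => bal (fun x => q (t, x)) (η t)) (Ici 0) := fun s hs => by
  have h1 : Tendsto (fun t => bal (fun x => q (t, x)) (η t) - bal (fun x => q (s, x)) (η t))
      (nhdsWithin s (Ici 0)) (nhds 0) := by
    refine squeeze_zero_norm' ?_ (hq.cont s hs)
    filter_upwards [self_mem_nhdsWithin] with t ht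
    exact abs_bal_sub_bal_le (hq.int t ht) (hq.int s hs) (Ioo_subset_Icc_self (hmem t))
  have h2 := ((continuous_bal (hq.int s hs)).continuousAt.tendsto).comp (hη s hs)
  have h3 := h1.add h2
  rw [zero_add] at h3
  exact h3.congr fun t => sub_add_cancel _ _

lemma setIntegral_cost {g : ℝ → ℝ} (hg : ∀ x, g x ∈ Icc 0 ρmax) (A : Set ℝ) :
    ∫ x in A, c (g x) = ∫ x in A, (1 + clampCost c ρmax (g x)) := by
  congr 1; ext x
  rw [clampCost, clamp_of_mem (hg x)]; ring

lemma timeL1_clampCost (h0 : clampCost c ρmax 0 = 0) (hcm : Measurable (clampCost c ρmax))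
    (hcl : ∃ Λe : ℝ, ∀ r s, |clampCost c ρmax r - clampCost c ρmax s| ≤ Λe * |r - s|)
    {p : ℝ × ℝ → ℝ} (hp : TimeL1 p) (hm : Measurable p) :
    TimeL1 fun P => clampCost c ρmax (p P) := by
  obtain ⟨Λe, hΛ⟩ := hcl
  refine hp.of_le (C := Λe) (hcm.comp hm) (fun t _ x => ?_) fun s t _ _ x => hΛ _ _
  have := hΛ (p (t, x)) 0
  rwa [h0, sub_zero, sub_zero] at this

lemma IsEntropySol.hughesSol (h : IsEntropySol ρmax v c ρ₀ ρ ξ) (hρ : 0 ≤ ρmax)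
    (hf : FluxOn (clampFlux v ρmax) ρmax V Λ)
    (h0 : clampCost c ρmax 0 = 0) (hcm : Measurable (clampCost c ρmax))
    (hcl : ∃ Λe : ℝ, ∀ r s, |clampCost c ρmax r - clampCost c ρmax s| ≤ Λe * |r - s|)
    (hub : ∀ᵐ x, (if x ∈ Ioo (-1 : ℝ) 1 then ρ₀ x else 0) = ub x) :
    HughesSol (clampFlux v ρmax) (clampCost c ρmax) ρmax ub (fun t => ξ (max t 0))
      (fun P => if 0 ≤ P.1 then ρ P.1 P.2 else 0) := by
  obtain ⟨Q, hQ⟩ := h.xi_lip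
  have hm : Measurable fun P : ℝ × ℝ => if 0 ≤ P.1 then ρ P.1 P.2 else 0 :=
    Measurable.ite (measurableSet_le measurable_const measurable_fst) h.meas measurable_const
  have hr : ∀ P : ℝ × ℝ, (if 0 ≤ P.1 then ρ P.1 P.2 else 0) ∈ Icc 0 ρmax := fun P => by
    split_ifs with h1
    · exact h.range _ _ h1
    · exact ⟨le_rfl, hρ⟩
  have hT : TimeL1 fun P : ℝ × ℝ => if 0 ≤ P.1 then ρ P.1 P.2 else 0 :=
    ⟨fun t ht => by simpa [ht] using h.integrable t ht, fun s hs => by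
      refine (h.timeCont s hs).congr' ?_
      filter_upwards [self_mem_nhdsWithin] with t ht
      simp only [if_pos (mem_Ici.1 ht), if_pos hs]⟩
  have hcont : Continuous fun t => ξ (max t 0) :=
    hQ.continuousOn.comp_continuous (by fun_prop) fun t => mem_Ici.2 (le_max_right _ _)
  refine ⟨hm, hr, hT, ?_, fun t => h.xi_mem _, hcont.measurable, ⟨Q, fun s t hs ht => ?_⟩, ?_, ?_⟩
  · filter_upwards [h.init, hub] with x h1 h2
    rw [if_pos le_rfl, h1, h2]
  · rw [max_eq_left hs, max_eq_left ht]
    exact hQ.dist_le_mul t ht s hs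
  · have hTc := timeL1_clampCost h0 hcm hcl hT hm
    have hae : (fun t => bal (fun x => clampCost c ρmax (if 0 ≤ t then ρ t x else 0))
        (ξ (max t 0))) =ᵐ[volume.restrict (Ici 0)] fun _ => 0 := by
      rw [Filter.EventuallyEq, ← restrict_Ioi_eq_restrict_Ici]
      filter_upwards [h.balance, ae_restrict_mem measurableSet_Ioi] with t hb ht
      have ht0 : (0 : ℝ) ≤ t := le_of_lt ht
      have hi := hTc.int t ht0
      simp only [if_pos ht0, max_eq_left ht0] at hi ⊢
      rw [← setIntegral_sub_eq_bal hi (Ioo_subset_Icc_self (h.xi_mem t)),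
        ← setIntegral_cost (fun x => h.range t x ht0),
        ← setIntegral_cost (fun x => h.range t x ht0), hb, sub_self]
    have hcl0 : Ici (0 : ℝ) ⊆ closure (interior (Ici 0)) := by rw [interior_Ici, closure_Ioi]
    exact Measure.eqOn_of_ae_eq hae (continuousOn_bal hTc hcont.continuousOn fun t => h.xi_mem _)
      continuousOn_const hcl0
  · intro k hk φ hφ _
    rw [← entropy_expr_eq (ρ := ρ) (ξ := ξ) hf hcont.measurable hm hr
      (fun t ht x => if_pos ht.le) (fun t ht => by rw [max_eq_left ht.le]) hk hφ]
    exact h.entropy k hk φ hφ.smooth hφ.cpt hφ.zero hφ.nonneg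

lemma HughesSol.isEntropySol {η : ℝ → ℝ} {p : ℝ × ℝ → ℝ}
    (h : HughesSol (clampFlux v ρmax) (clampCost c ρmax) ρmax ub η p)
    (hf : FluxOn (clampFlux v ρmax) ρmax V Λ)
    (h0 : clampCost c ρmax 0 = 0) (hcm : Measurable (clampCost c ρmax))
    (hcl : ∃ Λe : ℝ, ∀ r s, |clampCost c ρmax r - clampCost c ρmax s| ≤ Λe * |r - s|)
    (hub : ∀ᵐ x, (if x ∈ Ioo (-1 : ℝ) 1 then ρ₀ x else 0) = ub x) :
    IsEntropySol ρmax v c ρ₀ (fun t x => p (t, x)) η where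
  meas := h.meas
  range t x _ := h.range _
  integrable := h.time.int
  timeCont := h.time.cont
  init := by
    filter_upwards [h.init, hub] with x h1 h2
    rw [h1, h2]
  xi_mem := h.mem
  xi_lip := by
    obtain ⟨Q, hQ⟩ := h.lip
    refine ⟨Q.toNNReal, LipschitzOnWith.of_dist_le_mul fun t ht s hs => ?_⟩
    exact (hQ s t hs ht).trans (mul_le_mul_of_nonneg_right (Real.le_coe_toNNReal Q) (abs_nonneg _))
  balance := by
    filter_upwards [ae_restrict_mem measurableSet_Ioi] with t ht
    have ht0 : (0 : ℝ) ≤ t := le_of_lt ht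
    rw [setIntegral_cost (fun x => h.range (t, x)), setIntegral_cost (fun x => h.range (t, x)),
      ← sub_eq_zero, setIntegral_sub_eq_bal ((timeL1_clampCost h0 hcm hcl h.time h.meas).int t ht0)
        (Ioo_subset_Icc_self (h.mem t))]
    exact h.balance t ht0
  entropy k hk φ h1 h2 h3 h4 := by
    have hφ : IsTest φ := ⟨h1, h2, h3, h4⟩
    rw [entropy_expr_eq hf h.meas_eta h.meas h.range (fun _ _ _ => rfl) (fun _ _ => rfl) hk hφ]
    exact h.entropy k hk φ hφ fun _ _ => mem_univ _

end conversion

/-- Theorem 1.3 of Di Francesco–Fagioli–Rosini–Russo: under (H1) with `c'' > 0`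
and (H2), if `ρ₀ ∈ BV((−1,1);[0,ρmax])` with `M := ‖ρ₀‖_∞ < ρmax` satisfies
`(vmax/2)·(L·TV(ρ₀) + 3·C) < v(M)`, where `C = max{c'(ρ)·ρ : ρ ∈ [0,M]}` and
`L = max{c''(ρ)·ρ : ρ ∈ [0,M]}`, then there exists a unique BV-regular entropy
solution defined globally in time. -/
theorem hughes_DPA_existence_uniqueness
    (ρmax vmax : ℝ) (hρmax : 0 < ρmax)
    (c c' c'' : ℝ → ℝ) (hc : CostH1 ρmax c c' c'')
    (hc2pos : ∀ x ∈ Icc (0 : ℝ) ρmax, 0 < c'' x)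
    (v v' : ℝ → ℝ) (hv : SpeedH2 ρmax vmax v v')
    (ρ₀ : ℝ → ℝ) (hmeas : Measurable ρ₀)
    (hrange : ∀ x ∈ Ioo (-1 : ℝ) 1, ρ₀ x ∈ Icc (0 : ℝ) ρmax)
    (hBV : BoundedVariationOn ρ₀ (Ioo (-1 : ℝ) 1))
    (M : ℝ) (hM : M = essSup ρ₀ (volume.restrict (Ioo (-1 : ℝ) 1))) (hMlt : M < ρmax)
    (C L : ℝ)
    (hC : C = sSup ((fun x => c' x * x) '' Icc 0 M))
    (hL : L = sSup ((fun x => c'' x * x) '' Icc 0 M))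
    (hsmall : vmax / 2 * (L * (eVariationOn ρ₀ (Ioo (-1 : ℝ) 1)).toReal + 3 * C) < v M) :
    ∃ ρ : ℝ → ℝ → ℝ, ∃ ξ : ℝ → ℝ,
      IsBVEntropySol ρmax v c ρ₀ ρ ξ ∧
      ∀ ρ' : ℝ → ℝ → ℝ, ∀ ξ' : ℝ → ℝ,
        IsBVEntropySol ρmax v c ρ₀ ρ' ξ' →
        (∀ t : ℝ, 0 ≤ t → ξ' t = ξ t) ∧
        ∀ᵐ p : ℝ × ℝ, 0 < p.1 → ρ' p.1 p.2 = ρ p.1 p.2 := by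
  have hae := hM ▸ ae_le_essSup_of_range hrange
  obtain ⟨Λ, g, H, S⟩ := hughesData_truncDatum hρmax hc hv hBV (nonneg_of_ae_le hrange hae) hMlt
    hC hL hsmall
  have hub := truncDatum_ae_eq hrange hae
  obtain ⟨η, p, h, hvar, huniq⟩ := S.exists_unique
  refine ⟨fun t x => p (t, x), η, ⟨h.isEntropySol S.flux S.cost_zero S.cost.meas S.cost_lip hub,
    fun T _ => ⟨_, ENNReal.ofReal_lt_top, fun t _ =>
      (eVariationOn.mono _ (subset_univ _)).trans (hvar t)⟩⟩, fun ρ' ξ' h' => ?_⟩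
  obtain ⟨h1, h2⟩ := huniq _ _
    (h'.1.hughesSol hρmax.le S.flux S.cost_zero S.cost.meas S.cost_lip hub)
  refine ⟨fun t ht => ?_, ?_⟩
  · have := h1 t ht
    simpa only [max_eq_left ht] using this
  · refine ae_prod_of_forall_ae (p := fun P => 0 < P.1 → ρ' P.1 P.2 = p (P.1, P.2))
      (measurableSet_setOf_imp (measurableSet_lt measurable_const measurable_fst)
        (measurableSet_setOf_eq_fun h'.1.meas h.meas)) fun t => ?_
    by_cases ht : 0 < t
    · filter_upwards [h2 t ht] with x hx _
      rwa [if_pos ht.le] at hx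
    · exact Eventually.of_forall fun x hx => absurd hx ht

end
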